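/- Let n ∈ ℕ. Let (C,u) be an equicharacteristic ℤ-valued field with uniformizer π such that O_u is excellent, and let (K,v) and (L,w) be henselian valued field extensions of (C,u) in which π is still a uniformizer, such that the residue field extensions Kv/Cu and Lw/Cu are separable. Assume (R4_n) holds. If Th_{∃_n}(Kv,Cu) ⊆ Th_{∃_n}(Lw,Cu) (as L_ring(Cu)-theories), then Th_{∃_n}(K,C) ⊆ Th_{∃_n}(L,C) (as L_ring(C)-theories). -/

import Mathlib

open FirstOrder FirstOrder.Language

universe u v w x

namespace Paper



/-! ### Syntactic fragments -/

/-- `IsExistsN n φ`: `φ` is an `∃_n`-formula, i.e. of the form `∃ x₁ … x_m ψ`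
with `m ≤ n` and `ψ` quantifier-free. -/
inductive IsExistsN {L : Language} {α : Type*} : ℕ → ∀ {k : ℕ}, L.BoundedFormula α k → Prop
  | qf {n k : ℕ} {φ : L.BoundedFormula α k} : φ.IsQF → IsExistsN n φ
  | ex {n k : ℕ} {φ : L.BoundedFormula α (k + 1)} : IsExistsN n φ → IsExistsN (n + 1) φ.ex

/-- `φ` is an existential formula. -/
def IsExists {L : Language} {α : Type*} {k : ℕ} (φ : L.BoundedFormula α k) : Prop :=
  ∃ n : ℕ, IsExistsN n φ

/-- Positive boolean combinations of formulas satisfying `P`. -/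
inductive IsPosBC {L : Language} {α : Type*} (P : ∀ {k : ℕ}, L.BoundedFormula α k → Prop) :
    ∀ {k : ℕ}, L.BoundedFormula α k → Prop
  | base {k : ℕ} {φ : L.BoundedFormula α k} : P φ → IsPosBC P φ
  | inf {k : ℕ} {φ ψ : L.BoundedFormula α k} :
      IsPosBC P φ → IsPosBC P ψ → IsPosBC P (φ ⊓ ψ)
  | sup {k : ℕ} {φ ψ : L.BoundedFormula α k} :
      IsPosBC P φ → IsPosBC P ψ → IsPosBC P (φ ⊔ ψ)

/-- The `∃₁`-fragment: positive boolean combinations of formulas of the form `η` or `∃ y η`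
with `η` quantifier-free. -/
def IsE1 {L : Language} {α : Type*} {k : ℕ} (φ : L.BoundedFormula α k) : Prop :=
  IsPosBC (fun {k} φ => φ.IsQF ∨ ∃ ψ : L.BoundedFormula α (k + 1), ψ.IsQF ∧ φ = ψ.ex) φ

/-- `∃_n∃₁`-formulas: `∃ x₁ … x_m ψ` with `m ≤ n` and `ψ` in the `∃₁`-fragment. -/
inductive IsExistsNE1 {L : Language} {α : Type*} : ℕ → ∀ {k : ℕ}, L.BoundedFormula α k → Prop
  | e1 {n k : ℕ} {φ : L.BoundedFormula α k} : IsE1 φ → IsExistsNE1 n φ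
  | ex {n k : ℕ} {φ : L.BoundedFormula α (k + 1)} : IsExistsNE1 n φ → IsExistsNE1 (n + 1) φ.ex

/-- The `∃^n`-fragments, defined inductively: `∃^0`-formulas are the quantifier-free ones,
and an `∃^{n+1}`-formula is of the form `ψ` or `∃ x ψ` with `ψ` a positive boolean
combination of `∃^n`-formulas. -/
def IsExpN {L : Language} {α : Type*} : ℕ → ∀ {k : ℕ}, L.BoundedFormula α k → Prop
  | 0, _, φ => φ.IsQF
  | n + 1, k, φ => IsPosBC (IsExpN n) φ ∨
      ∃ ψ : L.BoundedFormula α (k + 1), IsPosBC (IsExpN n) ψ ∧ φ = ψ.ex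



/-! ### The language of rings with constants, and realization -/

/-- The `Language.ring`-structure on a ring. -/
noncomputable def ringStructure (M : Type*) [CommRing M] : Language.ring.Structure M :=
  (FirstOrder.Ring.compatibleRingOfRing M).toStructure

/-- The `L_ring(α)`-structure on a ring `M` with constants interpreted via `f : α → M`. -/
noncomputable def ringConStructure {α M : Type*} [CommRing M] (f : α → M) :
    (Language.ring[[α]]).Structure M :=
  letI := ringStructure M
  letI := constantsOn.structure f
  inferInstance

/-- `M ⊨ φ` for an `L_ring(α)`-sentence, with constants interpreted via `f`. -/
def RealizeRing (M : Type*) [CommRing M] {α : Type*} (f : α → M)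
    (φ : (Language.ring[[α]]).Sentence) : Prop :=
  @Sentence.Realize _ M (ringConStructure f) φ

/-- The unary relation symbol `O` for the valuation ring. -/
inductive ValRel : ℕ → Type
  | isO : ValRel 1

/-- The language with a single unary predicate `O`. -/
def oLang : Language := ⟨fun _ => Empty, ValRel⟩

/-- The language of valued fields `L_val = L_ring ∪ {O}`. -/
abbrev Lval : Language := Language.ring.sum oLang

/-- The `oLang`-structure on `M` in which `O` is interpreted as the set `O`. -/
def oStructure {M : Type*} (O : Set M) : oLang.Structure M where
  funMap := fun f _ => f.elim
  RelMap := fun {_} r => match r with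
    | .isO => fun xs => xs 0 ∈ O

/-- The `L_val(α)`-structure on a ring `M`, with `O` interpreted as the set `O` and
constants interpreted via `f : α → M`. -/
noncomputable def valConStructure {α M : Type*} [CommRing M] (O : Set M) (f : α → M) :
    (Lval[[α]]).Structure M :=
  letI := ringStructure M
  letI := oStructure O
  letI : Lval.Structure M := inferInstance
  letI := constantsOn.structure f
  inferInstance

/-- `M ⊨ φ` for an `L_val(α)`-sentence. -/
def RealizeVal (M : Type*) [CommRing M] (O : Set M) {α : Type*} (f : α → M)
    (φ : (Lval[[α]]).Sentence) : Prop :=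
  @Sentence.Realize _ M (valConStructure O f) φ



abbrev Zm0 : Type := WithZero (Multiplicative ℤ)

variable {K : Type*} [Field K] {Γ : Type*} [LinearOrderedCommGroupWithZero Γ]

/-- `π` is a uniformizer of `(K, v)`: `v π` is minimal positive
(multiplicatively: `0 < v π < 1` and `v π` is the largest value `< 1`). -/
def IsUniformizer (v : Valuation K Γ) (π : K) : Prop :=
  0 < v π ∧ v π < 1 ∧ ∀ x : K, v x < 1 → v x ≤ v π

/-- The valuation ring of `v`, as a set. -/
def Oset (v : Valuation K Γ) : Set K := {x | v x ≤ 1}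

/-- The residue field `Kv` of the valued field `(K, v)`. -/
abbrev ResF (v : Valuation K Γ) : Type _ :=
  IsLocalRing.ResidueField v.valuationSubring

/-- The residue map `O_v → Kv`. -/
abbrev resMap (v : Valuation K Γ) : v.valuationSubring →+* ResF v :=
  IsLocalRing.residue _

/-- `(K, v)` is a henselian valued field. -/
abbrev IsHenselian (v : Valuation K Γ) : Prop :=
  HenselianLocalRing v.valuationSubring

/-- compatibility of a ring homomorphism between residue fields with the residue maps,
for an extension `(K, v)` of `(C, u)`. -/
def ResCompat {C : Type*} [Field C] {Γ₀ : Type*} [LinearOrderedCommGroupWithZero Γ₀]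
    (u : Valuation C Γ₀) [Algebra C K] (v : Valuation K Γ)
    (g : ResF u →+* ResF v) : Prop :=
  ∀ (x : u.valuationSubring) (hx : algebraMap C K ↑x ∈ v.valuationSubring),
    g (resMap u x) = resMap v ⟨algebraMap C K ↑x, hx⟩

/-- `(K, v)` is complete (with respect to the valuation uniformity). -/
def IsCompleteValued (v : Valuation K Γ) : Prop :=
  letI : Valued K Γ := Valued.mk' v
  CompleteSpace K



/-- `E/F` admits a separating transcendence basis. -/
def HasSepTransBasis (F E : Type*) [Field F] [Field E] [Algebra F E] : Prop :=
  ∃ s : Set E, AlgebraicIndependent F ((↑) : s → E) ∧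
    Algebra.IsSeparable (IntermediateField.adjoin F s) E

/-- The field extension `E/F` is separable: every finitely generated subextension
admits a separating transcendence basis. -/
def IsSepExt (F E : Type*) [Field F] [Field E] [Algebra F E] : Prop :=
  ∀ s : Finset E, HasSepTransBasis F (IntermediateField.adjoin F (s : Set E))

/-- The extension given by a ring homomorphism `f : F →+* E` of fields is separable. -/
def IsSepExtHom {F E : Type*} [Field F] [Field E] (f : F →+* E) : Prop :=
  letI := f.toAlgebra
  IsSepExt F E

/-- `trdeg(E/F) ≤ d`: there is a finite transcendence basis with at most `d` elements. -/
def TrdegLE (F E : Type*) [CommRing F] [CommRing E] [Algebra F E] (d : ℕ) : Prop :=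
  ∃ s : Finset E, s.card ≤ d ∧ IsTranscendenceBasis F (Subtype.val : ((s : Set E)) → E)

/-- `F` is a large field: `F` is existentially closed in `F((t))`. -/
def LargeField (F : Type u) [Field F] : Prop :=
  ∀ φ : (Language.ring[[F]]).Sentence, IsExists φ →
    RealizeRing (LaurentSeries F) (algebraMap F (LaurentSeries F)) φ →
    RealizeRing F (id : F → F) φ

/-- `(R4_n)`: whenever a valuation `w` on a field `E` is trivial on a large subfield `F` of `E`
with residue field `Eu = F` (via the residue map), every `∃_n`-`L_ring(F)`-sentence true in `E`
is true in `F`. -/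
def R4N (n : ℕ) : Prop :=
  ∀ (E : Type u) [Field E] (Γ : Type u) [LinearOrderedCommGroupWithZero Γ]
    (w : Valuation E Γ) (F : Subfield E),
    LargeField.{u} F →
    (∀ y : F, (y : E) ≠ 0 → w y = 1) →
    (∀ y : E, w y ≤ 1 → ∃ x : F, w (y - x) < 1) →
    ∀ φ : (Language.ring[[F]]).Sentence, IsExistsN n φ →
      RealizeRing E ((↑) : F → E) φ → RealizeRing F (id : F → F) φ

/-- Excellence of the valuation ring of an (equicharacteristic, `ℤ`-valued) valued field
`(C, u)`, via the characterization: the fraction field of the completion (i.e. the completion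
of `C`) is a separable extension of `C`. -/
def ExcellentCompletion (C : Type u) [Field C] (u : Valuation C Zm0) : Prop :=
  letI : Valued C Zm0 := Valued.mk' u
  letI : Field (UniformSpace.Completion C) := UniformSpace.Completion.instField
  IsSepExtHom (UniformSpace.Completion.coeRingHom : C →+* UniformSpace.Completion C)


/-- `Th_P(K, fK) ⊆ Th_P(L, fL)`: every positive boolean combination of `L_ring(α)`-sentences
of the fragment `P` that is true in `K` is true in `L`. -/
def ThRingSub {α : Type*} (P : ∀ {k : ℕ}, (Language.ring[[α]]).BoundedFormula Empty k → Prop)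
    (K : Type*) [CommRing K] (fK : α → K) (L : Type*) [CommRing L] (fL : α → L) : Prop :=
  ∀ φ : (Language.ring[[α]]).Sentence, IsPosBC P φ →
    RealizeRing K fK φ → RealizeRing L fL φ

/-- `Th_P(K, OK, fK) ⊆ Th_P(L, OL, fL)` for `L_val(α)`-sentences. -/
def ThValSub {α : Type*} (P : ∀ {k : ℕ}, (Lval[[α]]).BoundedFormula Empty k → Prop)
    (K : Type*) [CommRing K] (OK : Set K) (fK : α → K)
    (L : Type*) [CommRing L] (OL : Set L) (fL : α → L) : Prop :=
  ∀ φ : (Lval[[α]]).Sentence, IsPosBC P φ →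
    RealizeVal K OK fK φ → RealizeVal L OL fL φ

end Paper

namespace Paper

/-! ### Preservation of `p`-independence -/

/-- Families of `F` that are linearly independent over `F ^ p` stay linearly independent over
`E ^ p`. -/
def PInd (p : ℕ) {F E : Type*} [Field F] [Field E] (φ : F →+* E) : Prop :=
  ∀ (m : ℕ) (c : Fin m → F), (∀ x : Fin m → F, ∑ i, c i * x i ^ p = 0 → ∀ i, x i = 0) →
    ∀ x : Fin m → E, ∑ i, φ (c i) * x i ^ p = 0 → ∀ i, x i = 0

section PInd

variable {p : ℕ} {F E E' : Type*} [Field F] [Field E] [Field E']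

lemma PInd.fintype {φ : F →+* E} (h : PInd p φ) {ι : Type*} [Fintype ι] (c : ι → F)
    (hc : ∀ x : ι → F, ∑ i, c i * x i ^ p = 0 → ∀ i, x i = 0)
    (x : ι → E) (hx : ∑ i, φ (c i) * x i ^ p = 0) (i : ι) : x i = 0 := by
  classical
  let e := Fintype.equivFin ι
  have := h (Fintype.card ι) (c ∘ e.symm) (fun y hy j => by
    have := hc (y ∘ e) (by
      rw [← hy]
      exact Fintype.sum_equiv e _ _ (by simp)) (e.symm j)
    simpa using this) (x ∘ e.symm) (by
      rw [← hx]
      exact (Fintype.sum_equiv e _ _ (by simp)).symm) (e i)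
  simpa using this

lemma PInd.comp {φ : F →+* E} {ψ : E →+* E'} (h : PInd p φ) (h' : PInd p ψ) :
    PInd p (ψ.comp φ) := by
  intro m c hc x hx
  exact h' m (fun i => φ (c i)) (h m c hc) x (by simpa using hx)

lemma PInd.of_comp {φ : F →+* E} {ψ : E →+* E'} (h : PInd p (ψ.comp φ)) : PInd p φ := by
  intro m c hc x hx i
  have := h m c hc (fun i => ψ (x i)) (by
    have := congrArg ψ hx
    simpa using this) i
  exact (map_eq_zero ψ).1 this

lemma PInd.of_span [Algebra F E] [ExpChar E p] {κ : Type*} (v : κ → E)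
    (hv : LinearIndependent F (fun k => v k ^ p))
    (hspan : ∀ (m : ℕ) (x : Fin m → E), ∃ d : E, d ≠ 0 ∧
      ∀ i, d * x i ∈ Submodule.span F (Set.range v)) :
    PInd p (algebraMap F E) := by
  classical
  intro m c hc x hx
  obtain ⟨d, hd, hdx⟩ := hspan m x
  simp only [Finsupp.mem_span_range_iff_exists_finsupp] at hdx
  choose a ha using hdx
  have key : ∑ i, algebraMap F E (c i) * (d * x i) ^ p = 0 := by
    have : ∑ i, algebraMap F E (c i) * (d * x i) ^ p
        = d ^ p * ∑ i, algebraMap F E (c i) * (x i) ^ p := by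
      rw [Finset.mul_sum]
      exact Finset.sum_congr rfl fun i _ => by ring
    rw [this, hx, mul_zero]
  let S : Finset κ := Finset.univ.biUnion fun i => (a i).support
  have ha' : ∀ i, d * x i = ∑ k ∈ S, a i k • v k := by
    intro i
    rw [← ha i, Finsupp.sum_of_support_subset _ _ _ (by simp)]
    intro k hk
    exact Finset.mem_biUnion.2 ⟨i, Finset.mem_univ _, hk⟩
  have e1 : ∀ i, (d * x i) ^ p = ∑ k ∈ S, (a i k) ^ p • v k ^ p := by
    intro i
    rw [ha' i]
    have := map_sum (frobenius E p) (fun k => a i k • v k) S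
    simp only [frobenius_def] at this
    rw [this]
    exact Finset.sum_congr rfl fun k _ => by rw [smul_pow]
  have e2 : ∑ k ∈ S, (∑ i, c i * a i k ^ p) • v k ^ p = 0 := by
    rw [← key]
    simp only [e1, Finset.mul_sum, Finset.sum_smul]
    rw [Finset.sum_comm]
    refine Finset.sum_congr rfl fun i _ => Finset.sum_congr rfl fun k _ => ?_
    rw [mul_smul, Algebra.smul_def (c i)]
  have e3 := linearIndependent_iff'.1 hv S _ e2
  intro i
  have : d * x i = 0 := by
    rw [ha' i]
    refine Finset.sum_eq_zero fun k hk => ?_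
    rw [hc _ (e3 k hk) i, zero_smul]
  exact (mul_eq_zero.1 this).resolve_left hd

lemma PInd.of_isSeparable [Algebra F E] [ExpChar F p] [Algebra.IsSeparable F E] :
    PInd p (algebraMap F E) := by
  have : ExpChar E p := expChar_of_injective_algebraMap (algebraMap F E).injective p
  let b := Module.Basis.ofVectorSpace F E
  refine PInd.of_span b ?_ ?_
  · have := LinearIndependent.map_pow_expChar_pow_of_isSeparable (v := b) p 1 b.linearIndependent
    simpa using this
  · intro m x
    refine ⟨1, one_ne_zero, fun i => ?_⟩
    rw [b.span_eq]
    trivial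

lemma PInd.of_algebraicIndependent [Algebra F E] [ExpChar F p] {ι : Type*} {v : ι → E}
    (hv : AlgebraicIndependent F v) (htop : IntermediateField.adjoin F (Set.range v) = ⊤) :
    PInd p (algebraMap F E) := by
  have : ExpChar E p := expChar_of_injective_algebraMap (algebraMap F E).injective p
  have hp : 0 < p := expChar_pos F p
  have hli : LinearIndependent F
      (fun m : ι →₀ ℕ => MvPolynomial.aeval v (MvPolynomial.monomial m (1 : F))) := by
    have h1 := (MvPolynomial.basisMonomials ι F).linearIndependent
    have h2 := h1.map' (MvPolynomial.aeval v).toLinearMap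
      (LinearMap.ker_eq_bot.2 hv)
    simpa [Function.comp_def] using h2
  have hrange : (MvPolynomial.aeval (R := F) v).range = Algebra.adjoin F (Set.range v) :=
    (Algebra.adjoin_range_eq_range_aeval F v).symm
  refine PInd.of_span
    (fun m : ι →₀ ℕ => MvPolynomial.aeval v (MvPolynomial.monomial m (1 : F))) ?_ ?_
  · have h3 : LinearIndependent F ((fun m : ι →₀ ℕ =>
        MvPolynomial.aeval v (MvPolynomial.monomial m (1 : F))) ∘ fun m => p • m) :=
      hli.comp _ fun a b hab => by
        ext i
        have := DFunLike.congr_fun hab i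
        simp only [Finsupp.coe_smul, Pi.smul_apply, smul_eq_mul] at this
        exact Nat.eq_of_mul_eq_mul_left hp this
    convert h3 using 2 with m
    simp only [Function.comp]
    rw [← map_pow, MvPolynomial.monomial_pow, one_pow]
  · intro m x
    have hx : ∀ e : E, ∃ d ∈ Algebra.adjoin F (Set.range v), d ≠ 0 ∧
        d * e ∈ Algebra.adjoin F (Set.range v) := by
      intro e
      have he : e ∈ IntermediateField.adjoin F (Set.range v) := htop ▸ trivial
      rw [IntermediateField.mem_adjoin_iff_div] at he
      obtain ⟨r, hr, s, hs, rfl⟩ := he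
      by_cases h0 : s = 0
      · exact ⟨1, one_mem _, one_ne_zero, by simp [h0, zero_mem]⟩
      · exact ⟨s, hs, h0, by rwa [mul_div_cancel₀ _ h0]⟩
    choose d hd hd0 hde using hx
    refine ⟨∏ i, d (x i), Finset.prod_ne_zero_iff.2 fun i _ => hd0 _, fun i => ?_⟩
    have hmem : (∏ i, d (x i)) * x i ∈ Algebra.adjoin F (Set.range v) := by
      classical
      rw [← Finset.mul_prod_erase _ _ (Finset.mem_univ i), mul_comm (d (x i)), mul_assoc]
      exact mul_mem (prod_mem fun j _ => hd _) (hde _)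
    rw [← hrange] at hmem
    obtain ⟨q, hq⟩ := hmem
    rw [← hq]
    change MvPolynomial.aeval v q ∈ _
    rw [MvPolynomial.as_sum q, map_sum]
    refine sum_mem fun k _ => ?_
    have : MvPolynomial.monomial k (q.coeff k) = (q.coeff k) • MvPolynomial.monomial k (1 : F) := by
      simp [MvPolynomial.smul_monomial]
    rw [this, map_smul]
    exact Submodule.smul_mem _ _ (Submodule.subset_span ⟨k, rfl⟩)

lemma PInd.of_hasSepTransBasis [Algebra F E] [ExpChar F p] (h : HasSepTransBasis F E) :
    PInd p (algebraMap F E) := by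
  obtain ⟨s, hs, hsep⟩ := h
  rw [IsScalarTower.algebraMap_eq F (IntermediateField.adjoin F s) E]
  have hE : ExpChar (IntermediateField.adjoin F s) p :=
    expChar_of_injective_algebraMap (algebraMap F _).injective p
  refine PInd.comp ?_ PInd.of_isSeparable
  let v : s → IntermediateField.adjoin F s :=
    fun i => ⟨i, IntermediateField.subset_adjoin F s i.2⟩
  have hv : AlgebraicIndependent F v := by
    refine AlgebraicIndependent.of_comp (IntermediateField.adjoin F s).val ?_
    exact hs
  refine PInd.of_algebraicIndependent hv ?_
  apply IntermediateField.map_injective (IntermediateField.adjoin F s).val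
  rw [IntermediateField.adjoin_map, ← AlgHom.fieldRange_eq_map, IntermediateField.fieldRange_val]
  congr 1
  ext y
  simpa [v] using fun hy => IntermediateField.subset_adjoin F s hy

lemma PInd.of_isSepExt [Algebra F E] [ExpChar F p] (h : IsSepExt F E) :
    PInd p (algebraMap F E) := by
  classical
  intro m c hc x hx i
  let s : Finset E := Finset.univ.image x
  have hx' : ∀ i, x i ∈ IntermediateField.adjoin F (s : Set E) := fun i =>
    IntermediateField.subset_adjoin F _ (by simp [s])
  have := PInd.of_hasSepTransBasis (p := p) (h s) m c hc (fun i => ⟨x i, hx' i⟩) (by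
    apply Subtype.ext
    simpa using hx) i
  exact congrArg Subtype.val this

lemma PInd.of_isSepExtHom [ExpChar F p] {φ : F →+* E} (h : IsSepExtHom φ) : PInd p φ := by
  let := φ.toAlgebra
  exact PInd.of_isSepExt (p := p) h

end PInd

end Paper

namespace Paper

section PInd

variable {p : ℕ} {F E E' : Type*} [Field F] [Field E] [Field E']

lemma PInd.linearIndependent_pow [Algebra F E] [ExpChar F p] (h : PInd p (algebraMap F E))
    {κ : Type*} {v : κ → E} (hv : LinearIndependent F v) :
    LinearIndependent F (fun k => v k ^ p) := by
  classical
  have hE : ExpChar E p := expChar_of_injective_algebraMap (algebraMap F E).injective p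
  rw [linearIndependent_iff']
  intro s g hg
  let k0 : Subfield F := (frobenius F p).fieldRange
  let b := Module.Basis.ofVectorSpace k0 F
  let S := s.biUnion fun k => (b.repr (g k)).support
  have hroot : ∀ z : k0, ∃ y : F, y ^ p = z := by
    rintro ⟨z, y, hy⟩
    exact ⟨y, hy⟩
  choose r hr using hroot
  have hgk : ∀ k ∈ s, g k = ∑ j ∈ S, r (b.repr (g k) j) ^ p * b j := by
    intro k hk
    conv_lhs => rw [← b.linearCombination_repr (g k)]
    rw [Finsupp.linearCombination_apply, Finsupp.sum_of_support_subset (s := S) _ _ _ (by simp)]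
    · refine Finset.sum_congr rfl fun j _ => ?_
      rw [hr]
      rfl
    · intro j hj
      exact Finset.mem_biUnion.2 ⟨k, hk, hj⟩
  have h1 : ∑ j : S, algebraMap F E (b j) *
      (∑ k ∈ s, r (b.repr (g k) j) • v k) ^ p = 0 := by
    rw [← hg]
    have e1 : ∀ j, (∑ k ∈ s, r (b.repr (g k) j) • v k) ^ p
        = ∑ k ∈ s, r (b.repr (g k) j) ^ p • v k ^ p := by
      intro j
      have := map_sum (frobenius E p) (fun k => r (b.repr (g k) j) • v k) s
      simp only [frobenius_def] at this
      rw [this]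
      exact Finset.sum_congr rfl fun k _ => by rw [smul_pow]
    simp only [e1, Finset.mul_sum]
    rw [Finset.sum_comm]
    refine Finset.sum_congr rfl fun k hk => ?_
    conv_rhs => rw [hgk k hk, Finset.sum_smul, ← Finset.sum_coe_sort S]
    refine Finset.sum_congr rfl fun j _ => ?_
    rw [← Algebra.smul_def, smul_smul, mul_comm]
  have h2 := h.fintype (fun j : S => b j) (fun x hx => by
    have hli := linearIndependent_iff'.1 b.linearIndependent S
      (fun j => if hj : j ∈ S then ⟨x ⟨j, hj⟩ ^ p, x ⟨j, hj⟩, rfl⟩ else 0) (by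
        rw [← Finset.sum_coe_sort S, ← hx]
        refine Finset.sum_congr rfl fun j _ => ?_
        rw [dif_pos j.2, mul_comm]
        rfl)
    intro j
    have := congrArg Subtype.val (hli j j.2)
    rw [dif_pos j.2] at this
    exact pow_eq_zero_iff (expChar_pos F p).ne' |>.1 this) _ h1
  intro k hk
  rw [hgk k hk]
  refine Finset.sum_eq_zero fun j hj => ?_
  have := linearIndependent_iff'.1 hv s _ (h2 ⟨j, hj⟩) k hk
  rw [this, zero_pow (expChar_pos F p).ne', zero_mul]

lemma PInd.exists_sepTransBasis [Algebra F E] [ExpChar F p] (h : PInd p (algebraMap F E))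
    [Algebra.EssFiniteType F E] :
    ∃ s : Finset E, IsTranscendenceBasis F ((↑) : s → E) ∧
      Algebra.IsSeparable (IntermediateField.adjoin F (s : Set E)) E := by
  rcases ‹ExpChar F p› with _ | hp
  · exact exists_isTranscendenceBasis_and_isSeparable_of_perfectField F E
  · refine exists_isTranscendenceBasis_and_isSeparable_of_linearIndepOn_pow_of_essFiniteType p hp ?_
    intro s hs
    have : ExpChar F p := .prime hp
    exact PInd.linearIndependent_pow h hs

lemma PInd.restrict [Algebra F E] (h : PInd p (algebraMap F E)) (M : IntermediateField F E) :
    PInd p (algebraMap F M) :=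
  PInd.of_comp (ψ := algebraMap M E) (by rwa [← IsScalarTower.algebraMap_eq])

lemma essFiniteType_adjoin [Algebra F E] {s : Set E} (hs : s.Finite) :
    Algebra.EssFiniteType F (IntermediateField.adjoin F s) := by
  rw [IntermediateField.essFiniteType_iff]
  exact IntermediateField.fg_adjoin_of_finite hs

end PInd

end Paper

namespace Paper

section Smooth

variable {F E : Type*} [Field F] [Field E] [Algebra F E]

lemma subsingleton_h1Cotangent_iff (F M : Type*) [CommRing F] [CommRing M] [Algebra F M] :
    Subsingleton (Algebra.H1Cotangent F M) ↔ ∀ f : MvPolynomial M F,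
      MvPolynomial.aeval (id : M → M) f = 0 →
      (∀ m, MvPolynomial.aeval (id : M → M) (MvPolynomial.pderiv m f) = 0) →
      f ∈ (RingHom.ker (MvPolynomial.aeval (R := F) (id : M → M)).toRingHom) ^ 2 := by
  let := (MvPolynomial.aeval (R := F) (id : M → M)).toRingHom.toAlgebra
  have hst : IsScalarTower F (MvPolynomial M F) M := .of_algebraMap_eq fun x => by
    change _ = MvPolynomial.aeval (id : M → M) (MvPolynomial.C x)
    simp
  have hsurj : Function.Surjective (algebraMap (MvPolynomial M F) M) := fun m =>
    ⟨MvPolynomial.X m, by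
      change MvPolynomial.aeval (id : M → M) (MvPolynomial.X m) = m
      simp⟩
  rw [← Algebra.FormallySmooth.kerCotangentToTensor_injective_iff hsurj, injective_iff_map_eq_zero]
  have key : ∀ f : RingHom.ker (algebraMap (MvPolynomial M F) M),
      KaehlerDifferential.kerCotangentToTensor F (MvPolynomial M F) M
        ((RingHom.ker (algebraMap (MvPolynomial M F) M)).toCotangent f) = 0 ↔
      ∀ m, MvPolynomial.aeval (id : M → M) (MvPolynomial.pderiv m f.1) = 0 := by
    intro f
    rw [KaehlerDifferential.kerCotangentToTensor_toCotangent]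
    let b := Algebra.TensorProduct.basis M (KaehlerDifferential.mvPolynomialBasis F M)
    rw [← b.repr.map_eq_zero_iff, Algebra.TensorProduct.basis_repr_tmul, one_smul,
      Finsupp.ext_iff]
    refine forall_congr' fun m => ?_
    rw [Finsupp.mapRange_apply, KaehlerDifferential.mvPolynomialBasis_repr_apply]
    rfl
  constructor
  · intro h f hf hd
    have := h _ ((key ⟨f, hf⟩).2 hd)
    rw [Ideal.toCotangent_eq_zero] at this
    exact this
  · intro h a ha
    obtain ⟨f, rfl⟩ := Ideal.toCotangent_surjective _ a
    rw [Ideal.toCotangent_eq_zero]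
    exact h f.1 f.2 ((key f).1 ha)

lemma formallySmooth_of_finset
    (h : ∀ s : Finset E, Algebra.FormallySmooth F (IntermediateField.adjoin F (s : Set E))) :
    Algebra.FormallySmooth F E := by
  classical
  rw [Algebra.formallySmooth_iff]
  refine ⟨inferInstance, ?_⟩
  rw [subsingleton_h1Cotangent_iff]
  intro f hf hd
  let M := IntermediateField.adjoin F (f.vars : Set E)
  have hM := (subsingleton_h1Cotangent_iff F M).1 (h f.vars).subsingleton_h1Cotangent
  have hinj : Function.Injective (Subtype.val : M → E) := Subtype.val_injective
  obtain ⟨g, hgf⟩ := MvPolynomial.exists_rename_eq_of_vars_subset_range f (Subtype.val : M → E)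
    hinj (fun x hx => by
      simpa using IntermediateField.subset_adjoin F _ hx)
  have hcomp : ∀ q : MvPolynomial M F,
      MvPolynomial.aeval (id : E → E) (MvPolynomial.rename (Subtype.val : M → E) q)
        = (MvPolynomial.aeval (id : M → M) q : M) := by
    intro q
    rw [MvPolynomial.aeval_rename]
    have := MvPolynomial.comp_aeval_apply (R := F) (id : M → M) M.val q
    simpa using! this.symm
  have hg := hM g (by
    apply hinj
    rw [← hcomp, hgf, hf]
    rfl) (fun m => by
      apply hinj
      rw [← hcomp, ← MvPolynomial.pderiv_rename hinj, hgf, hd]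
      rfl)
  have hle : (RingHom.ker (MvPolynomial.aeval (R := F) (id : M → M)).toRingHom).map
      (MvPolynomial.rename (R := F) (Subtype.val : M → E)).toRingHom ≤
      RingHom.ker (MvPolynomial.aeval (R := F) (id : E → E)).toRingHom := by
    rw [Ideal.map_le_iff_le_comap]
    intro q hq
    have : MvPolynomial.aeval (id : M → M) q = 0 := hq
    change MvPolynomial.aeval (id : E → E) (MvPolynomial.rename (Subtype.val : M → E) q) = 0
    rw [hcomp, this]
    rfl
  have h2 := Ideal.mem_map_of_mem (MvPolynomial.rename (R := F) (Subtype.val : M → E)).toRingHom hg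
  rw [Ideal.map_pow] at h2
  rw [← hgf]
  exact Ideal.pow_right_mono hle 2 h2

lemma PInd.formallySmooth {p : ℕ} [ExpChar F p] (h : PInd p (algebraMap F E)) :
    Algebra.FormallySmooth F E := by
  refine formallySmooth_of_finset fun s => ?_
  have := essFiniteType_adjoin (F := F) s.finite_toSet
  obtain ⟨t, ht, hsep⟩ := (h.restrict (IntermediateField.adjoin F (s : Set E))).exists_sepTransBasis
  have : Algebra.IsSeparable (IntermediateField.adjoin F
      (Set.range ((↑) : t → IntermediateField.adjoin F (s : Set E)))) 
      (IntermediateField.adjoin F (s : Set E)) := by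
    convert hsep <;> simp
  exact .of_algebraicIndependent_of_isSeparable ht.1

end Smooth

end Paper

namespace Paper

section Presentation

open Polynomial

variable {R A : Type*} [CommRing R] [CommRing A]

/-- The polynomial `z` evaluated at the fractions `r i / h`, multiplied by a power of `h`. -/
noncomputable def homogEval {ι : Type*} (j : R →+* A) (z : MvPolynomial ι R) (r : ι → A) (h : A) :
    A :=
  ∑ m ∈ z.support, j (z.coeff m) * (m.prod fun i k => r i ^ k) * h ^ (z.totalDegree - m.degree)

lemma map_homogEval {ι : Type*} {L : Type*} [Field L] (j : R →+* A) (z : MvPolynomial ι R)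
    (r : ι → A) (h : A) (ψ : A →+* L) (hh : ψ h ≠ 0) :
    ψ (homogEval j z r h) =
      ψ h ^ z.totalDegree * MvPolynomial.eval₂ (ψ.comp j) (fun i => ψ (r i) / ψ h) z := by
  rw [homogEval, map_sum, MvPolynomial.eval₂_eq, Finset.mul_sum]
  refine Finset.sum_congr rfl fun m hm => ?_
  have hdeg : m.degree ≤ z.totalDegree := MvPolynomial.le_totalDegree hm
  rw [map_mul, map_mul, map_pow, RingHom.comp_apply, Finsupp.prod, map_prod]
  simp only [map_pow, div_pow, Finset.prod_div_distrib]
  have h1 : ∏ i ∈ m.support, ψ h ^ m i = ψ h ^ m.degree := by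
    rw [Finset.prod_pow_eq_pow_sum]
    rfl
  rw [h1, ← Nat.sub_add_cancel hdeg, pow_add, Nat.add_sub_cancel]
  field_simp

variable [IsDomain A] {k E : Type*} [Field k] [Field E] [Algebra A k] [IsFractionRing A k]
  [Algebra k E] [Algebra A E] [IsScalarTower A k E]

omit [IsDomain A] in
lemma exists_clear_denominators (g : k[X]) : ∃ (c : A) (g' : A[X]), c ∈ nonZeroDivisors A ∧
    g'.map (algebraMap A k) = C (algebraMap A k c) * g := by
  obtain ⟨b, hb, hg⟩ := IsLocalization.integerNormalization_spec (nonZeroDivisors A) g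
  refine ⟨b, _, hb, hg.trans ?_⟩
  rw [← Polynomial.smul_eq_C_mul, algebraMap_smul]

lemma exists_minimal_presentation {y : E} (hy : IsSeparable k y) :
    ∃ f : A[X], aeval y f = 0 ∧ aeval y (derivative f) ≠ 0 ∧
      ∀ G : A[X], aeval y G = 0 → ∃ c : A, c ≠ 0 ∧ f ∣ C c * G := by
  obtain ⟨b, f, hb, hfm⟩ := exists_clear_denominators (A := A) (minpoly k y)
  have hb0 : (algebraMap A k b) ≠ 0 := by
    simpa using nonZeroDivisors.ne_zero hb
  have hae : ∀ g : A[X], aeval y g = aeval y (g.map (algebraMap A k)) := fun g => by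
    rw [aeval_map_algebraMap]
  refine ⟨f, ?_, ?_, ?_⟩
  · rw [hae, hfm, map_mul, minpoly.aeval, mul_zero]
  · rw [hae, ← derivative_map, hfm, derivative_C_mul, map_mul, aeval_C]
    refine mul_ne_zero (by simpa using nonZeroDivisors.ne_zero hb) ?_
    exact hy.aeval_derivative_ne_zero (minpoly.aeval k y)
  · intro G hG
    rw [hae] at hG
    obtain ⟨H, hH⟩ := minpoly.dvd k y hG
    obtain ⟨c, H', hc0, hc⟩ := exists_clear_denominators (A := A) H
    refine ⟨c * b, mul_ne_zero (nonZeroDivisors.ne_zero hc0) (nonZeroDivisors.ne_zero hb), H', ?_⟩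
    apply Polynomial.map_injective (algebraMap A k) (IsFractionRing.injective A k)
    rw [Polynomial.map_mul, Polynomial.map_mul, hfm, hc, hH]
    rw [Polynomial.map_C, map_mul, C_mul]
    ring

lemma exists_numerator {y : E} (hy : IsIntegral k y) {e : E}
    (he : e ∈ IntermediateField.adjoin k {y}) :
    ∃ (h : A) (r : A[X]), h ≠ 0 ∧ aeval y r = algebraMap A E h * e := by
  rw [← IntermediateField.mem_toSubalgebra,
    IntermediateField.adjoin_simple_toSubalgebra_of_isAlgebraic hy.isAlgebraic,
    Algebra.adjoin_singleton_eq_range_aeval] at he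
  obtain ⟨g, rfl⟩ := he
  obtain ⟨c, r, hc0, hc⟩ := exists_clear_denominators (A := A) g
  refine ⟨c, r, nonZeroDivisors.ne_zero hc0, ?_⟩
  rw [← aeval_map_algebraMap k, hc, map_mul, aeval_C, ← IsScalarTower.algebraMap_apply]
  rfl

lemma exists_presentation [Algebra R A] [Algebra R E] [IsScalarTower R A E]
    {ι : Type*} [Fintype ι] {y : E} (hy : IsSeparable k y)
    (a : ι → E) (ha : ∀ i, a i ∈ IntermediateField.adjoin k {y})
    (Z : Finset (MvPolynomial ι R)) (hZ : ∀ z ∈ Z, MvPolynomial.aeval a z = 0) :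
    ∃ (f : A[X]) (h : A) (r : ι → A[X]), aeval y f = 0 ∧ aeval y (derivative f) ≠ 0 ∧ h ≠ 0 ∧
      (∀ i, aeval y (r i) = algebraMap A E h * a i) ∧
      ∀ (L : Type u) [Field L] (ψ : A →+* L) (y' : L), eval₂ ψ y' f = 0 → ψ h ≠ 0 →
        ∀ z ∈ Z, MvPolynomial.eval₂ (ψ.comp (algebraMap R A))
          (fun i => eval₂ ψ y' (r i) / ψ h) z = 0 := by
  classical
  obtain ⟨f, hf0, hf1, hf⟩ := exists_minimal_presentation (A := A) hy
  choose h r hh hr using fun i => exists_numerator (A := A) hy.isIntegral (ha i)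
  let h0 := ∏ i, h i
  have hh0 : h0 ≠ 0 := Finset.prod_ne_zero_iff.2 fun i _ => hh i
  let r0 : ι → A[X] := fun i => C (∏ j ∈ Finset.univ.erase i, h j) * r i
  have hinj : Function.Injective (algebraMap A E) := by
    rw [IsScalarTower.algebraMap_eq A k E]
    exact (algebraMap k E).injective.comp (IsFractionRing.injective A k)
  have hr0 : ∀ i, aeval y (r0 i) = algebraMap A E h0 * a i := by
    intro i
    simp only [r0, h0, map_mul, aeval_C, hr]
    rw [← Finset.mul_prod_erase _ h (Finset.mem_univ i), map_mul]
    ring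
  have hG : ∀ z ∈ Z, ∃ c : A, c ≠ 0 ∧
      f ∣ C c * homogEval (algebraMap R A[X]) z r0 (C h0) := by
    intro z hz
    apply hf
    have h1 : (aeval y : A[X] →ₐ[A] E).toRingHom (C h0) = algebraMap A E h0 := aeval_C _ _
    have h1' : algebraMap A E h0 ≠ 0 := (map_ne_zero_iff _ hinj).2 hh0
    have h2 := map_homogEval (algebraMap R A[X]) z r0 (C h0) (aeval y : A[X] →ₐ[A] E).toRingHom
      (by rw [h1]; exact h1')
    have h3 : (aeval y : A[X] →ₐ[A] E).toRingHom.comp (algebraMap R A[X]) = algebraMap R E := by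
      ext x
      change aeval y (algebraMap R A[X] x) = _
      rw [IsScalarTower.algebraMap_apply R A A[X], Polynomial.algebraMap_apply, aeval_C]
      simp [← IsScalarTower.algebraMap_apply]
    have h4 : (fun i => (aeval y : A[X] →ₐ[A] E).toRingHom (r0 i) /
        (aeval y : A[X] →ₐ[A] E).toRingHom (C h0)) = a := by
      ext i
      rw [h1]
      change aeval y (r0 i) / _ = _
      rw [hr0, mul_div_cancel_left₀ _ h1']
    rw [h3, h4, ← MvPolynomial.aeval_def, hZ z hz, mul_zero] at h2
    exact h2
  choose! c hc hdvd using hG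
  let c0 := ∏ z ∈ Z, c z
  have hc0 : c0 ≠ 0 := Finset.prod_ne_zero_iff.2 hc
  refine ⟨f, c0 * h0, fun i => C c0 * r0 i, hf0, hf1, mul_ne_zero hc0 hh0, ?_, ?_⟩
  · intro i
    rw [map_mul, hr0, aeval_C, map_mul, mul_assoc]
  · intro L _ ψ y' hfy hψ z hz
    rw [map_mul] at hψ
    have hψc : ψ c0 ≠ 0 := left_ne_zero_of_mul hψ
    have hψh : ψ h0 ≠ 0 := right_ne_zero_of_mul hψ
    have hψz : ψ (c z) ≠ 0 := by
      rw [map_prod] at hψc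
      exact Finset.prod_ne_zero_iff.1 hψc z hz
    have h1 : eval₂RingHom ψ y' (C h0) = ψ h0 := eval₂_C _ _
    have h2 := map_homogEval (algebraMap R A[X]) z r0 (C h0) (eval₂RingHom ψ y')
      (by rw [h1]; exact hψh)
    obtain ⟨H, hH⟩ := hdvd z hz
    have h3 := congrArg (eval₂RingHom ψ y') hH
    rw [map_mul, map_mul] at h3
    have h5 : eval₂RingHom ψ y' f = 0 := hfy
    have h6 : eval₂RingHom ψ y' (C (c z)) = ψ (c z) := eval₂_C _ _
    rw [h5, h6, zero_mul] at h3
    have h7 := (mul_eq_zero.1 h3).resolve_left hψz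
    rw [h7, h1] at h2
    have h8 := (mul_eq_zero.1 h2.symm).resolve_left (pow_ne_zero _ hψh)
    have h9 : (eval₂RingHom ψ y').comp (algebraMap R A[X]) = ψ.comp (algebraMap R A) := by
      ext x
      change eval₂ ψ y' (algebraMap R A[X] x) = _
      rw [IsScalarTower.algebraMap_apply R A A[X], Polynomial.algebraMap_apply, eval₂_C]
      simp
    rw [h9] at h8
    rw [← h8]
    congr 1
    ext i
    change eval₂ ψ y' (C c0 * r0 i) / _ = eval₂ ψ y' (r0 i) / _
    rw [eval₂_mul, eval₂_C, map_mul]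
    field_simp

end Presentation

end Paper

namespace Paper

section SepPresentation

open Polynomial

variable {F E : Type*} [Field F] [Field E] {p : ℕ}

lemma PInd.exists_sep_generators [Algebra F E] [ExpChar F p] (h : PInd p (algebraMap F E))
    {ι : Type*} [Finite ι] (a : ι → E) :
    ∃ (d : ℕ) (T : Fin d → E) (y : E), AlgebraicIndependent F T ∧
      IsSeparable (IntermediateField.adjoin F (Set.range T)) y ∧
      (∀ i, a i ∈ IntermediateField.adjoin (IntermediateField.adjoin F (Set.range T)) {y}) ∧
      (∀ j, T j ∈ IntermediateField.adjoin F (Set.range a)) ∧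
      y ∈ IntermediateField.adjoin F (Set.range a) := by
  classical
  let M := IntermediateField.adjoin F (Set.range a)
  have : Algebra.EssFiniteType F M := essFiniteType_adjoin (Set.finite_range a)
  obtain ⟨s, hs, hsep⟩ := (h.restrict M).exists_sepTransBasis
  let k := IntermediateField.adjoin F (s : Set M)
  have hft : Algebra.EssFiniteType k M := .of_comp F k M
  have hfin : FiniteDimensional k M :=
    Algebra.finite_of_essFiniteType_of_isAlgebraic
  obtain ⟨y, hy⟩ := Field.exists_primitive_element k M
  let T0 : Fin s.card → M := fun i => (s.equivFin.symm i : M)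
  have hT0 : Set.range T0 = s := by
    ext x
    constructor
    · rintro ⟨i, rfl⟩
      exact (s.equivFin.symm i).2
    · intro hx
      exact ⟨s.equivFin ⟨x, hx⟩, by simp [T0]⟩
  have hT0i : AlgebraicIndependent F T0 := hs.1.comp _ s.equivFin.symm.injective
  let T : Fin s.card → E := fun i => (T0 i : E)
  have hmap : (IntermediateField.adjoin F (Set.range T)) =
      k.map M.val := by
    rw [IntermediateField.adjoin_map]
    congr 1
    rw [← hT0, ← Set.range_comp]
    rfl
  let e : k →+* IntermediateField.adjoin F (Set.range T) :=
    { toFun := fun x => ⟨(x : M), by rw [hmap]; exact ⟨x, x.2, rfl⟩⟩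
      map_one' := rfl
      map_mul' := fun _ _ => rfl
      map_zero' := rfl
      map_add' := fun _ _ => rfl }
  have he : (algebraMap (IntermediateField.adjoin F (Set.range T)) E).comp e =
      (algebraMap M E).comp (algebraMap k M) := rfl
  refine ⟨s.card, T, y, ?_, ?_, ?_, fun j => (T0 j).2, y.2⟩
  · exact hT0i.map' (f := M.val) M.val.injective
  · have h1 : IsSeparable k y := Algebra.IsSeparable.isSeparable k y
    refine Separable.of_dvd (f := ((minpoly k y).map e)) (Polynomial.Separable.map h1) ?_
    apply minpoly.dvd
    rw [aeval_def, eval₂_map, he]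
    refine (Polynomial.hom_eval₂ (minpoly k y) (algebraMap k M) (algebraMap M E) y).symm.trans ?_
    change algebraMap M E (aeval y _) = 0
    rw [minpoly.aeval, map_zero]
  · intro i
    let a' : M := ⟨a i, IntermediateField.subset_adjoin _ _ ⟨i, rfl⟩⟩
    have h1 : a' ∈ (IntermediateField.adjoin k {y}) := by
      rw [hy]; trivial
    have h2 : ∀ x ∈ (IntermediateField.adjoin k {y}), (x : E) ∈
        IntermediateField.adjoin (IntermediateField.adjoin F (Set.range T)) {(y : E)} := by
      intro x hx
      induction hx using IntermediateField.adjoin_induction with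
      | mem x hx =>
        rw [Set.mem_singleton_iff.1 hx]
        exact IntermediateField.mem_adjoin_simple_self _ _
      | algebraMap x => exact (IntermediateField.adjoin _ _).algebraMap_mem (e x)
      | add x z _ _ hx hz => exact add_mem hx hz
      | inv x _ hx => exact inv_mem hx
      | mul x z _ _ hx hz => exact mul_mem hx hz
    exact h2 _ h1

/-- A finite tuple of a separable extension is the image of a generic point of a hypersurface,
and the polynomial relations in `Z` hold at all points of an open part of that hypersurface. -/
lemma exists_hypersurface [Algebra F E] {ι : Type*} [Finite ι] {a : ι → E} {d : ℕ}
    {T : Fin d → E} {y : E} (hT : AlgebraicIndependent F T)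
    (hy : IsSeparable (IntermediateField.adjoin F (Set.range T)) y)
    (ha : ∀ i, a i ∈ IntermediateField.adjoin (IntermediateField.adjoin F (Set.range T)) {y})
    (Z : Finset (MvPolynomial ι F)) (hZ : ∀ z ∈ Z, MvPolynomial.aeval a z = 0) :
    ∃ (f : (MvPolynomial (Fin d) F)[X]) (h : MvPolynomial (Fin d) F)
      (r : ι → (MvPolynomial (Fin d) F)[X]),
      eval₂ (MvPolynomial.eval₂Hom (algebraMap F E) T) y f = 0 ∧
      eval₂ (MvPolynomial.eval₂Hom (algebraMap F E) T) y (derivative f) ≠ 0 ∧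
      MvPolynomial.eval₂Hom (algebraMap F E) T h ≠ 0 ∧
      (∀ i, eval₂ (MvPolynomial.eval₂Hom (algebraMap F E) T) y (r i) =
        MvPolynomial.eval₂Hom (algebraMap F E) T h * a i) ∧
      ∀ (L : Type u) [Field L] (φ : F →+* L) (T' : Fin d → L) (y' : L),
        eval₂ (MvPolynomial.eval₂Hom φ T') y' f = 0 →
        MvPolynomial.eval₂Hom φ T' h ≠ 0 → ∀ z ∈ Z,
        MvPolynomial.eval₂ φ (fun i => eval₂ (MvPolynomial.eval₂Hom φ T') y' (r i) /
          MvPolynomial.eval₂Hom φ T' h) z = 0 := by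
  have := Fintype.ofFinite ι
  let k := IntermediateField.adjoin F (Set.range T)
  let T1 : Fin d → k := fun j => ⟨T j, IntermediateField.subset_adjoin _ _ ⟨j, rfl⟩⟩
  let A := MvPolynomial (Fin d) F
  let : Algebra A k := (MvPolynomial.eval₂Hom (algebraMap F k) T1).toAlgebra
  let : Algebra A E := (MvPolynomial.eval₂Hom (algebraMap F E) T).toAlgebra
  have hAE : algebraMap A E = MvPolynomial.eval₂Hom (algebraMap F E) T := rfl
  have hAk : algebraMap A k = MvPolynomial.eval₂Hom (algebraMap F k) T1 := rfl
  have hst : IsScalarTower A k E := by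
    apply IsScalarTower.of_algebraMap_eq'
    rw [hAE, hAk]
    ext x
    · simp [← IsScalarTower.algebraMap_apply]
    · simp [T1]
  have hst' : IsScalarTower F A E := by
    apply IsScalarTower.of_algebraMap_eq'
    rw [hAE]
    ext x
    exact (MvPolynomial.eval₂Hom_C _ _ _).symm
  have hinj : Function.Injective (algebraMap A E) := hT
  have hinjk : Function.Injective (algebraMap A k) := by
    rw [IsScalarTower.algebraMap_eq A k E, RingHom.coe_comp] at hinj
    exact Function.Injective.of_comp hinj
  have hfr : IsFractionRing A k := by
    have : FaithfulSMul A k := (faithfulSMul_iff_algebraMap_injective A k).2 hinjk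
    refine IsFractionRing.of_field A k ?_
    rintro ⟨z, hz⟩
    have h1 := hz
    rw [IntermediateField.mem_adjoin_range_iff] at h1
    obtain ⟨r, s, rfl⟩ := h1
    refine ⟨r, s, ?_⟩
    apply Subtype.ext
    have h3 : ∀ x : A, algebraMap k E (algebraMap A k x) = MvPolynomial.aeval T x := fun x => by
      rw [← IsScalarTower.algebraMap_apply]
      rfl
    change _ = algebraMap k E (_ / _)
    rw [map_div₀, h3, h3]
  obtain ⟨f, h, r, h1, h2, h3, h4, h5⟩ :=
    exists_presentation.{u} (R := F) (A := A) (k := k) (E := E) hy a ha Z hZ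
  refine ⟨f, h, r, h1, h2, ?_, h4, ?_⟩
  · exact (map_ne_zero_iff _ hinj).2 h3
  · intro L _ φ T' y' hf hh z hz
    have := h5 L (MvPolynomial.eval₂Hom φ T') y' hf hh z hz
    have h6 : (MvPolynomial.eval₂Hom φ T').comp (algebraMap F A) = φ := by
      ext x
      exact MvPolynomial.eval₂Hom_C _ _ _
    rwa [h6] at this

end SepPresentation

end Paper

namespace Paper

section Hensel

open Polynomial

lemma exists_root_of_coeff_mem_maximalIdeal {R : Type*} [CommRing R] [HenselianLocalRing R]
    (h : R[X]) (hh : ∀ i, h.coeff i ∈ IsLocalRing.maximalIdeal R) :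
    ∃ z : R, 1 + z + z ^ 2 * h.eval z = 0 := by
  let N := h.natDegree
  let f : R[X] := X ^ (N + 2) + (X ^ (N + 1) + reverse h)
  have hdeg : (X ^ (N + 1) + reverse h).degree < ((N + 2 : ℕ) : WithBot ℕ) := by
    refine (degree_add_le _ _).trans_lt (max_lt ?_ ?_)
    · exact (degree_X_pow_le _).trans_lt (by exact_mod_cast Nat.lt_succ_self _)
    · refine degree_le_natDegree.trans_lt ?_
      have := reverse_natDegree_le h
      exact_mod_cast (by omega : h.reverse.natDegree < N + 2)
  have hmon : f.Monic := monic_X_pow_add hdeg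
  have hred : f.map (IsLocalRing.residue R) = X ^ (N + 2) + X ^ (N + 1) := by
    have h0 : (reverse h).map (IsLocalRing.residue R) = 0 := by
      ext i
      rw [coeff_map, coeff_reverse, coeff_zero, IsLocalRing.residue_eq_zero_iff]
      exact hh _
    simp [f, Polynomial.map_add, h0]
  have hev : ∀ g : R[X], IsLocalRing.residue R (g.eval (-1)) =
      (g.map (IsLocalRing.residue R)).eval (-1) := fun g => by
    rw [eval_map, ← eval₂_at_apply]
    simp
  obtain ⟨x, hx, hx1⟩ := HenselianLocalRing.is_henselian f hmon (-1) (by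
    rw [← IsLocalRing.residue_eq_zero_iff, hev, hred]
    simp [pow_succ]) (by
    rw [← IsLocalRing.notMem_maximalIdeal, ← IsLocalRing.residue_eq_zero_iff, hev,
      ← derivative_map, hred]
    simp only [derivative_add, derivative_X_pow, eval_add, eval_mul, eval_pow, eval_X, eval_C]
    have : ((-1 : IsLocalRing.ResidueField R)) ^ N ≠ 0 := pow_ne_zero _ (by simp)
    intro h
    apply this
    have h2 : N + 2 - 1 = N + 1 := rfl
    rw [h2, Nat.add_sub_cancel] at h
    push_cast at h
    linear_combination -h)
  have hxu : IsUnit x := by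
    rw [← IsLocalRing.notMem_maximalIdeal, ← IsLocalRing.residue_eq_zero_iff]
    rw [← IsLocalRing.residue_eq_zero_iff, map_sub, sub_eq_zero] at hx1
    rw [hx1]
    simp
  obtain ⟨w, rfl⟩ := hxu
  refine ⟨(w⁻¹ : Rˣ), ?_⟩
  have hrev : eval ((w : Rˣ) : R) (reverse h) * ((w⁻¹ : Rˣ) : R) ^ N = eval ((w⁻¹ : Rˣ) : R) h := by
    let _ : Invertible ((w⁻¹ : Rˣ) : R) := ⟨w, by simp, by simp⟩
    have h3 := eval₂_reverse_mul_pow (RingHom.id R) ((w⁻¹ : Rˣ) : R) h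
    have h4 : ⅟((w⁻¹ : Rˣ) : R) = w := rfl
    rwa [h4] at h3
  rw [← hrev]
  have hx' : (w : R) ^ (N + 2) + ((w : R) ^ (N + 1) + eval (w : R) (reverse h)) = 0 := by
    simpa [f, IsRoot] using hx
  have hw : (w : R) * ((w⁻¹ : Rˣ) : R) = 1 := by simp
  generalize ((w⁻¹ : Rˣ) : R) = z at *
  have h1 : (w : R) ^ (N + 2) * z ^ (N + 2) = 1 := by rw [← mul_pow, hw, one_pow]
  have h2 : (w : R) ^ (N + 1) * z ^ (N + 1) = 1 := by rw [← mul_pow, hw, one_pow]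
  calc 1 + z + z ^ 2 * (eval (w : R) (reverse h) * z ^ N)
      = z ^ (N + 2) * ((w : R) ^ (N + 2) + ((w : R) ^ (N + 1) + eval (w : R) (reverse h))) := by
        linear_combination (-1) * h1 - z * h2
    _ = 0 := by rw [hx', mul_zero]

variable {K : Type*} [Field K] {Γ : Type*} [LinearOrderedCommGroupWithZero Γ]

/-- Newton's form of Hensel's lemma in a henselian valued field. -/
lemma exists_root_of_lt (v : Valuation K Γ) (hv : IsHenselian v) (g : K[X]) (γ : Γ)
    (hγ : ∀ i, v (g.coeff i) ≤ γ) (hlt : v (g.coeff 0) * γ < v (g.coeff 1) ^ 2) :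
    ∃ y, g.eval y = 0 ∧ v y * v (g.coeff 1) ≤ v (g.coeff 0) := by
  by_cases h0 : g.coeff 0 = 0
  · exact ⟨0, by rw [← coeff_zero_eq_eval_zero, h0], by simp⟩
  have h1 : g.coeff 1 ≠ 0 := by
    intro h
    rw [h] at hlt
    simp at hlt
  have hv0 : 0 < v (g.coeff 0) := by simpa [zero_lt_iff] using h0
  have hv1 : 0 < v (g.coeff 1) := by simpa [zero_lt_iff] using h1
  set e := g.coeff 0 / g.coeff 1 with he
  have he1 : v e < 1 := by
    rw [he, map_div₀, div_lt_one₀ hv1]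
    have := (mul_le_mul_right (hγ 1) (v (g.coeff 0))).trans_lt hlt
    rw [pow_two] at this
    exact lt_of_mul_lt_mul_right this hv1.le
  let q : K[X] := C ((g.coeff 0)⁻¹ * e ^ 2) * (divX (divX g)).comp (C e * X)
  have hq : ∀ i, v (q.coeff i) < 1 := by
    intro i
    rw [coeff_C_mul, comp_C_mul_X_coeff, coeff_divX, coeff_divX, map_mul, map_mul, map_mul,
      map_pow, map_pow, map_inv₀]
    have h2 : (v (g.coeff 0))⁻¹ * v e ^ 2 * γ < 1 := by
      rw [he, map_div₀]
      have h3 : (v (g.coeff 0))⁻¹ * (v (g.coeff 0) / v (g.coeff 1)) ^ 2 * γ =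
          v (g.coeff 0) * γ / v (g.coeff 1) ^ 2 := by
        field_simp
      rw [h3, div_lt_one₀ (pow_pos hv1 2)]
      exact hlt
    refine lt_of_le_of_lt ?_ h2
    have h4 : v (g.coeff (i + 1 + 1)) * v e ^ i ≤ γ * 1 :=
      mul_le_mul' (hγ _) (pow_le_one₀ zero_le he1.le)
    rw [mul_one] at h4
    exact mul_le_mul_right h4 _
  let q' : v.valuationSubring[X] := q.toSubring v.valuationSubring.toSubring (by
    intro x hx
    obtain ⟨i, _, rfl⟩ := Polynomial.mem_coeffs_iff.1 hx
    exact (hq i).le)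
  have hq' : q'.map v.valuationSubring.subtype = q := by
    ext i
    rw [coeff_map]
    exact Polynomial.coeff_toSubring _ _ _
  obtain ⟨z, hz⟩ := exists_root_of_coeff_mem_maximalIdeal q' (fun i => by
    apply (ValuationSubring.valuation_lt_one_iff _ _).2
    have h5 : ((q'.coeff i : v.valuationSubring) : K) = q.coeff i := by
      rw [← hq', coeff_map]; rfl
    rw [h5]
    exact (Valuation.isEquiv_valuation_valuationSubring v).lt_one_iff_lt_one.1 (hq i))
  refine ⟨e * z, ?_, ?_⟩
  · have hz' : 1 + (z : K) + (z : K) ^ 2 * q.eval (z : K) = 0 := by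
      have := congrArg v.valuationSubring.subtype hz
      rw [map_add, map_add, map_mul, map_pow, ← eval₂_at_apply, ← eval_map, hq'] at this
      simpa using this
    have hg : g = C (g.coeff 0) + X * (C (g.coeff 1) + X * divX (divX g)) := by
      conv_lhs => rw [← X_mul_divX_add g, ← X_mul_divX_add (divX g), coeff_divX]
      ring
    have hqe : q.eval (z : K) = (g.coeff 0)⁻¹ * e ^ 2 * (divX (divX g)).eval (e * z) := by
      simp [q, eval_comp]
    rw [hqe] at hz'
    rw [hg]
    simp only [eval_add, eval_mul, eval_C, eval_X]
    have he2 : e * g.coeff 1 = g.coeff 0 := by rw [he]; field_simp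
    generalize eval (e * (z : K)) g.divX.divX = D at *
    have h6 : g.coeff 0 * (1 + (z : K) + (z : K) ^ 2 * ((g.coeff 0)⁻¹ * e ^ 2 * D)) = 0 := by
      rw [hz', mul_zero]
    field_simp at h6
    linear_combination h6 + z * he2
  · rw [map_mul, he, map_div₀]
    have hz1 : v (z : K) ≤ 1 := z.2
    calc v (g.coeff 0) / v (g.coeff 1) * v (z : K) * v (g.coeff 1)
        = v (g.coeff 0) * v (z : K) := by field_simp
      _ ≤ v (g.coeff 0) * 1 := mul_le_mul_right hz1 _
      _ = _ := mul_one _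

end Hensel

end Paper

namespace Paper

section Place

open Polynomial

variable {K R : Type*} [Field K] [Field R]

/-- The relation `P x r` expresses that `x` is finite with residue `r` at a (surjective) place
of `K` with residue field `R`. -/
structure IsPlace (P : K → R → Prop) : Prop where
  one : P 1 1
  neg : ∀ {x r}, P x r → P (-x) (-r)
  add : ∀ {x y r s}, P x r → P y s → P (x + y) (r + s)
  mul : ∀ {x y r s}, P x r → P y s → P (x * y) (r * s)
  uniq : ∀ {x r s}, P x r → P x s → r = s
  total : ∀ x, (∃ r, P x r) ∨ P x⁻¹ 0
  surj : ∀ r, ∃ x, P x r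

/-- Hensel's lemma at `0` for the place `P`. -/
def IsPlaceHensel (P : K → R → Prop) : Prop :=
  ∀ g : K[X], (∀ i, ∃ r, P (g.coeff i) r) → P (g.coeff 0) 0 → ¬ P (g.coeff 1) 0 →
    ∃ y, P y 0 ∧ g.eval y = 0

namespace IsPlace

variable {P : K → R → Prop}

lemma zero (hP : IsPlace P) : P 0 0 := by
  simpa using hP.add hP.one (hP.neg hP.one)

lemma sub (hP : IsPlace P) {x y : K} {r s : R} (h : P x r) (h' : P y s) : P (x - y) (r - s) := by
  simpa [sub_eq_add_neg] using hP.add h (hP.neg h')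

lemma inv (hP : IsPlace P) {x : K} {r : R} (h : P x r) (hr : r ≠ 0) : P x⁻¹ r⁻¹ := by
  have hx : x ≠ 0 := by
    rintro rfl
    exact hr (hP.uniq h hP.zero)
  rcases hP.total x⁻¹ with ⟨s, hs⟩ | h0
  · have h1 := hP.mul h hs
    rw [mul_inv_cancel₀ hx] at h1
    have h2 := hP.uniq hP.one h1
    rwa [eq_inv_of_mul_eq_one_right h2.symm] at hs
  · rw [inv_inv] at h0
    exact absurd (hP.uniq h h0) hr

/-- The ring of finite elements of a place. -/
def ring (hP : IsPlace P) : Subring K where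
  carrier := {x | ∃ r, P x r}
  one_mem' := ⟨_, hP.one⟩
  zero_mem' := ⟨_, hP.zero⟩
  add_mem' := fun ⟨_, h⟩ ⟨_, h'⟩ => ⟨_, hP.add h h'⟩
  mul_mem' := fun ⟨_, h⟩ ⟨_, h'⟩ => ⟨_, hP.mul h h'⟩
  neg_mem' := fun ⟨_, h⟩ => ⟨_, hP.neg h⟩

/-- The residue map of a place. -/
noncomputable def res (hP : IsPlace P) : hP.ring →+* R where
  toFun := fun x => x.2.choose
  map_one' := hP.uniq (Subtype.prop (1 : hP.ring)).choose_spec hP.one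
  map_zero' := hP.uniq (Subtype.prop (0 : hP.ring)).choose_spec hP.zero
  map_add' := fun x y => hP.uniq (x + y).2.choose_spec (hP.add x.2.choose_spec y.2.choose_spec)
  map_mul' := fun x y => hP.uniq (x * y).2.choose_spec (hP.mul x.2.choose_spec y.2.choose_spec)

lemma rel_res (hP : IsPlace P) (x : hP.ring) : P x (hP.res x) := x.2.choose_spec

lemma res_eq (hP : IsPlace P) {x : hP.ring} {r : R} (h : P x r) : hP.res x = r :=
  hP.uniq (hP.rel_res x) h

lemma exists_root (hP : IsPlace P) (hH : IsPlaceHensel P) (g : hP.ring[X]) (y₀ : hP.ring)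
    (h0 : hP.res (g.eval y₀) = 0) (h1 : hP.res (g.derivative.eval y₀) ≠ 0) :
    ∃ y : hP.ring, hP.res y = hP.res y₀ ∧ g.eval y = 0 := by
  obtain ⟨z, hz, hgz⟩ := hH ((taylor y₀ g).map hP.ring.subtype)
    (fun i => by rw [coeff_map]; exact (Subtype.prop ((taylor y₀ g).coeff i)))
    (by
      rw [coeff_map, taylor_coeff_zero, ← h0]
      exact hP.rel_res _)
    (by
      rw [coeff_map, taylor_coeff_one]
      intro h
      exact h1 (hP.res_eq h))
  let z' : hP.ring := ⟨z, _, hz⟩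
  refine ⟨z' + y₀, ?_, ?_⟩
  · rw [map_add, hP.res_eq (x := z') hz, zero_add]
  · have h2 : hP.ring.subtype ((taylor y₀ g).eval z') = 0 := by
      rw [← eval₂_at_apply, ← eval_map]
      exact hgz
    rw [taylor_eval] at h2
    exact Subtype.ext h2

end IsPlace

variable {F : Type*} [Field F] {p : ℕ}

lemma IsPlace.exists_lift_finite {K : Type u} [Field K] {P : K → R → Prop} (hP : IsPlace P)
    (hH : IsPlaceHensel P) [ExpChar F p]
    {s : F →+* K} {σ : F →+* R} (hs : ∀ x, P (s x) (σ x)) (hσ : PInd p σ) {ι : Type*} [Finite ι]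
    (a : ι → R) (Z : Finset (MvPolynomial ι F)) (hZ : ∀ z ∈ Z, z.eval₂ σ a = 0) :
    ∃ x : ι → K, (∀ i, P (x i) (a i)) ∧ ∀ z ∈ Z, z.eval₂ s x = 0 := by
  let : Algebra F R := σ.toAlgebra
  obtain ⟨d, T, y, hT, hy, ha, -, -⟩ := PInd.exists_sep_generators (p := p) (F := F) hσ a
  obtain ⟨f, h, r, hf, hf', hh, hr, hL⟩ := exists_hypersurface.{u} hT hy ha Z hZ
  let sO : F →+* hP.ring := s.codRestrict hP.ring (fun x => ⟨_, hs x⟩)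
  have hsO : hP.res.comp sO = σ := by
    ext x
    exact hP.res_eq (hs x)
  have hsO' : hP.ring.subtype.comp sO = s := rfl
  choose T0 hT0 using fun j => hP.surj (T j)
  let T' : Fin d → hP.ring := fun j => ⟨T0 j, _, hT0 j⟩
  have hT' : ∀ j, hP.res (T' j) = T j := fun j => hP.res_eq (hT0 j)
  obtain ⟨y0, hy0⟩ := hP.surj y
  let y0' : hP.ring := ⟨y0, _, hy0⟩
  have hy0' : hP.res y0' = y := hP.res_eq hy0
  let ψ : MvPolynomial (Fin d) F →+* hP.ring := MvPolynomial.eval₂Hom sO T'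
  have hψ1 : hP.res.comp ψ = MvPolynomial.eval₂Hom (algebraMap F R) T := by
    ext j
    · simpa [ψ, RingHom.algebraMap_toAlgebra] using DFunLike.congr_fun hsO j
    · simp [ψ, hT']
  have hψ2 : hP.ring.subtype.comp ψ = MvPolynomial.eval₂Hom s (fun j => (T' j : K)) := by
    ext j
    · simp [ψ, ← hsO']
    · simp [ψ]
  have hres : ∀ (q : (MvPolynomial (Fin d) F)[X]) (y₁ : hP.ring), hP.res y₁ = y →
      hP.res (eval₂ ψ y₁ q) = eval₂ (MvPolynomial.eval₂Hom (algebraMap F R) T) y q := by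
    intro q y₁ hy₁
    rw [hom_eval₂, hψ1, hy₁]
  obtain ⟨y1, hy1, hroot⟩ := hP.exists_root hH (f.map ψ) y0'
    (by rw [eval_map, hres _ _ hy0', hf])
    (by rw [derivative_map, eval_map, hres _ _ hy0']; exact hf')
  rw [hy0'] at hy1
  have hval : ∀ q : (MvPolynomial (Fin d) F)[X], (eval₂ (MvPolynomial.eval₂Hom s
      (fun j => (T' j : K))) (y1 : K) q) = (eval₂ ψ y1 q : hP.ring) := by
    intro q
    rw [← hψ2]
    exact (hom_eval₂ q ψ hP.ring.subtype y1).symm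
  have hhres : hP.res (ψ h) = MvPolynomial.eval₂Hom (algebraMap F R) T h :=
    DFunLike.congr_fun hψ1 h
  have hhval : MvPolynomial.eval₂Hom s (fun j => (T' j : K)) h = (ψ h : K) :=
    (DFunLike.congr_fun hψ2 h).symm
  refine ⟨_, ?_, hL K s (fun j => T' j) y1 ?_ ?_⟩
  · intro i
    rw [hval, hhval, div_eq_mul_inv]
    have h1 := hP.rel_res (eval₂ ψ y1 (r i))
    have h2 := hP.rel_res (ψ h)
    rw [hres _ _ hy1, hr] at h1
    rw [hhres] at h2
    have h3 := hP.mul h1 (hP.inv h2 hh)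
    have h4 : ∀ b c : R, b ≠ 0 → b * c * b⁻¹ = c := fun b c hb => by field_simp
    rwa [h4 _ _ hh] at h3
  · rw [hval, ← eval_map, hroot]
    rfl
  · rw [hhval]
    intro h0
    have : ψ h = 0 := Subtype.ext h0
    rw [this, map_zero] at hhres
    exact hh hhres.symm

lemma IsPlace.exists_lift {K : Type u} [Field K] {P : K → R → Prop} (hP : IsPlace P)
    (hH : IsPlaceHensel P) [ExpChar F p]
    {s : F →+* K} {σ : F →+* R} (hs : ∀ x, P (s x) (σ x)) (hσ : PInd p σ) {ι : Type*}
    (a : ι → R) (Z : Finset (MvPolynomial ι F)) (hZ : ∀ z ∈ Z, z.eval₂ σ a = 0) :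
    ∃ x : ι → K, (∀ i, P (x i) (a i)) ∧ ∀ z ∈ Z, z.eval₂ s x = 0 := by
  classical
  let V : Finset ι := Z.biUnion MvPolynomial.vars
  have hV : ∀ z ∈ Z, ∃ z' : MvPolynomial V F, MvPolynomial.rename Subtype.val z' = z := by
    intro z hz
    apply MvPolynomial.exists_rename_eq_of_vars_subset_range _ _ Subtype.val_injective
    intro i hi
    rw [Subtype.range_val]
    exact Finset.mem_biUnion.2 ⟨z, hz, hi⟩
  choose! g hg using hV
  obtain ⟨x, hx, hxZ⟩ := hP.exists_lift_finite hH hs hσ (fun i : V => a i) (Z.image g) (by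
    intro z' hz'
    obtain ⟨z, hz, rfl⟩ := Finset.mem_image.1 hz'
    rw [← hZ z hz]
    conv_rhs => rw [← hg z hz]
    rw [MvPolynomial.eval₂_rename]
    rfl)
  choose t ht using fun i => hP.surj (a i)
  refine ⟨fun i => if h : i ∈ V then x ⟨i, h⟩ else t i, ?_, ?_⟩
  · intro i
    dsimp only
    split_ifs with h
    · exact hx ⟨i, h⟩
    · exact ht i
  · intro z hz
    rw [← hxZ _ (Finset.mem_image_of_mem g hz)]
    conv_lhs => rw [← hg z hz]
    rw [MvPolynomial.eval₂_rename]
    congr 1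
    ext i
    simp

end Place

end Paper

namespace Paper

section Ultrapower

open Polynomial Filter

variable {I : Type*} (U : Ultrafilter I)

/-- The diagonal embedding of a ring into its ultrapower. -/
def diag (R : Type*) [CommRing R] : R →+* Germ (U : Filter I) R :=
  (Germ.coeRingHom (U : Filter I)).comp (Pi.constRingHom I R)

/-- A smooth point on an affine plane curve is not the only point with nonzero first coordinate
avoiding a given curve not passing through it, phrased with coefficient arrays. -/
def LargeCurve (R : Type*) [Field R] : Prop :=
  ∀ (N : ℕ) (c d : ℕ → ℕ → R), 2 ≤ N → c 0 0 = 0 → c 0 1 ≠ 0 → d 0 0 ≠ 0 →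
    ∃ t y : R, t ≠ 0 ∧ ∑ i ∈ Finset.range N, ∑ j ∈ Finset.range N, c i j * t ^ i * y ^ j = 0 ∧
      ∑ i ∈ Finset.range N, ∑ j ∈ Finset.range N, d i j * t ^ i * y ^ j ≠ 0

variable {K R : Type*} [Field K] [Field R]

lemma germ_exists_rep {β : Type*} (x : Germ (U : Filter I) β) : ∃ f : I → β, (f : Germ (U : Filter I) β) = x :=
  Quotient.exists_rep x

lemma germ_coe_eq {β : Type*} {f g : I → β} :
    (f : Germ (U : Filter I) β) = g ↔ ∀ᶠ i in (U : Filter I), f i = g i := Germ.coe_eq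

lemma germ_coe_eq_zero {f : I → R} :
    (f : Germ (U : Filter I) R) = 0 ↔ ∀ᶠ i in (U : Filter I), f i = 0 := by
  rw [← Germ.coe_zero]
  exact Germ.coe_eq

lemma germ_coe_ne_zero {f : I → R} :
    (f : Germ (U : Filter I) R) ≠ 0 ↔ ∀ᶠ i in (U : Filter I), f i ≠ 0 := by
  rw [Ne, germ_coe_eq_zero, ← Ultrafilter.eventually_not]

lemma germ_coe_eval₂ {F : Type*} [CommRing F] {ι : Type*} (s : F →+* R) (x : ι → I → R)
    (z : MvPolynomial ι F) :
    ((fun n => z.eval₂ s (fun i => x i n) : I → R) : Germ (U : Filter I) R) =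
      z.eval₂ ((diag U R).comp s) (fun i => (x i : Germ (U : Filter I) R)) := by
  have h1 := MvPolynomial.hom_eval₂ z ((Pi.constRingHom I R).comp s)
    (Germ.coeRingHom (U : Filter I)) x
  refine Eq.trans ?_ (h1.trans ?_)
  · change _ = Germ.ofFun (l := (U : Filter I))
      (MvPolynomial.eval₂ ((Pi.constRingHom I R).comp s) x z)
    congr 1
    ext n
    have h2 := MvPolynomial.hom_eval₂ z ((Pi.constRingHom I R).comp s)
      (Pi.evalRingHom (fun _ => R) n) x
    exact h2.symm
  · rfl

lemma LargeCurve.germ (h : LargeCurve R) : LargeCurve (Germ (U : Filter I) R) := by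
  intro N c d hN h0 h1 h2
  choose c' hc' using fun i j => germ_exists_rep U (c i j)
  choose d' hd' using fun i j => germ_exists_rep U (d i j)
  rw [← hc', germ_coe_eq_zero] at h0
  rw [← hc', germ_coe_ne_zero] at h1
  rw [← hd', germ_coe_ne_zero] at h2
  have : ∀ n, ∃ t y : R, c' 0 0 n = 0 → c' 0 1 n ≠ 0 → d' 0 0 n ≠ 0 →
    t ≠ 0 ∧ ∑ i ∈ Finset.range N, ∑ j ∈ Finset.range N, c' i j n * t ^ i * y ^ j = 0 ∧
      ∑ i ∈ Finset.range N, ∑ j ∈ Finset.range N, d' i j n * t ^ i * y ^ j ≠ 0 := by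
    intro n
    by_cases hn : c' 0 0 n = 0 ∧ c' 0 1 n ≠ 0 ∧ d' 0 0 n ≠ 0
    · obtain ⟨t, y, H⟩ := h N (fun i j => c' i j n) (fun i j => d' i j n) hN hn.1 hn.2.1 hn.2.2
      exact ⟨t, y, fun _ _ _ => H⟩
    · exact ⟨0, 0, fun a b c => absurd ⟨a, b, c⟩ hn⟩
  choose t y H using this
  have hsum : ∀ e : ℕ → ℕ → I → R, ((fun n => ∑ i ∈ Finset.range N, ∑ j ∈ Finset.range N,
      e i j n * t n ^ i * y n ^ j : I → R) : Germ (U : Filter I) R) =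
      ∑ i ∈ Finset.range N, ∑ j ∈ Finset.range N,
        (e i j : Germ (U : Filter I) R) * (t : Germ (U : Filter I) R) ^ i *
          (y : Germ (U : Filter I) R) ^ j := by
    intro e
    have h3 : (fun n => ∑ i ∈ Finset.range N, ∑ j ∈ Finset.range N,
      e i j n * t n ^ i * y n ^ j : I → R) = ∑ i ∈ Finset.range N, ∑ j ∈ Finset.range N,
      e i j * t ^ i * y ^ j := by
      ext n
      simp
    rw [h3]
    change Germ.coeRingHom (U : Filter I) _ = _
    simp only [map_sum, map_mul, map_pow]
    rfl
  refine ⟨t, y, ?_, ?_, ?_⟩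
  · rw [germ_coe_ne_zero]
    filter_upwards [h0, h1, h2] with n a b c using (H n a b c).1
  · simp only [← hc']
    rw [← hsum, germ_coe_eq_zero]
    filter_upwards [h0, h1, h2] with n a b c using (H n a b c).2.1
  · simp only [← hd']
    rw [← hsum, germ_coe_ne_zero]
    filter_upwards [h0, h1, h2] with n a b c using (H n a b c).2.2

variable {P : K → R → Prop}

lemma IsPlace.germ (h : IsPlace P) :
    IsPlace (Germ.LiftRel P : Germ (U : Filter I) K → Germ (U : Filter I) R → Prop) where
  one := Germ.liftRel_const h.one
  neg := by
    intro x r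
    obtain ⟨x, rfl⟩ := germ_exists_rep U x
    obtain ⟨r, rfl⟩ := germ_exists_rep U r
    intro H
    exact Eventually.mono (Germ.liftRel_coe.1 H) fun n hn => h.neg hn
  add := by
    intro x y r s
    obtain ⟨x, rfl⟩ := germ_exists_rep U x
    obtain ⟨r, rfl⟩ := germ_exists_rep U r
    obtain ⟨y, rfl⟩ := germ_exists_rep U y
    obtain ⟨s, rfl⟩ := germ_exists_rep U s
    intro H H'
    filter_upwards [Germ.liftRel_coe.1 H, Germ.liftRel_coe.1 H'] with n a b using h.add a b
  mul := by
    intro x y r s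
    obtain ⟨x, rfl⟩ := germ_exists_rep U x
    obtain ⟨r, rfl⟩ := germ_exists_rep U r
    obtain ⟨y, rfl⟩ := germ_exists_rep U y
    obtain ⟨s, rfl⟩ := germ_exists_rep U s
    intro H H'
    filter_upwards [Germ.liftRel_coe.1 H, Germ.liftRel_coe.1 H'] with n a b using h.mul a b
  uniq := by
    intro x r s
    obtain ⟨x, rfl⟩ := germ_exists_rep U x
    obtain ⟨r, rfl⟩ := germ_exists_rep U r
    obtain ⟨s, rfl⟩ := germ_exists_rep U s
    intro H H'
    rw [germ_coe_eq]
    filter_upwards [Germ.liftRel_coe.1 H, Germ.liftRel_coe.1 H'] with n a b using h.uniq a b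
  total := by
    intro x
    obtain ⟨x, rfl⟩ := germ_exists_rep U x
    have H : ∀ᶠ n in (U : Filter I), (∃ r, P (x n) r) ∨ P (x n)⁻¹ 0 :=
      Eventually.of_forall fun n => h.total (x n)
    rcases Ultrafilter.eventually_or.1 H with H | H
    · left
      have : ∀ n, ∃ r, (∃ r, P (x n) r) → P (x n) r := by
        intro n
        by_cases hn : ∃ r, P (x n) r
        · exact ⟨hn.choose, fun _ => hn.choose_spec⟩
        · exact ⟨0, fun h => absurd h hn⟩
      choose r hr using this
      exact ⟨r, Eventually.mono H fun n => hr n⟩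
    · right
      exact H
  surj := by
    intro r
    obtain ⟨r, rfl⟩ := germ_exists_rep U r
    choose x hx using h.surj
    exact ⟨fun n => x (r n), Eventually.of_forall fun n => hx _⟩

lemma IsPlaceHensel.germ (h : IsPlaceHensel P) (hP : IsPlace P) :
    IsPlaceHensel (Germ.LiftRel P : Germ (U : Filter I) K → Germ (U : Filter I) R → Prop) := by
  intro g hg h0 h1
  choose c hc using fun i => germ_exists_rep U (g.coeff i)
  have hg' : ∀ i, ∀ᶠ n in (U : Filter I), ∃ r, P (c i n) r := by
    intro i
    obtain ⟨r, hr⟩ := hg i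
    obtain ⟨r, rfl⟩ := germ_exists_rep U r
    rw [← hc i] at hr
    exact Eventually.mono (Germ.liftRel_coe.1 hr) fun n hn => ⟨_, hn⟩
  rw [← hc 0] at h0
  rw [← hc 1] at h1
  have h0' : ∀ᶠ n in (U : Filter I), P (c 0 n) 0 := Germ.liftRel_coe.1 h0
  have h1' : ∀ᶠ n in (U : Filter I), ¬ P (c 1 n) 0 := Ultrafilter.eventually_not.2 h1
  let N := g.natDegree + 2
  have hgN : ∀ᶠ n in (U : Filter I), ∀ i ∈ Finset.range N, ∃ r, P (c i n) r :=
    (Filter.eventually_all_finset (Finset.range N)).2 fun i _ => hg' i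
  let G : I → K[X] := fun n => ∑ i ∈ Finset.range N, C (c i n) * X ^ i
  have hG : ∀ n i, (G n).coeff i = if i < N then c i n else 0 := by
    intro n i
    simp [G, coeff_X_pow]
  have : ∀ n, ∃ y, P (c 0 n) 0 → ¬ P (c 1 n) 0 → (∀ i ∈ Finset.range N, ∃ r, P (c i n) r) →
      P y 0 ∧ (G n).eval y = 0 := by
    intro n
    by_cases hn : P (c 0 n) 0 ∧ ¬ P (c 1 n) 0 ∧ (∀ i ∈ Finset.range N, ∃ r, P (c i n) r)
    · obtain ⟨y, hy⟩ := h (G n) (by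
        intro i
        rw [hG]
        split_ifs with hi
        · exact hn.2.2 i (Finset.mem_range.2 hi)
        · exact ⟨0, hP.zero⟩) (by rw [hG, if_pos (by simp [N])]; exact hn.1)
        (by rw [hG, if_pos (by simp [N])]; exact hn.2.1)
      exact ⟨y, fun _ _ _ => hy⟩
    · exact ⟨0, fun a b c => absurd ⟨a, b, c⟩ hn⟩
  choose y hy using this
  refine ⟨y, ?_, ?_⟩
  · change ∀ᶠ n in (U : Filter I), P (y n) 0
    filter_upwards [h0', h1', hgN] with n a b c using (hy n a b c).1
  · have hev : g.eval (y : Germ (U : Filter I) K) =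
        ((fun n => (G n).eval (y n) : I → K) : Germ (U : Filter I) K) := by
      rw [eval_eq_sum_range' (n := N) (by simp [N])]
      simp only [← hc]
      have h3 : (fun n => (G n).eval (y n) : I → K) = ∑ i ∈ Finset.range N, c i * y ^ i := by
        ext n
        simp [G, eval_finsetSum]
      rw [h3]
      change _ = Germ.coeRingHom (U : Filter I) _
      simp only [map_sum, map_mul, map_pow]
      rfl
    rw [hev, germ_coe_eq_zero]
    filter_upwards [h0', h1', hgN] with n a b c using (hy n a b c).2

lemma PInd.diag (p : ℕ) : PInd p (diag U R) := by
  intro m c hc x hx i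
  choose x' hx' using fun i => germ_exists_rep U (x i)
  simp only [← hx'] at hx
  have h3 : ∑ i, Paper.diag U R (c i) * (x' i : Germ (U : Filter I) R) ^ p =
      ((fun n => ∑ i, c i * x' i n ^ p : I → R) : Germ (U : Filter I) R) := by
    have h4 : (fun n => ∑ i, c i * x' i n ^ p : I → R) =
        ∑ i, (Pi.constRingHom I R (c i)) * x' i ^ p := by
      ext n
      simp
    rw [h4]
    change _ = Germ.coeRingHom (U : Filter I) _
    simp only [map_sum, map_mul, map_pow]
    rfl
  rw [h3, germ_coe_eq_zero] at hx
  rw [← hx', germ_coe_eq_zero]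
  exact Eventually.mono hx fun n hn => hc _ hn i

end Ultrapower

end Paper

namespace Paper

section Stage

open Polynomial Filter

/-- A henselian place of `K` over a field `F` embedded in the residue field by a map that
preserves `p`-independence, with residue field large in the sense of `LargeCurve`. -/
structure Stage (p : ℕ) where
  F : Type u
  K : Type u
  R : Type u
  [fieldF : Field F]
  [fieldK : Field K]
  [fieldR : Field R]
  [expChar : ExpChar F p]
  s : F →+* K
  σ : F →+* R
  P : K → R → Prop
  place : IsPlace P
  hensel : IsPlaceHensel P
  compat : ∀ x, P (s x) (σ x)
  pind : PInd p σ
  large : LargeCurve R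

attribute [instance] Stage.fieldF Stage.fieldK Stage.fieldR Stage.expChar

variable {p : ℕ}

lemma Stage.exists_section (S : Stage.{u} p) : ∃ (I : Type u) (U : Ultrafilter I)
    (s' : S.R →+* Germ (U : Filter I) S.K),
    s'.comp S.σ = (diag U S.K).comp S.s ∧
    ∀ r, Germ.LiftRel S.P (s' r) (diag U S.R r) := by
  classical
  let J := {z : MvPolynomial S.R S.F // z.eval₂ S.σ id = 0}
  let I := Finset J
  let U : Ultrafilter I := Ultrafilter.of atTop
  have hU : ∀ z : J, ∀ᶠ Z in (U : Filter I), z ∈ Z := by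
    intro z
    apply Ultrafilter.of_le atTop
    filter_upwards [eventually_ge_atTop ({z} : Finset J)] with Z hZ
    exact hZ (Finset.mem_singleton_self z)
  have hx : ∀ Z : I, ∃ x : S.R → S.K, (∀ r, S.P (x r) r) ∧
      ∀ z ∈ Z, z.1.eval₂ S.s x = 0 := by
    intro Z
    obtain ⟨x, hx, hx'⟩ := S.place.exists_lift S.hensel S.compat S.pind (id : S.R → S.R)
      (Z.image Subtype.val) (by
        intro z hz
        obtain ⟨z, _, rfl⟩ := Finset.mem_image.1 hz
        exact z.2)
    exact ⟨x, hx, fun z hz => hx' _ (Finset.mem_image_of_mem _ hz)⟩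
  choose x hx hxZ using hx
  let t : S.R → Germ (U : Filter I) S.K := fun r => ((fun Z => x Z r : I → S.K) : Germ _ _)
  have ht : ∀ z : MvPolynomial S.R S.F, z.eval₂ S.σ id = 0 →
      z.eval₂ ((diag U S.K).comp S.s) t = 0 := by
    intro z hz
    have h1 := germ_coe_eval₂ U S.s (fun r Z => x Z r) z
    rw [← h1, germ_coe_eq_zero]
    filter_upwards [hU ⟨z, hz⟩] with Z hZ
    exact hxZ Z _ hZ
  let s' : S.R →+* Germ (U : Filter I) S.K :=
    { toFun := t
      map_one' := by
        have := ht (MvPolynomial.X 1 - MvPolynomial.C 1) (by simp)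
        simpa [sub_eq_zero] using this
      map_zero' := by
        have := ht (MvPolynomial.X 0) (by simp)
        simpa using this
      map_add' := fun a b => by
        have := ht (MvPolynomial.X (a + b) - (MvPolynomial.X a + MvPolynomial.X b)) (by simp)
        simpa [sub_eq_zero, -MvPolynomial.eval₂_add, MvPolynomial.eval₂_add] using this
      map_mul' := fun a b => by
        have := ht (MvPolynomial.X (a * b) - (MvPolynomial.X a * MvPolynomial.X b))
          (by simp [MvPolynomial.eval₂_mul])
        simpa [sub_eq_zero, MvPolynomial.eval₂_mul] using this }
  refine ⟨I, U, s', ?_, ?_⟩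
  · ext c
    have := ht (MvPolynomial.X (S.σ c) - MvPolynomial.C c) (by simp)
    rw [MvPolynomial.eval₂_sub, MvPolynomial.eval₂_X, MvPolynomial.eval₂_C, sub_eq_zero] at this
    exact this
  · intro r
    exact Eventually.of_forall fun Z => hx Z r

/-- The index set of the ultrapower used in `Stage.next`. -/
def Stage.I (S : Stage.{u} p) : Type u := S.exists_section.choose

/-- The ultrafilter of the ultrapower used in `Stage.next`. -/
noncomputable def Stage.U (S : Stage.{u} p) : Ultrafilter S.I := S.exists_section.choose_spec.choose

/-- A section, in an ultrapower, of the residue map of a stage. -/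
noncomputable def Stage.sect (S : Stage.{u} p) : S.R →+* Germ (S.U : Filter S.I) S.K :=
  S.exists_section.choose_spec.choose_spec.choose

lemma Stage.sect_comp (S : Stage.{u} p) : S.sect.comp S.σ = (diag S.U S.K).comp S.s :=
  S.exists_section.choose_spec.choose_spec.choose_spec.1

lemma Stage.sect_rel (S : Stage.{u} p) (r : S.R) :
    Germ.LiftRel S.P (S.sect r) (diag S.U S.R r) :=
  S.exists_section.choose_spec.choose_spec.choose_spec.2 r

/-- The stage over the residue field of `S` obtained from an ultrapower of `S`. -/
noncomputable def Stage.next (S : Stage.{u} p) : Stage.{u} p :=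
  have : ExpChar S.R p := expChar_of_injective_ringHom S.σ.injective p
  { F := S.R
    K := Germ (S.U : Filter S.I) S.K
    R := Germ (S.U : Filter S.I) S.R
    s := S.sect
    σ := diag S.U S.R
    P := Germ.LiftRel S.P
    place := S.place.germ S.U
    hensel := S.hensel.germ S.U S.place
    compat := S.sect_rel
    pind := PInd.diag S.U p
    large := S.large.germ S.U }

/-- The embedding of the field of a stage in that of the next stage. -/
noncomputable def Stage.up (S : Stage.{u} p) : S.K →+* S.next.K := diag S.U S.K

/-- The embedding of the residue field of a stage in that of the next stage. -/
noncomputable def Stage.upR (S : Stage.{u} p) : S.R →+* S.next.R := diag S.U S.R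

lemma Stage.up_rel (S : Stage.{u} p) {x : S.K} {r : S.R} (h : S.P x r) :
    S.next.P (S.up x) (S.upR r) := Germ.liftRel_const h

/-- The embedding of the residue field of a stage in the field of the next stage. -/
noncomputable def Stage.lift (S : Stage.{u} p) : S.R →+* S.next.K := S.sect

lemma Stage.lift_rel (S : Stage.{u} p) (r : S.R) : S.next.P (S.lift r) (S.upR r) := S.sect_rel r

lemma Stage.lift_σ (S : Stage.{u} p) (c : S.F) : S.lift (S.σ c) = S.up (S.s c) :=
  DFunLike.congr_fun S.sect_comp c

lemma Stage.next_lift_upR (S : Stage.{u} p) (r : S.R) :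
    S.next.lift (S.upR r) = S.next.up (S.lift r) :=
  S.next.lift_σ (r : S.next.F)

/-- The system `Z = 0`, `q ≠ 0` has a solution in `X`. -/
def Sol {n : ℕ} {F X : Type*} [CommRing F] [CommRing X] (φ : F →+* X)
    (Z : Finset (MvPolynomial (Fin n) F)) (q : MvPolynomial (Fin n) F) : Prop :=
  ∃ a : Fin n → X, (∀ z ∈ Z, z.eval₂ φ a = 0) ∧ q.eval₂ φ a ≠ 0

lemma Sol.of_diag {F X : Type*} [CommRing F] [Field X] {I : Type*} (U : Ultrafilter I) {n : ℕ}
    {φ : F →+* X} {Z : Finset (MvPolynomial (Fin n) F)} {q : MvPolynomial (Fin n) F}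
    (h : Sol ((diag U X).comp φ) Z q) : Sol φ Z q := by
  obtain ⟨a, hZ, hq⟩ := h
  choose a' ha' using fun i => germ_exists_rep U (a i)
  have h1 : ∀ z : MvPolynomial (Fin n) F, z.eval₂ ((diag U X).comp φ) a =
      ((fun k => z.eval₂ φ (fun i => a' i k) : I → X) : Germ (U : Filter I) X) := by
    intro z
    rw [germ_coe_eval₂]
    congr 1
    ext i
    exact (ha' i).symm
  have hZ' : ∀ᶠ k in (U : Filter I), ∀ z ∈ Z, z.eval₂ φ (fun i => a' i k) = 0 :=
    (Filter.eventually_all_finset Z).2 fun z hz => by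
      rw [← germ_coe_eq_zero, ← h1, hZ z hz]
  rw [h1, germ_coe_ne_zero] at hq
  obtain ⟨k, hk, hk'⟩ := (hZ'.and hq).exists
  exact ⟨fun i => a' i k, hk, hk'⟩

lemma Sol.map {F X Y : Type*} [CommRing F] [CommRing X] [CommRing Y] {n : ℕ} {φ : F →+* X}
    {Z : Finset (MvPolynomial (Fin n) F)} {q : MvPolynomial (Fin n) F} (h : Sol φ Z q)
    (ψ : X →+* Y) (hψ : Function.Injective ψ) : Sol (ψ.comp φ) Z q := by
  obtain ⟨a, hZ, hq⟩ := h
  refine ⟨ψ ∘ a, fun z hz => ?_, ?_⟩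
  · have := (MvPolynomial.hom_eval₂ z φ ψ a).symm.trans (congrArg ψ (hZ z hz))
    rwa [map_zero] at this
  · intro h0
    refine hq (hψ ((MvPolynomial.hom_eval₂ q φ ψ a).trans ?_))
    rw [map_zero]
    exact h0

/-- The direct limit of a sequence of fields. -/
lemma exists_chain_union (K : ℕ → Type u) [∀ i, Field (K i)] (d : ∀ i, K i →+* K (i + 1)) :
    ∃ (M : Type u) (_ : Field M) (e : ∀ i, K i →+* M), (∀ i, (e (i + 1)).comp (d i) = e i) ∧
      ∀ x : M, ∃ i y, e i y = x := by
  let f : ∀ i j : ℕ, i ≤ j → K i →+* K j := fun i j h =>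
    Nat.leRec (motive := fun j _ => K i →+* K j) (RingHom.id _) (fun k _ g => (d k).comp g) h
  have hf0 : ∀ i, f i i le_rfl = RingHom.id _ := fun i => Nat.leRec_self _ _
  have hfs : ∀ i j (h : i ≤ j), f i (j + 1) (Nat.le_succ_of_le h) = (d j).comp (f i j h) :=
    fun i j h => Nat.leRec_succ _ _ _
  have : DirectedSystem K (fun i j h => (f i j h : K i → K j)) :=
    { map_self := fun i x => by rw [hf0]; rfl
      map_map := by
        intro k j i hij hjk x
        induction k, hjk using Nat.le_induction with
        | base => rw [hf0]; rfl
        | succ m hjk ih =>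
          rw [hfs j m hjk, hfs i m (hij.trans hjk), RingHom.comp_apply, RingHom.comp_apply, ih] }
  refine ⟨DirectLimit K f, inferInstance, fun i => DirectLimit.Ring.of K f i, ?_, ?_⟩
  · intro i
    ext x
    have h1 : d i = f i (i + 1) (Nat.le_succ i) := by
      rw [hfs i i le_rfl, hf0, RingHom.comp_id]
    rw [RingHom.comp_apply, h1]
    exact DirectLimit.Ring.of_f _ _
  · intro x
    induction x using DirectLimit.induction with
    | _ i x => exact ⟨i, x, rfl⟩

end Stage

end Paper

namespace Paper

section Chain

variable {p : ℕ}

/-- The iterates of `Stage.next`. -/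
noncomputable def Stage.iter (S : Stage.{u} p) : ℕ → Stage.{u} p
  | 0 => S
  | i + 1 => (S.iter i).next

/-- The embedding of the base field of a stage in the residue fields of its iterates. -/
noncomputable def Stage.toR (S : Stage.{u} p) : ∀ i, S.F →+* (S.iter i).R
  | 0 => S.σ
  | i + 1 => (S.iter i).upR.comp (S.toR i)

/-- The semantic form of `R4N`. -/
def R4Sol (n : ℕ) : Prop :=
  ∀ (E : Type u) [Field E] (Γ : Type u) [LinearOrderedCommGroupWithZero Γ]
    (w : Valuation E Γ) (F : Subfield E),
    LargeField.{u} F →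
    (∀ y : F, (y : E) ≠ 0 → w y = 1) →
    (∀ y : E, w y ≤ 1 → ∃ x : F, w (y - x) < 1) →
    ∀ (Z : Finset (MvPolynomial (Fin n) F)) (q : MvPolynomial (Fin n) F),
      Sol F.subtype Z q → Sol (RingHom.id F) Z q

lemma largeCurve_of_directed {M : Type u} [Field M] (R : ℕ → Type u) [∀ i, Field (R i)]
    (g : ∀ i, R i →+* M) (hg : ∀ i j, i ≤ j → (g i).range ≤ (g j).range)
    (hR : ∀ i, LargeCurve (R i)) (F : Subfield M) (hF : ∀ x, x ∈ F ↔ ∃ i, x ∈ (g i).range) :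
    LargeCurve F := by
  intro N c d hN h0 h1 h2
  have hF' : ∀ x : F, ∃ i, (x : M) ∈ (g i).range := fun x => (hF x).1 x.2
  choose m hm using hF'
  let k := (Finset.range N).sup fun i => (Finset.range N).sup fun j => max (m (c i j)) (m (d i j))
  have hk : ∀ i ∈ Finset.range N, ∀ j ∈ Finset.range N, m (c i j) ≤ k ∧ m (d i j) ≤ k := by
    intro i hi j hj
    have h3 : (Finset.range N).sup (fun j => max (m (c i j)) (m (d i j))) ≤ k :=
      Finset.le_sup (f := fun i => (Finset.range N).sup fun j => max (m (c i j)) (m (d i j))) hi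
    have h4 : max (m (c i j)) (m (d i j)) ≤ _ :=
      Finset.le_sup (f := fun j => max (m (c i j)) (m (d i j))) hj
    exact max_le_iff.1 (h4.trans h3)
  have hc : ∀ i j, ∃ r, i ∈ Finset.range N → j ∈ Finset.range N → g k r = c i j := by
    intro i j
    by_cases h : i ∈ Finset.range N ∧ j ∈ Finset.range N
    · obtain ⟨r, hr⟩ := hg _ _ (hk i h.1 j h.2).1 (hm (c i j))
      exact ⟨r, fun _ _ => hr⟩
    · exact ⟨0, fun a b => absurd ⟨a, b⟩ h⟩
  have hd : ∀ i j, ∃ r, i ∈ Finset.range N → j ∈ Finset.range N → g k r = d i j := by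
    intro i j
    by_cases h : i ∈ Finset.range N ∧ j ∈ Finset.range N
    · obtain ⟨r, hr⟩ := hg _ _ (hk i h.1 j h.2).2 (hm (d i j))
      exact ⟨r, fun _ _ => hr⟩
    · exact ⟨0, fun a b => absurd ⟨a, b⟩ h⟩
  choose c' hc' using hc
  choose d' hd' using hd
  have hN0 : 0 ∈ Finset.range N := Finset.mem_range.2 (by omega)
  have hN1 : 1 ∈ Finset.range N := Finset.mem_range.2 (by omega)
  obtain ⟨t, y, ht, hf, hq⟩ := hR k N c' d' hN
    (by
      apply (g k).injective
      rw [hc' 0 0 hN0 hN0, h0, map_zero]; rfl)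
    (by
      intro h
      apply h1
      apply Subtype.ext
      rw [← hc' 0 1 hN0 hN1, h, map_zero]; rfl)
    (by
      intro h
      apply h2
      apply Subtype.ext
      rw [← hd' 0 0 hN0 hN0, h, map_zero]; rfl)
  have hmem : ∀ r, g k r ∈ F := fun r => (hF _).2 ⟨k, r, rfl⟩
  let t' : F := ⟨g k t, hmem t⟩
  let y' : F := ⟨g k y, hmem y⟩
  have hsum : ∀ (e : ℕ → ℕ → F) (e' : ℕ → ℕ → R k), (∀ i j, i ∈ Finset.range N →
      j ∈ Finset.range N → g k (e' i j) = e i j) →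
      ((∑ i ∈ Finset.range N, ∑ j ∈ Finset.range N, e i j * t' ^ i * y' ^ j : F) : M) =
      g k (∑ i ∈ Finset.range N, ∑ j ∈ Finset.range N, e' i j * t ^ i * y ^ j) := by
    intro e e' he
    change F.subtype _ = _
    simp only [map_sum, map_mul, map_pow]
    refine Finset.sum_congr rfl fun i hi => Finset.sum_congr rfl fun j hj => ?_
    rw [he i j hi hj]
    rfl
  refine ⟨t', y', ?_, ?_, ?_⟩
  · intro h
    apply ht
    apply (g k).injective
    rw [map_zero]
    exact congrArg Subtype.val h
  · apply Subtype.ext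
    rw [hsum c c' hc', hf, map_zero]; rfl
  · intro h
    apply hq
    apply (g k).injective
    rw [← hsum d d' hd', h, map_zero]; rfl

theorem Stage.sol_residue (S : Stage.{u} p) {n : ℕ} (hR4 : R4Sol.{u} n)
    (hlarge : ∀ (F : Type u) [Field F], LargeCurve F → LargeField F)
    {Z : Finset (MvPolynomial (Fin n) S.F)} {q : MvPolynomial (Fin n) S.F}
    (h : Sol S.s Z q) : Sol S.σ Z q := by
  classical
  obtain ⟨M, _, e, he, hM⟩ := exists_chain_union (fun i => (S.iter i).K) (fun i => (S.iter i).up)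
  have he' : ∀ i (x : (S.iter i).K), e (i + 1) ((S.iter i).up x) = e i x :=
    fun i x => DFunLike.congr_fun (he i) x
  let g : ∀ i, (S.iter i).R →+* M := fun i => (e (i + 1)).comp (S.iter i).lift
  have hg : ∀ i r, g (i + 1) ((S.iter i).upR r) = g i r := by
    intro i r
    change e (i + 2) ((S.iter i).next.lift ((S.iter i).upR r)) = e (i + 1) ((S.iter i).lift r)
    rw [(S.iter i).next_lift_upR]
    exact he' (i + 1) _
  have hgmono : ∀ i j, i ≤ j → (g i).range ≤ (g j).range := by
    intro i j hij
    induction j, hij using Nat.le_induction with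
    | base => exact le_rfl
    | succ j hij ih =>
      refine ih.trans ?_
      rintro _ ⟨r, rfl⟩
      exact ⟨_, hg j r⟩
  let F : Subfield M :=
    { carrier := {x | ∃ i, x ∈ (g i).range}
      mul_mem' := by
        rintro a b ⟨i, hi⟩ ⟨j, hj⟩
        exact ⟨max i j, mul_mem (hgmono _ _ (le_max_left i j) hi) (hgmono _ _ (le_max_right i j) hj)⟩
      one_mem' := ⟨0, one_mem _⟩
      add_mem' := by
        rintro a b ⟨i, hi⟩ ⟨j, hj⟩
        exact ⟨max i j, add_mem (hgmono _ _ (le_max_left i j) hi) (hgmono _ _ (le_max_right i j) hj)⟩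
      zero_mem' := ⟨0, zero_mem _⟩
      neg_mem' := by
        rintro a ⟨i, hi⟩
        exact ⟨i, neg_mem hi⟩
      inv_mem' := by
        rintro a ⟨i, r, rfl⟩
        exact ⟨i, r⁻¹, map_inv₀ _ _⟩ }
  have hF : ∀ x, x ∈ F ↔ ∃ i, x ∈ (g i).range := fun x => Iff.rfl
  have hFlarge : LargeField F := hlarge F
    (largeCurve_of_directed (fun i => (S.iter i).R) g hgmono (fun i => (S.iter i).large) F hF)
  let Q : ∀ i, M → (S.iter i).R → Prop := fun i x r => ∃ y, (S.iter i).P y r ∧ e i y = x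
  have hQup : ∀ i x r, Q i x r → Q (i + 1) x ((S.iter i).upR r) := by
    rintro i x r ⟨y, hy, rfl⟩
    exact ⟨(S.iter i).up y, (S.iter i).up_rel hy, he' i y⟩
  have hQmono : ∀ i j, i ≤ j → ∀ x r, Q i x r → ∃ r', Q j x r' ∧ (r = 0 → r' = 0) := by
    intro i j hij x r hr
    induction j, hij using Nat.le_induction with
    | base => exact ⟨r, hr, id⟩
    | succ j hij ih =>
      obtain ⟨r', hr', h0⟩ := ih
      exact ⟨_, hQup _ _ _ hr', fun h => (congrArg _ (h0 h)).trans (map_zero _)⟩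
  have hQ0 : ∀ i j x, x ≠ 0 → Q i x 0 → ∀ r, ¬ Q j x⁻¹ r := by
    intro i j x hx hi r hj
    obtain ⟨r1, ⟨y1, h1, h1'⟩, h10⟩ := hQmono i _ (le_max_left i j) _ _ hi
    obtain ⟨r2, ⟨y2, h2, h2'⟩, -⟩ := hQmono j _ (le_max_right i j) _ _ hj
    obtain rfl := h10 rfl
    have h3 := (S.iter (max i j)).place.mul h1 h2
    have h4 : y1 * y2 = 1 := by
      apply (e (max i j)).injective
      rw [map_mul, h1', h2', mul_inv_cancel₀ hx, map_one]
    rw [h4, zero_mul] at h3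
    exact zero_ne_one ((S.iter (max i j)).place.uniq h3 (S.iter (max i j)).place.one)
  let O : ValuationSubring M :=
    { carrier := {x | ∃ i r, Q i x r}
      mul_mem' := by
        rintro a b ⟨i, r, hi⟩ ⟨j, s, hj⟩
        obtain ⟨r1, ⟨y1, h1, h1'⟩, -⟩ := hQmono i _ (le_max_left i j) _ _ hi
        obtain ⟨r2, ⟨y2, h2, h2'⟩, -⟩ := hQmono j _ (le_max_right i j) _ _ hj
        exact ⟨max i j, _, _, (S.iter (max i j)).place.mul h1 h2, by rw [map_mul, h1', h2']⟩
      one_mem' := ⟨0, 1, 1, (S.iter 0).place.one, map_one _⟩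
      add_mem' := by
        rintro a b ⟨i, r, hi⟩ ⟨j, s, hj⟩
        obtain ⟨r1, ⟨y1, h1, h1'⟩, -⟩ := hQmono i _ (le_max_left i j) _ _ hi
        obtain ⟨r2, ⟨y2, h2, h2'⟩, -⟩ := hQmono j _ (le_max_right i j) _ _ hj
        exact ⟨max i j, _, _, (S.iter (max i j)).place.add h1 h2, by rw [map_add, h1', h2']⟩
      zero_mem' := ⟨0, 0, 0, (S.iter 0).place.zero, map_zero _⟩
      neg_mem' := by
        rintro a ⟨i, r, y, hy, rfl⟩
        exact ⟨i, _, _, (S.iter i).place.neg hy, map_neg _ _⟩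
      mem_or_inv_mem' := by
        intro x
        obtain ⟨i, y, rfl⟩ := hM x
        rcases (S.iter i).place.total y with ⟨r, hr⟩ | h
        · exact Or.inl ⟨i, r, y, hr, rfl⟩
        · exact Or.inr ⟨i, 0, _, h, map_inv₀ _ _⟩ }
  have hlt : ∀ i x, Q i x 0 → O.valuation x < 1 := by
    intro i x hx
    by_cases hx0 : x = 0
    · rw [hx0, map_zero]; exact zero_lt_one
    · by_contra hlt
      rw [not_lt] at hlt
      have h1 : O.valuation x⁻¹ ≤ 1 := by
        rw [map_inv₀]
        exact inv_le_one_of_one_le₀ hlt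
      rw [ValuationSubring.valuation_le_one_iff] at h1
      obtain ⟨j, r, hj⟩ := h1
      exact hQ0 i j x hx0 hx r hj
  have hFO : ∀ y ∈ F, y ∈ O := by
    rintro _ ⟨i, r, rfl⟩
    exact ⟨i + 1, _, _, (S.iter i).lift_rel r, rfl⟩
  have hbase : ∀ i c, g i (S.toR i c) = e 0 (S.s c) := by
    intro i c
    induction i with
    | zero =>
      change e 1 (S.lift (S.σ c)) = _
      rw [S.lift_σ]
      exact he' 0 _
    | succ i ih =>
      rw [← ih]
      exact hg i _
  let φ : S.F →+* F := ((e 0).comp S.s).codRestrict F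
    (fun c => (hF _).2 ⟨0, S.toR 0 c, hbase 0 c⟩)
  have hφ : F.subtype.comp φ = (e 0).comp S.s := rfl
  have hSol : Sol F.subtype (Z.image (MvPolynomial.map φ)) (MvPolynomial.map φ q) := by
    obtain ⟨a, hZ, hq⟩ := h.map (e 0) (e 0).injective
    refine ⟨a, ?_, ?_⟩
    · intro z hz
      obtain ⟨z', hz', rfl⟩ := Finset.mem_image.1 hz
      rw [MvPolynomial.eval₂_map, hφ]
      exact hZ z' hz'
    · rw [MvPolynomial.eval₂_map, hφ]
      exact hq
  obtain ⟨a, hZ, hq⟩ := hR4 M O.ValueGroup O.valuation F hFlarge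
    (by
      intro y hy
      have h1 : O.valuation (y : M) ≤ 1 := (O.valuation_le_one_iff _).2 (hFO y y.2)
      have h2 : O.valuation (y : M)⁻¹ ≤ 1 :=
        (O.valuation_le_one_iff _).2 (hFO _ (F.inv_mem y.2))
      rw [map_inv₀] at h2
      refine le_antisymm h1 ?_
      exact (inv_le_one₀ (by simpa [zero_lt_iff] using hy)).1 h2)
    (by
      intro y hy
      rw [ValuationSubring.valuation_le_one_iff] at hy
      obtain ⟨i, r, y, hy, rfl⟩ := hy
      refine ⟨⟨g i r, i, r, rfl⟩, hlt (i + 1) _ ⟨(S.iter i).up y - (S.iter i).lift r, ?_, ?_⟩⟩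
      · have h1 := (S.iter i).next.place.sub ((S.iter i).up_rel hy) ((S.iter i).lift_rel r)
        have h0 : (S.iter i).upR r - (S.iter i).upR r = 0 := sub_self _
        rw [h0] at h1
        exact h1
      · exact (map_sub (e (i + 1)) _ _).trans (congrArg (· - _) (he' i y))) _ _ hSol
  have hj : ∃ j, ∀ i, (a i : M) ∈ (g j).range := by
    choose m hm using fun i => (hF _).1 (a i).2
    exact ⟨Finset.univ.sup m, fun i => hgmono _ _ (Finset.le_sup (Finset.mem_univ i)) (hm i)⟩
  obtain ⟨j, hj⟩ := hj
  choose b hb using hj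
  have hval : ∀ z : MvPolynomial (Fin n) S.F, g j (z.eval₂ (S.toR j) b) =
      F.subtype ((MvPolynomial.map φ z).eval₂ (RingHom.id F) a) := by
    intro z
    rw [MvPolynomial.hom_eval₂, MvPolynomial.hom_eval₂, MvPolynomial.eval₂_map]
    congr 1
    · ext c
      exact hbase j c
    · ext i
      exact hb i
  have hSolj : Sol (S.toR j) Z q := by
    refine ⟨b, fun z hz => (g j).injective ?_, fun h0 => hq ?_⟩
    · rw [hval, hZ _ (Finset.mem_image_of_mem _ hz), map_zero, map_zero]
    · apply F.subtype.injective
      rw [← hval, h0, map_zero, map_zero]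
  clear * - hSolj
  induction j with
  | zero => exact hSolj
  | succ j ih => exact ih (Sol.of_diag _ hSolj)

end Chain

end Paper

namespace Paper

section Fragments

variable {α : Type u} [Field α]

/-- Realization of a bounded `L_ring(α)`-formula without free variables other than the bounded
ones. -/
def RealizeAt {k : ℕ} {F : Type u} [Field F] (f : α → F) (a : Fin k → F)
    (φ : (Language.ring[[α]]).BoundedFormula Empty k) : Prop :=
  @BoundedFormula.Realize _ F (ringConStructure f) _ _ φ default a

/-- The value of an `L_ring(α)`-term. -/
noncomputable def termValue {k : ℕ} {F : Type u} [Field F] (f : α → F) (a : Fin k → F)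
    (t : (Language.ring[[α]]).Term (Empty ⊕ Fin k)) : F :=
  @Term.realize _ F (ringConStructure f) _ (Sum.elim default a) t

lemma exists_polynomial_of_term {k : ℕ} (t : (Language.ring[[α]]).Term (Empty ⊕ Fin k)) :
    ∃ P : MvPolynomial (Fin k) α, ∀ (F : Type u) [Field F] (f : α →+* F) (a : Fin k → F),
      termValue f a t = P.eval₂ f a := by
  induction t with
  | var x =>
    rcases x with x | i
    · exact x.elim
    · exact ⟨.X i, fun F _ f a => by rw [MvPolynomial.eval₂_X]; rfl⟩
  | @func l g ts ih =>
    choose P hP using ih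
    rcases g with g | g
    · cases g with
      | add =>
        refine ⟨P 0 + P 1, fun F _ f a => ?_⟩
        rw [MvPolynomial.eval₂_add, ← hP, ← hP]; rfl
      | mul =>
        refine ⟨P 0 * P 1, fun F _ f a => ?_⟩
        rw [MvPolynomial.eval₂_mul, ← hP, ← hP]; rfl
      | neg =>
        refine ⟨-P 0, fun F _ f a => ?_⟩
        rw [MvPolynomial.eval₂_neg, ← hP]; rfl
      | zero =>
        refine ⟨0, fun F _ f a => ?_⟩
        rw [MvPolynomial.eval₂_zero]; rfl
      | one =>
        refine ⟨1, fun F _ f a => ?_⟩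
        rw [MvPolynomial.eval₂_one]; rfl
    · cases l with
      | zero =>
        refine ⟨.C g, fun F _ f a => ?_⟩
        exact (MvPolynomial.eval₂_C f a g).symm
      | succ l => exact isEmptyElim g

lemma exists_term_of_polynomial {k : ℕ} (P : MvPolynomial (Fin k) α) :
    ∃ t : (Language.ring[[α]]).Term (Empty ⊕ Fin k),
      ∀ (F : Type u) [Field F] (f : α →+* F) (a : Fin k → F),
      termValue f a t = P.eval₂ f a := by
  induction P using MvPolynomial.induction_on with
  | C c =>
    refine ⟨.func (l := 0) (Sum.inr c) Fin.elim0, fun F _ f a => ?_⟩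
    rw [MvPolynomial.eval₂_C]; rfl
  | add p q hp hq =>
    obtain ⟨s, hs⟩ := hp
    obtain ⟨t, ht⟩ := hq
    refine ⟨.func (l := 2) (Sum.inl .add) ![s, t], fun F _ f a => ?_⟩
    rw [MvPolynomial.eval₂_add, ← hs, ← ht]; rfl
  | mul_X p i hp =>
    obtain ⟨s, hs⟩ := hp
    refine ⟨.func (l := 2) (Sum.inl .mul) ![s, .var (Sum.inr i)], fun F _ f a => ?_⟩
    rw [MvPolynomial.eval₂_mul, MvPolynomial.eval₂_X, ← hs]; rfl

lemma exists_pattern_of_isQF {k : ℕ} {φ : (Language.ring[[α]]).BoundedFormula Empty k}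
    (hφ : φ.IsQF) :
    ∃ P : Finset (MvPolynomial (Fin k) α), ∀ (F L : Type u) [Field F] [Field L] (f : α →+* F)
      (g : α →+* L) (a : Fin k → F) (b : Fin k → L),
      (∀ p ∈ P, p.eval₂ f a = 0 ↔ p.eval₂ g b = 0) → (RealizeAt f a φ ↔ RealizeAt g b φ) := by
  classical
  induction hφ with
  | falsum => exact ⟨∅, fun F L _ _ f g a b _ => Iff.rfl⟩
  | of_isAtomic h =>
    cases h with
    | equal s t =>
      obtain ⟨p, hp⟩ := exists_polynomial_of_term s
      obtain ⟨q, hq⟩ := exists_polynomial_of_term t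
      refine ⟨{p - q}, fun F L _ _ f g a b h => ?_⟩
      have key : ∀ (F : Type u) [Field F] (f : α →+* F) (a : Fin k → F),
          RealizeAt f a (s.bdEqual t) ↔ (p - q).eval₂ f a = 0 := by
        intro F _ f a
        rw [MvPolynomial.eval₂_sub, sub_eq_zero, ← hp, ← hq]
        rfl
      rw [key, key]
      exact h _ (Finset.mem_singleton_self _)
    | rel R ts => exact R.elim (fun r => isEmptyElim r) (fun r => isEmptyElim r)
  | imp h1 h2 ih1 ih2 =>
    obtain ⟨P, hP⟩ := ih1
    obtain ⟨Q, hQ⟩ := ih2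
    refine ⟨P ∪ Q, fun F L _ _ f g a b h => ?_⟩
    exact imp_congr (hP F L f g a b fun p hp => h p (Finset.mem_union_left _ hp))
      (hQ F L f g a b fun p hp => h p (Finset.mem_union_right _ hp))

lemma exists_pattern_of_isExistsN {n k : ℕ} {φ : (Language.ring[[α]]).BoundedFormula Empty k}
    (hφ : IsExistsN n φ) :
    ∃ P : Finset (MvPolynomial (Fin k ⊕ Fin n) α), ∀ (F : Type u) [Field F] (f : α →+* F)
      (a : Fin k → F), RealizeAt f a φ → ∃ b : Fin n → F,
      ∀ (L : Type u) [Field L] (g : α →+* L) (a' : Fin k → L) (b' : Fin n → L),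
        (∀ p ∈ P, p.eval₂ f (Sum.elim a b) = 0 ↔ p.eval₂ g (Sum.elim a' b') = 0) →
        RealizeAt g a' φ := by
  classical
  induction hφ with
  | qf h =>
    obtain ⟨P, hP⟩ := exists_pattern_of_isQF h
    refine ⟨P.image (MvPolynomial.rename Sum.inl), fun F _ f a ha => ⟨0, fun L _ g a' b' h => ?_⟩⟩
    refine (hP F L f g a a' fun p hp => ?_).1 ha
    have := h _ (Finset.mem_image_of_mem _ hp)
    simpa only [MvPolynomial.eval₂_rename, Sum.elim_comp_inl] using this
  | @ex n k φ h ih =>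
    obtain ⟨P, hP⟩ := ih
    let e : Fin (k + 1) ⊕ Fin n → Fin k ⊕ Fin (n + 1) :=
      Sum.elim (Fin.lastCases (Sum.inr 0) Sum.inl) (fun j => Sum.inr j.succ)
    have he : ∀ (F : Type u) (a : Fin k → F) (b : Fin (n + 1) → F),
        Sum.elim a b ∘ e = Sum.elim (Fin.snoc a (b 0) : Fin (k + 1) → F) (Fin.tail b) := by
      intro F a b
      ext (i | j)
      · induction i using Fin.lastCases with
        | last => simp [e]
        | cast i => simp [e]
      · simp [e, Fin.tail]
    refine ⟨P.image (MvPolynomial.rename e), fun F _ f a ha => ?_⟩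
    obtain ⟨x, hx⟩ : ∃ x, RealizeAt f (Fin.snoc a x : Fin (k + 1) → F) φ := by
      let _ := ringConStructure f
      exact BoundedFormula.realize_ex.1 ha
    obtain ⟨b, hb⟩ := hP F f _ hx
    refine ⟨Fin.cons x b, fun L _ g a' b' h => ?_⟩
    have h1 : RealizeAt g (Fin.snoc a' (b' 0) : Fin (k + 1) → L) φ := by
      refine hb L g _ (Fin.tail b') fun p hp => ?_
      have := h _ (Finset.mem_image_of_mem _ hp)
      simpa only [MvPolynomial.eval₂_rename, he, Fin.cons_zero, Fin.tail_cons] using this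
    let _ := ringConStructure g
    exact BoundedFormula.realize_ex.2 ⟨_, h1⟩

lemma realizeRing_of_sol {n : ℕ} {φ : (Language.ring[[α]]).Sentence} (hφ : IsExistsN n φ)
    {F L : Type u} [Field F] [Field L] (f : α →+* F) (g : α →+* L)
    (h : ∀ (Z : Finset (MvPolynomial (Fin n) α)) (q : MvPolynomial (Fin n) α),
      Sol f Z q → Sol g Z q) (hF : RealizeRing F f φ) : RealizeRing L g φ := by
  classical
  obtain ⟨P, hP⟩ := exists_pattern_of_isExistsN hφ
  obtain ⟨b, hb⟩ := hP F f default hF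
  let e : Fin 0 ⊕ Fin n → Fin n := Sum.elim Fin.elim0 id
  have he : ∀ (F : Type u) (b : Fin n → F), Sum.elim (default : Fin 0 → F) b = b ∘ e := by
    intro F b
    ext (i | j)
    · exact i.elim0
    · rfl
  simp only [he, ← MvPolynomial.eval₂_rename] at hb
  let Q := P.image (MvPolynomial.rename e)
  obtain ⟨b', hZ, hq⟩ := h (Q.filter fun p => p.eval₂ f b = 0)
    (∏ p ∈ Q.filter (fun p => ¬ p.eval₂ f b = 0), p) ⟨b, by simp, by
      rw [MvPolynomial.eval₂_prod, Finset.prod_ne_zero_iff]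
      intro p hp
      exact (Finset.mem_filter.1 hp).2⟩
  refine hb L g default b' fun p hp => ?_
  rw [he, ← MvPolynomial.eval₂_rename]
  have hpQ : MvPolynomial.rename e p ∈ Q := Finset.mem_image_of_mem _ hp
  constructor
  · intro h0
    exact hZ _ (Finset.mem_filter.2 ⟨hpQ, h0⟩)
  · intro h0
    by_contra h1
    rw [MvPolynomial.eval₂_prod, Finset.prod_ne_zero_iff] at hq
    exact hq _ (Finset.mem_filter.2 ⟨hpQ, h1⟩) h0

omit [Field α] in
lemma isExistsN_exs {n m : ℕ} : ∀ {k : ℕ} {φ : (Language.ring[[α]]).BoundedFormula Empty k},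
    IsExistsN m φ → m + k = n → IsExistsN n φ.exs
  | 0, φ, h, hn => by subst hn; exact h
  | k + 1, φ, h, hn => isExistsN_exs (k := k) (IsExistsN.ex h) (by omega)

lemma exists_sentence_of_sol {n : ℕ} (Z : Finset (MvPolynomial (Fin n) α))
    (q : MvPolynomial (Fin n) α) :
    ∃ φ : (Language.ring[[α]]).Sentence, IsExistsN n φ ∧
      ∀ (F : Type u) [Field F] (f : α →+* F), RealizeRing F f φ ↔ Sol f Z q := by
  classical
  have hZ : ∃ ψ : (Language.ring[[α]]).BoundedFormula Empty n, ψ.IsQF ∧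
      ∀ (F : Type u) [Field F] (f : α →+* F) (a : Fin n → F),
        RealizeAt f a ψ ↔ ((∀ z ∈ Z, z.eval₂ f a = 0) ∧ q.eval₂ f a ≠ 0) := by
    obtain ⟨t0, ht0⟩ := exists_term_of_polynomial (0 : MvPolynomial (Fin n) α)
    have key : ∀ p : MvPolynomial (Fin n) α, ∃ ψ : (Language.ring[[α]]).BoundedFormula Empty n,
        ψ.IsQF ∧ ∀ (F : Type u) [Field F] (f : α →+* F) (a : Fin n → F),
          RealizeAt f a ψ ↔ p.eval₂ f a = 0 := by
      intro p
      obtain ⟨t, ht⟩ := exists_term_of_polynomial p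
      refine ⟨t.bdEqual t0, (BoundedFormula.IsAtomic.equal _ _).isQF, fun F _ f a => ?_⟩
      rw [← ht, ← MvPolynomial.eval₂_zero f a, ← ht0]
      rfl
    induction Z using Finset.induction_on with
    | empty =>
      obtain ⟨ψ, h1, h2⟩ := key q
      refine ⟨ψ.not, h1.not, fun F _ f a => ?_⟩
      have : RealizeAt f a ψ.not ↔ ¬ RealizeAt f a ψ := by
        let _ := ringConStructure f
        exact BoundedFormula.realize_not
      rw [this, h2]
      simp
    | insert z Z hz ih =>
      obtain ⟨ψ, h1, h2⟩ := ih
      obtain ⟨ψ', h1', h2'⟩ := key z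
      refine ⟨ψ' ⊓ ψ, h1'.inf h1, fun F _ f a => ?_⟩
      have : RealizeAt f a (ψ' ⊓ ψ) ↔ RealizeAt f a ψ' ∧ RealizeAt f a ψ := by
        let _ := ringConStructure f
        exact BoundedFormula.realize_inf
      rw [this, h2, h2', Finset.forall_mem_insert, and_assoc]
  obtain ⟨ψ, h1, h2⟩ := hZ
  refine ⟨ψ.exs, isExistsN_exs (IsExistsN.qf (n := 0) h1) (zero_add n), fun F _ f => ?_⟩
  have : RealizeRing F f ψ.exs ↔ ∃ a : Fin n → F, RealizeAt f a ψ := by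
    let _ := ringConStructure f
    exact BoundedFormula.realize_exs
  rw [this]
  exact exists_congr fun a => h2 F f a

lemma sol_iff_of_thRingSub {n : ℕ} {F L : Type u} [Field F] [Field L] (f : α →+* F) (g : α →+* L)
    (h : ThRingSub (fun {k} φ => IsExistsN n (k := k) φ) F f L g)
    {Z : Finset (MvPolynomial (Fin n) α)} {q : MvPolynomial (Fin n) α} (hF : Sol f Z q) :
    Sol g Z q := by
  obtain ⟨φ, h1, h2⟩ := exists_sentence_of_sol Z q
  exact (h2 L g).1 (h φ (.base h1) ((h2 F f).2 hF))

lemma thRingSub_of_sol {n : ℕ} {F L : Type u} [Field F] [Field L] (f : α →+* F) (g : α →+* L)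
    (h : ∀ (Z : Finset (MvPolynomial (Fin n) α)) (q : MvPolynomial (Fin n) α),
      Sol f Z q → Sol g Z q) :
    ThRingSub (fun {k} φ => IsExistsN n (k := k) φ) F f L g := by
  intro φ hφ
  have key : ∀ (k : ℕ) (hk : k = 0) (φ : (Language.ring[[α]]).BoundedFormula Empty k),
      IsPosBC (fun {k} φ => IsExistsN n (k := k) φ) φ →
      ∀ (a : Fin k → F) (b : Fin k → L), RealizeAt f a φ → RealizeAt g b φ := by
    intro k hk φ hφ
    induction hφ with
    | base h1 =>
      subst hk
      intro a b ha
      rw [Subsingleton.elim a default] at ha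
      rw [Subsingleton.elim b default]
      exact realizeRing_of_sol h1 f g h ha
    | @inf φ ψ h1 h2 ih1 ih2 =>
      intro a b ha
      have ha' : RealizeAt f a φ ∧ RealizeAt f a ψ := by
        let _ := ringConStructure f
        exact BoundedFormula.realize_inf.1 ha
      let _ := ringConStructure g
      exact BoundedFormula.realize_inf.2 ⟨ih1 a b ha'.1, ih2 a b ha'.2⟩
    | @sup φ ψ h1 h2 ih1 ih2 =>
      intro a b ha
      have ha' : RealizeAt f a φ ∨ RealizeAt f a ψ := by
        let _ := ringConStructure f
        exact BoundedFormula.realize_sup.1 ha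
      let _ := ringConStructure g
      exact BoundedFormula.realize_sup.2 (ha'.imp (ih1 a b) (ih2 a b))
  exact key 0 rfl φ hφ default default

lemma R4N.r4Sol {n : ℕ} (h : R4N.{u} n) : R4Sol.{u} n := by
  intro E _ Γ _ w F hF h1 h2 Z q hs
  obtain ⟨φ, h3, h4⟩ := exists_sentence_of_sol Z q
  exact (h4 F (RingHom.id F)).1 (h E Γ w F hF h1 h2 φ h3 ((h4 E F.subtype).2 hs))

lemma largeField_of_sol {F : Type u} [Field F]
    (h : ∀ (n : ℕ) (Z : Finset (MvPolynomial (Fin n) F)) (q : MvPolynomial (Fin n) F),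
      Sol (algebraMap F (LaurentSeries F)) Z q → Sol (RingHom.id F) Z q) : LargeField F := by
  rintro φ ⟨n, hφ⟩ hr
  exact realizeRing_of_sol hφ (algebraMap F (LaurentSeries F)) (RingHom.id F) (h n) hr

end Fragments

end Paper

namespace Paper

section LargeCurve

open Polynomial

variable {F : Type u} [Field F]

lemma sum_coeff_eq_eval₂ (φ : F[X][X]) (t y : F) {N : ℕ} (hN : φ.natDegree < N)
    (hN' : ∀ j, (φ.coeff j).natDegree < N) :
    ∑ i ∈ Finset.range N, ∑ j ∈ Finset.range N, (φ.coeff j).coeff i * t ^ i * y ^ j =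
      φ.eval₂ (evalRingHom t) y := by
  rw [eval₂_eq_sum_range' _ hN, Finset.sum_comm]
  refine Finset.sum_congr rfl fun j _ => ?_
  rw [coe_evalRingHom, eval_eq_sum_range' (hN' j), Finset.sum_mul]

lemma exists_natDegree_coeff_lt (φ : F[X][X]) : ∃ N, ∀ j, (φ.coeff j).natDegree < N := by
  refine ⟨(φ.support.sup fun j => (φ.coeff j).natDegree) + 1, fun j => Nat.lt_succ_of_le ?_⟩
  by_cases hj : j ∈ φ.support
  · exact Finset.le_sup (f := fun j => (φ.coeff j).natDegree) hj
  · rw [notMem_support_iff.1 hj, natDegree_zero]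
    exact Nat.zero_le _

lemma LargeCurve.exists_eval₂ (hF : LargeCurve F) {φ γ : F[X][X]}
    (h0 : (φ.coeff 0).coeff 0 = 0) (h1 : (φ.coeff 1).coeff 0 ≠ 0) (hγ : (γ.coeff 0).coeff 0 ≠ 0) :
    ∃ t y : F, t ≠ 0 ∧ φ.eval₂ (evalRingHom t) y = 0 ∧ γ.eval₂ (evalRingHom t) y ≠ 0 := by
  obtain ⟨N1, hN1⟩ := exists_natDegree_coeff_lt φ
  obtain ⟨N2, hN2⟩ := exists_natDegree_coeff_lt γ
  let N := N1 + N2 + φ.natDegree + γ.natDegree + 2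
  obtain ⟨t, y, ht, h2, h3⟩ := hF N (fun i j => (φ.coeff j).coeff i) (fun i j => (γ.coeff j).coeff i)
    (by omega) h0 h1 hγ
  refine ⟨t, y, ht, ?_, ?_⟩
  · rwa [sum_coeff_eq_eval₂ φ t y (by omega) fun j => (hN1 j).trans (by omega)] at h2
  · rwa [sum_coeff_eq_eval₂ γ t y (by omega) fun j => (hN2 j).trans (by omega)] at h3

lemma exists_eval_add_eq (g : F[X][X]) (y : F[X]) (M : ℕ) : ∃ k : F[X][X],
    (g.map C).eval (C y + C (X ^ M) * X) =
      C (g.eval y) + C (g.derivative.eval y * X ^ M) * X + k * C (X ^ (2 * M)) * X ^ 2 := by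
  obtain ⟨k, hk⟩ := (g.map C).binomExpansion (C y) (C (X ^ M) * X)
  refine ⟨k, hk.trans ?_⟩
  rw [derivative_map, eval_map, eval_map, eval₂_at_apply, eval₂_at_apply, map_mul, mul_pow,
    two_mul, pow_add, map_mul]
  ring

lemma eval₂_eval_add (g : F[X][X]) (y : F[X]) (M : ℕ) (t z : F) :
    ((g.map C).eval (C y + C (X ^ M) * X)).eval₂ (evalRingHom t) z =
      g.eval₂ (evalRingHom t) (y.eval t + t ^ M * z) := by
  rw [← coe_eval₂RingHom, eval_map, hom_eval₂]
  congr 1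
  · ext <;> simp
  · simp [eval₂_pow]

lemma LargeCurve.exists_root (hF : LargeCurve F) {g G : F[X][X]} {y r a b : F[X]} {m l M : ℕ}
    (hl : l < M) (hm : m ≤ M) (hr : g.eval y = X ^ (M + m + 1) * r)
    (ha : g.derivative.eval y = X ^ m * a) (ha0 : a.coeff 0 ≠ 0)
    (hb : G.eval y = X ^ l * b) (hb0 : b.coeff 0 ≠ 0) :
    ∃ t z : F, t ≠ 0 ∧ g.eval₂ (evalRingHom t) z = 0 ∧ G.eval₂ (evalRingHom t) z ≠ 0 := by
  obtain ⟨k, hk⟩ := exists_eval_add_eq g y M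
  obtain ⟨k', hk'⟩ := exists_eval_add_eq G y M
  obtain ⟨e, hM⟩ := Nat.exists_eq_add_of_le hm
  obtain ⟨j, hj⟩ := Nat.exists_eq_add_of_lt hl
  have h1 : (g.map C).eval (C y + C (X ^ M) * X) =
      C (X ^ (M + m)) * (C (X * r) + C a * X + k * C (X ^ e) * X ^ 2) := by
    rw [hk, hr, ha, hM]
    simp only [map_mul, map_pow]
    ring
  have h2 : (G.map C).eval (C y + C (X ^ M) * X) =
      C (X ^ l) * (C b + (C (G.derivative.eval y * X ^ (j + 1)) +
        k' * C (X ^ (l + 2 * j + 2)) * X) * X) := by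
    rw [hk', hb]
    rw [hj]
    simp only [map_mul, map_pow]
    ring
  obtain ⟨t, z, ht, h3, h4⟩ := hF.exists_eval₂ (φ := C (X * r) + C a * X + k * C (X ^ e) * X ^ 2)
    (γ := C b + (C (G.derivative.eval y * X ^ (j + 1)) + k' * C (X ^ (l + 2 * j + 2)) * X) * X)
    (by simp) (by simp [coeff_mul_X_pow', coeff_C, ha0]) (by simpa using hb0)
  refine ⟨t, y.eval t + t ^ M * z, ht, ?_, ?_⟩
  · rw [← eval₂_eval_add, h1, eval₂_mul, h3, mul_zero]
  · rw [← eval₂_eval_add, h2, eval₂_mul]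
    refine mul_ne_zero ?_ h4
    rw [eval₂_C, coe_evalRingHom, eval_pow, eval_X]
    exact pow_ne_zero l ht

end LargeCurve

section Hypersurface

open Polynomial

lemma eval₂_option_eq {R S σ : Type*} [CommRing R] [CommRing S] (φ : R →+* S) (x : Option σ → S)
    (g : MvPolynomial (Option σ) R) : g.eval₂ φ x =
      (MvPolynomial.optionEquivLeft R σ g).eval₂ (MvPolynomial.eval₂Hom φ fun i => x (some i))
        (x none) := by
  induction g using MvPolynomial.induction_on with
  | C c => simp [MvPolynomial.optionEquivLeft_C]
  | add p q hp hq => rw [MvPolynomial.eval₂_add, hp, hq, map_add, eval₂_add]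
  | mul_X p i hp =>
    rw [MvPolynomial.eval₂_mul, hp, map_mul, eval₂_mul, MvPolynomial.eval₂_X]
    cases i <;> simp

/-- Evaluation of all variables but the last one. -/
noncomputable def spec {R S σ : Type*} [CommRing R] [CommRing S] (φ : R →+* S) (x : σ → S) (c : S)
    (g : MvPolynomial (Option σ) R) : S[X] :=
  g.eval₂ (C.comp φ) fun i => i.elim (C c * X) fun j => C (x j)

lemma eval_spec {R S σ : Type*} [CommRing R] [CommRing S] (φ : R →+* S) (x : σ → S) (c y : S)
    (g : MvPolynomial (Option σ) R) :
    (spec φ x c g).eval y = g.eval₂ φ fun i => i.elim (c * y) x := by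
  rw [spec, ← coe_evalRingHom, MvPolynomial.hom_eval₂]
  congr 1
  · ext; simp
  · ext i; cases i <;> simp

lemma derivative_spec {R S σ : Type*} [CommRing R] [CommRing S] (φ : R →+* S) (x : σ → S) (c : S)
    (g : MvPolynomial (Option σ) R) :
    derivative (spec φ x c g) = C c * spec φ x c (MvPolynomial.pderiv none g) := by
  classical
  induction g using MvPolynomial.induction_on with
  | C a => simp [spec]
  | add p q hp hq =>
    have h : ∀ p q, spec φ x c (p + q) = spec φ x c p + spec φ x c q :=
      fun p q => MvPolynomial.eval₂_add _ _
    rw [h, map_add, hp, hq, map_add, h, mul_add]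
  | mul_X p i hp =>
    have h : ∀ p q, spec φ x c (p + q) = spec φ x c p + spec φ x c q :=
      fun p q => MvPolynomial.eval₂_add _ _
    have h' : ∀ p q, spec φ x c (p * q) = spec φ x c p * spec φ x c q :=
      fun p q => MvPolynomial.eval₂_mul _ _
    rw [h', derivative_mul, hp, Derivation.leibniz, h, smul_eq_mul, smul_eq_mul, h', h']
    cases i with
    | none =>
      simp only [MvPolynomial.pderiv_X_self]
      simp [spec]
      ring
    | some j =>
      rw [MvPolynomial.pderiv_X_of_ne (by simp)]
      simp [spec]
      ring

variable {F E : Type u} [Field F] [Field E] {p : ℕ}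

lemma PInd.exists_generic_hypersurface [Algebra F E] [ExpChar F p]
    (hp : PInd p (algebraMap F E)) {n : ℕ} {Z : Finset (MvPolynomial (Fin n) F)}
    {q : MvPolynomial (Fin n) F} {a : Fin n → E} (hZ : ∀ z ∈ Z, z.eval₂ (algebraMap F E) a = 0)
    (hq : q.eval₂ (algebraMap F E) a ≠ 0) :
    ∃ (d : ℕ) (x : Option (Fin d) → E) (f h : MvPolynomial (Option (Fin d)) F),
      AlgebraicIndependent F (fun j => x (some j)) ∧
      (∀ j, x j ∈ IntermediateField.adjoin F (Set.range a)) ∧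
      f.eval₂ (algebraMap F E) x = 0 ∧
      (MvPolynomial.pderiv none f).eval₂ (algebraMap F E) x ≠ 0 ∧
      h.eval₂ (algebraMap F E) x ≠ 0 ∧
      ∀ (L : Type u) [Field L] (φ : F →+* L) (x' : Option (Fin d) → L),
        f.eval₂ φ x' = 0 → h.eval₂ φ x' ≠ 0 → Sol φ Z q := by
  classical
  let b : Option (Fin n) → E := fun i => i.elim (q.eval₂ (algebraMap F E) a)⁻¹ a
  obtain ⟨d, T, y, hT, hy, hb, hTa, hya⟩ := hp.exists_sep_generators b
  have hba : IntermediateField.adjoin F (Set.range b) ≤ IntermediateField.adjoin F (Set.range a) := by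
    rw [IntermediateField.adjoin_le_iff]
    rintro _ ⟨_ | i, rfl⟩
    · refine inv_mem ?_
      have : q.eval₂ (algebraMap F E) a = algebraMap (IntermediateField.adjoin F (Set.range a)) E
          (MvPolynomial.aeval (fun i => (⟨a i, IntermediateField.subset_adjoin _ _ ⟨i, rfl⟩⟩ :
            IntermediateField.adjoin F (Set.range a))) q) := by
        rw [← MvPolynomial.aeval_algebraMap_apply]
        rfl
      rw [this]
      exact Subtype.property _
    · exact IntermediateField.subset_adjoin _ _ ⟨i, rfl⟩
  let Z' : Finset (MvPolynomial (Option (Fin n)) F) :=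
    insert (MvPolynomial.rename some q * MvPolynomial.X none - 1)
      (Z.image (MvPolynomial.rename some))
  have hbs : b ∘ some = a := rfl
  obtain ⟨f, h, r, h1, h2, h3, -, h5⟩ := exists_hypersurface hT hy hb Z' (by
    intro z hz
    rw [MvPolynomial.aeval_def]
    rcases Finset.mem_insert.1 hz with rfl | hz
    · rw [MvPolynomial.eval₂_sub, MvPolynomial.eval₂_mul, MvPolynomial.eval₂_rename, hbs,
        MvPolynomial.eval₂_X, MvPolynomial.eval₂_one]
      exact sub_eq_zero.2 (mul_inv_cancel₀ hq)
    · obtain ⟨z', hz', rfl⟩ := Finset.mem_image.1 hz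
      rw [MvPolynomial.eval₂_rename]
      exact hZ z' hz')
  let e := MvPolynomial.optionEquivLeft F (Fin d)
  refine ⟨d, fun i => i.elim y T, e.symm f, MvPolynomial.rename some h, hT, ?_, ?_, ?_, ?_, ?_⟩
  · rintro (_ | j)
    · exact hba hya
    · exact hba (hTa j)
  · rw [eval₂_option_eq]
    simpa [e] using h1
  · have key := derivative_spec (algebraMap F E) T 1 (e.symm f)
    have key2 : spec (algebraMap F E) T 1 (e.symm f) =
        f.map (MvPolynomial.eval₂Hom (algebraMap F E) T) := by
      rw [spec, eval₂_option_eq, AlgEquiv.apply_symm_apply]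
      rw [Polynomial.map]
      congr 1
      · ext <;> simp
      · simp
    rw [key2, derivative_map] at key
    have := congrArg (eval y) key
    rw [eval_map, map_one, one_mul, eval_spec, one_mul] at this
    rw [← this]
    exact h2
  · rw [MvPolynomial.eval₂_rename]
    exact h3
  · intro L _ φ x' hf hh
    rw [eval₂_option_eq] at hf
    rw [MvPolynomial.eval₂_rename] at hh
    have h6 := h5 L φ (fun j => x' (some j)) (x' none) (by simpa [e] using hf) hh
    let a' : Option (Fin n) → L := fun i =>
      eval₂ (MvPolynomial.eval₂Hom φ fun j => x' (some j)) (x' none) (r i) /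
        MvPolynomial.eval₂Hom φ (fun j => x' (some j)) h
    refine ⟨fun i => a' (some i), fun z hz => ?_, ?_⟩
    · have := h6 _ (Finset.mem_insert_of_mem (Finset.mem_image_of_mem _ hz))
      rwa [MvPolynomial.eval₂_rename] at this
    · have := h6 _ (Finset.mem_insert_self _ _)
      rw [MvPolynomial.eval₂_sub, MvPolynomial.eval₂_mul, MvPolynomial.eval₂_rename,
        MvPolynomial.eval₂_X, MvPolynomial.eval₂_one, sub_eq_zero] at this
      exact left_ne_zero_of_mul_eq_one this

end Hypersurface

end Paper

namespace Paper

section Scale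

open Polynomial

lemma exists_scale {F σ : Type*} [CommRing F] (N : ℕ) (g : MvPolynomial σ F) :
    ∃ M0, ∀ M, M0 ≤ M → ∃ G : MvPolynomial σ F[X], ∀ {B : Type u} [CommRing B] (φ : F →+* B) (t s : B),
      t * s = 1 → ∀ x : σ → B, t ^ M * g.eval₂ φ (fun i => s ^ N * x i) =
        G.eval₂ (eval₂RingHom φ t) x := by
  induction g using MvPolynomial.induction_on with
  | C c =>
    refine ⟨0, fun M _ => ⟨.C (X ^ M * C c), fun φ t s hts x => ?_⟩⟩
    rw [MvPolynomial.eval₂_C, MvPolynomial.eval₂_C, coe_eval₂RingHom, eval₂_mul, eval₂_pow, eval₂_X,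
      eval₂_C]
  | add p q hp hq =>
    obtain ⟨M1, h1⟩ := hp
    obtain ⟨M2, h2⟩ := hq
    refine ⟨max M1 M2, fun M hM => ?_⟩
    obtain ⟨G1, hG1⟩ := h1 M ((le_max_left _ _).trans hM)
    obtain ⟨G2, hG2⟩ := h2 M ((le_max_right _ _).trans hM)
    refine ⟨G1 + G2, fun φ t s hts x => ?_⟩
    rw [MvPolynomial.eval₂_add, mul_add, hG1 φ t s hts, hG2 φ t s hts, MvPolynomial.eval₂_add]
  | mul_X p i hp =>
    obtain ⟨M1, h1⟩ := hp
    refine ⟨M1 + N, fun M hM => ?_⟩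
    obtain ⟨G1, hG1⟩ := h1 (M - N) (by omega)
    refine ⟨G1 * .X i, fun φ t s hts x => ?_⟩
    rw [MvPolynomial.eval₂_mul, MvPolynomial.eval₂_mul, ← hG1 φ t s hts, MvPolynomial.eval₂_X,
      MvPolynomial.eval₂_X]
    obtain ⟨k, rfl⟩ := Nat.exists_eq_add_of_le (show N ≤ M by omega)
    have : t ^ N * s ^ N = 1 := by rw [← mul_pow, hts, one_pow]
    rw [Nat.add_sub_cancel_left, pow_add]
    linear_combination (t ^ k * MvPolynomial.eval₂ φ (fun i => s ^ N * x i) p * x i) * this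

lemma dvd_eval₂_sub_eval₂ {R S σ : Type*} [CommRing R] [CommRing S] (φ : R →+* S) {x y : σ → S}
    {c : S} (h : ∀ j, c ∣ x j - y j) (g : MvPolynomial σ R) :
    c ∣ g.eval₂ φ x - g.eval₂ φ y := by
  induction g using MvPolynomial.induction_on with
  | C a => simp
  | add p q hp hq =>
    rw [MvPolynomial.eval₂_add, MvPolynomial.eval₂_add, add_sub_add_comm]
    exact dvd_add hp hq
  | mul_X p i hp =>
    rw [MvPolynomial.eval₂_mul, MvPolynomial.eval₂_mul, MvPolynomial.eval₂_X, MvPolynomial.eval₂_X]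
    have : p.eval₂ φ x * x i - p.eval₂ φ y * y i =
        (p.eval₂ φ x - p.eval₂ φ y) * x i + p.eval₂ φ y * (x i - y i) := by ring
    rw [this]
    exact dvd_add (hp.mul_right _) ((h i).mul_left _)

end Scale

section Laurent

variable {F : Type u} [Field F] (p : ℕ)

lemma coeff_eq_zero_of_sum_pow {m : ℕ} {c : Fin m → F}
    (hc : ∀ x : Fin m → F, ∑ i, c i * x i ^ p = 0 → ∀ i, x i = 0) (k : ℕ) :
    ∀ x : Fin m → PowerSeries F, ∑ i, PowerSeries.C (c i) * x i ^ p = 0 →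
      ∀ i, PowerSeries.coeff k (x i) = 0 := by
  have h0 : ∀ x : Fin m → PowerSeries F, ∑ i, PowerSeries.C (c i) * x i ^ p = 0 →
      ∀ i, PowerSeries.constantCoeff (x i) = 0 := by
    intro x hx
    refine hc _ ?_
    have := congrArg PowerSeries.constantCoeff hx
    simpa using this
  induction k with
  | zero =>
    intro x hx i
    rw [PowerSeries.coeff_zero_eq_constantCoeff]
    exact h0 x hx i
  | succ k ih =>
    intro x hx i
    choose y hy using fun i => PowerSeries.X_dvd_iff.2 (h0 x hx i)
    rw [hy, PowerSeries.coeff_succ_X_mul]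
    refine ih y ?_ i
    have : PowerSeries.X ^ p * ∑ i, PowerSeries.C (c i) * y i ^ p = 0 := by
      rw [← hx, Finset.mul_sum]
      refine Finset.sum_congr rfl fun i _ => ?_
      rw [hy i]
      ring
    exact (mul_eq_zero.1 this).resolve_left (pow_ne_zero _ PowerSeries.X_ne_zero)

lemma exists_powerSeries {ι : Type*} [Finite ι] (x : ι → LaurentSeries F) :
    ∃ (N : ℕ) (y : ι → PowerSeries F), ∀ i,
      x i = HahnSeries.single (-1 : ℤ) (1 : F) ^ N * HahnSeries.ofPowerSeries ℤ F (y i) := by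
  have := Fintype.ofFinite ι
  have key : ∀ x : LaurentSeries F, ∃ M : ℕ, ∀ N, M ≤ N → ∃ y : PowerSeries F,
      x = HahnSeries.single (-1 : ℤ) (1 : F) ^ N * HahnSeries.ofPowerSeries ℤ F y := by
    intro x
    refine ⟨(-x.order).toNat, fun N hN => ⟨PowerSeries.X ^ (x.order + N).toNat *
      x.powerSeriesPart, ?_⟩⟩
    have h1 := LaurentSeries.single_order_mul_powerSeriesPart x
    conv_lhs => rw [← h1]
    rw [map_mul, ← mul_assoc, HahnSeries.ofPowerSeries_X_pow, HahnSeries.single_pow,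
      HahnSeries.single_mul_single, one_pow, one_mul]
    congr 2
    have : (0 : ℤ) ≤ x.order + N := by omega
    rw [Int.toNat_of_nonneg this]
    simp
  choose M hM using fun i => key (x i)
  refine ⟨Finset.univ.sup M, ?_⟩
  choose y hy using fun i => hM i _ (Finset.le_sup (Finset.mem_univ i))
  exact ⟨y, hy⟩

lemma algebraMap_laurentSeries (c : F) : algebraMap F (LaurentSeries F) c =
    HahnSeries.ofPowerSeries ℤ F (PowerSeries.C c) := by
  rw [HahnSeries.ofPowerSeries_C, LaurentSeries.algebraMap_apply]

lemma PInd.laurentSeries : PInd p (algebraMap F (LaurentSeries F)) := by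
  intro m c hc x hx i
  obtain ⟨N, y, hy⟩ := exists_powerSeries x
  have hs : HahnSeries.single (-1 : ℤ) (1 : F) ≠ 0 := by simp
  have h1 : ∑ i, PowerSeries.C (c i) * y i ^ p = 0 := by
    apply HahnSeries.ofPowerSeries_injective (Γ := ℤ)
    have : (HahnSeries.single (-1 : ℤ) (1 : F) ^ N) ^ p *
        HahnSeries.ofPowerSeries ℤ F (∑ i, PowerSeries.C (c i) * y i ^ p) = 0 := by
      rw [← hx, map_sum, Finset.mul_sum]
      refine Finset.sum_congr rfl fun i _ => ?_
      rw [map_mul, map_pow, hy i, algebraMap_laurentSeries]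
      ring
    rw [map_zero]
    exact (mul_eq_zero.1 this).resolve_left (pow_ne_zero _ (pow_ne_zero _ hs))
  have h2 : y i = 0 := by
    ext k
    rw [coeff_eq_zero_of_sum_pow p hc k y h1 i, map_zero]
  rw [hy, h2, map_zero, mul_zero]

end Laurent

section LargeOfCurve

open Polynomial

variable {F : Type u} [Field F]

lemma exists_order {s : PowerSeries F} (hs : s ≠ 0) :
    ∃ m, PowerSeries.coeff m s ≠ 0 ∧ ∀ k < m, PowerSeries.coeff k s = 0 := by
  classical
  have : ∃ m, PowerSeries.coeff m s ≠ 0 := by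
    by_contra! h
    exact hs (PowerSeries.ext fun k => by rw [h k, map_zero])
  exact ⟨Nat.find this, Nat.find_spec this, fun k hk => not_not.1 (Nat.find_min this hk)⟩

lemma exists_eq_X_pow_mul {s : PowerSeries F} {P : F[X]} {m N : ℕ} (hm : m < N)
    (h : PowerSeries.X ^ N ∣ s - (P : PowerSeries F)) (h1 : PowerSeries.coeff m s ≠ 0)
    (h2 : ∀ k < m, PowerSeries.coeff k s = 0) : ∃ a : F[X], P = X ^ m * a ∧ a.coeff 0 ≠ 0 := by
  rw [PowerSeries.X_pow_dvd_iff] at h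
  have h3 : ∀ k < N, PowerSeries.coeff k s = P.coeff k := by
    intro k hk
    have := h k hk
    rwa [map_sub, sub_eq_zero, Polynomial.coeff_coe] at this
  obtain ⟨a, rfl⟩ := X_pow_dvd_iff.2 (fun k hk => (h3 k (hk.trans hm)).symm.trans (h2 k hk))
  refine ⟨a, rfl, ?_⟩
  have h4 := h3 m hm
  rw [coeff_X_pow_mul', if_pos le_rfl, Nat.sub_self] at h4
  rwa [← h4]

theorem LargeCurve.largeField (hF : LargeCurve F) : LargeField F := by
  classical
  refine largeField_of_sol fun n Z q => ?_
  rintro ⟨a, hZ, hq⟩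
  obtain ⟨p, _⟩ := ExpChar.exists F
  obtain ⟨d, x, f, h, -, -, h1, h2, h3, h4⟩ :=
    (PInd.laurentSeries (F := F) p).exists_generic_hypersurface hZ hq
  obtain ⟨N, y, hy⟩ := exists_powerSeries x
  set s : LaurentSeries F := HahnSeries.single (-1 : ℤ) (1 : F) with hs
  let t : LaurentSeries F := HahnSeries.ofPowerSeries ℤ F PowerSeries.X
  have hts : t * s = 1 := by
    simp [t, s, HahnSeries.ofPowerSeries_X, HahnSeries.single_mul_single]
  have ht0 : t ≠ 0 := left_ne_zero_of_mul_eq_one hts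
  obtain ⟨M1, hM1⟩ := exists_scale.{u} N f
  obtain ⟨M2, hM2⟩ := exists_scale.{u} N h
  obtain ⟨f', hf'⟩ := hM1 M1 le_rfl
  obtain ⟨h', hh'⟩ := hM2 M2 le_rfl
  obtain rfl : x = fun i => s ^ N * HahnSeries.ofPowerSeries ℤ F (y i) := funext hy
  let ι : F[X] →+* PowerSeries F := Polynomial.coeToPowerSeries.ringHom
  have hι : eval₂RingHom (algebraMap F (LaurentSeries F)) t =
      (HahnSeries.ofPowerSeries ℤ F).comp ι := by
    ext c
    · simp [ι, algebraMap_laurentSeries]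
    · simp [ι, t]
  have hinj := HahnSeries.ofPowerSeries_injective (Γ := ℤ) (R := F)
  have hval : ∀ g : MvPolynomial (Option (Fin d)) F[X],
      g.eval₂ (eval₂RingHom (algebraMap F (LaurentSeries F)) t)
        (fun i => HahnSeries.ofPowerSeries ℤ F (y i)) =
      HahnSeries.ofPowerSeries ℤ F (g.eval₂ ι y) := by
    intro g
    rw [MvPolynomial.hom_eval₂, hι]
  have e1 : f'.eval₂ ι y = 0 := by
    apply hinj
    rw [← hval, ← hf' _ t s hts, h1, mul_zero, map_zero]
  have e3 : h'.eval₂ ι y ≠ 0 := by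
    intro h0
    have := hh' (algebraMap F (LaurentSeries F)) t s hts
      (fun i => HahnSeries.ofPowerSeries ℤ F (y i))
    rw [hval, h0, map_zero] at this
    exact (mul_ne_zero (pow_ne_zero _ ht0) h3) this
  have e2 : (MvPolynomial.pderiv none f').eval₂ ι y ≠ 0 := by
    intro h0
    let z : Option (Fin d) → LaurentSeries F := fun i => HahnSeries.ofPowerSeries ℤ F (y i)
    have k1 : spec (eval₂RingHom (algebraMap F (LaurentSeries F)) t) (fun j => z (some j)) 1 f' =
        C (t ^ M1) * spec (algebraMap F (LaurentSeries F)) (fun j => s ^ N * z (some j)) (s ^ N)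
          f := by
      have := hf' (C.comp (algebraMap F (LaurentSeries F))) (C t) (C s)
        (by rw [← map_mul, hts, map_one]) (fun i => i.elim X fun j => C (z (some j)))
      have k2 : eval₂RingHom (C.comp (algebraMap F (LaurentSeries F))) (C t) =
          C.comp (eval₂RingHom (algebraMap F (LaurentSeries F)) t) := by
        ext <;> simp
      have k6 : (fun i : Option (Fin d) => C s ^ N * i.elim X fun j => C (z (some j))) =
          fun i => i.elim (C (s ^ N) * X) fun j => C (s ^ N * z (some j)) := by
        ext1 i
        cases i <;> simp
      rw [k2, k6] at this
      rw [spec, spec, map_one, one_mul, map_pow]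
      exact this.symm
    have k3 := congrArg (fun g => (derivative g).eval (z none)) k1
    simp only [derivative_mul, derivative_C, zero_mul, zero_add, derivative_spec, map_one, one_mul,
      eval_mul, eval_C, eval_spec] at k3
    have k4 : (fun i : Option (Fin d) => i.elim (z none) fun j => z (some j)) = z := by
      ext i; cases i <;> rfl
    have k5 : (fun i : Option (Fin d) => i.elim (s ^ N * z none) fun j => s ^ N * z (some j)) =
        fun i => s ^ N * z i := by
      ext i; cases i <;> rfl
    rw [k4, k5, hval, h0, map_zero] at k3
    have hs0 : s ≠ 0 := right_ne_zero_of_mul_eq_one hts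
    exact mul_ne_zero (pow_ne_zero M1 ht0) (mul_ne_zero (pow_ne_zero N hs0) h2) k3.symm
  obtain ⟨m, hm1, hm2⟩ := exists_order e2
  obtain ⟨l, hl1, hl2⟩ := exists_order e3
  let M := m + l + 1
  let R := M + m + 1
  let τ : Option (Fin d) → F[X] := fun i => PowerSeries.trunc R (y i)
  have hτ : ∀ g : MvPolynomial (Option (Fin d)) F[X],
      PowerSeries.X ^ R ∣ g.eval₂ ι y - ((g.eval₂ (RingHom.id F[X]) τ : F[X]) : PowerSeries F) := by
    intro g
    have : ((g.eval₂ (RingHom.id F[X]) τ : F[X]) : PowerSeries F) =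
        g.eval₂ ι fun i => (τ i : PowerSeries F) := by
      change ι (g.eval₂ (RingHom.id F[X]) τ) = _
      rw [MvPolynomial.hom_eval₂]
      rfl
    rw [this]
    refine dvd_eval₂_sub_eval₂ ι (fun i => ?_) g
    rw [PowerSeries.X_pow_dvd_iff]
    intro k hk
    rw [map_sub, Polynomial.coeff_coe, PowerSeries.coeff_trunc, if_pos hk, sub_self]
  have hopt : (fun i : Option (Fin d) => i.elim (τ none) fun j => τ (some j)) = τ := by
    ext i; cases i <;> rfl
  let g1 := spec (RingHom.id F[X]) (fun j => τ (some j)) 1 f'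
  let g2 := spec (RingHom.id F[X]) (fun j => τ (some j)) 1 h'
  have hg1 : g1.eval (τ none) = f'.eval₂ (RingHom.id F[X]) τ := by
    rw [eval_spec, one_mul, hopt]
  have hg1' : g1.derivative.eval (τ none) = (MvPolynomial.pderiv none f').eval₂ (RingHom.id F[X]) τ := by
    rw [derivative_spec, map_one, one_mul, eval_spec, one_mul, hopt]
  have hg2 : g2.eval (τ none) = h'.eval₂ (RingHom.id F[X]) τ := by
    rw [eval_spec, one_mul, hopt]
  obtain ⟨r, hr⟩ : ∃ r, g1.eval (τ none) = X ^ R * r := by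
    have := hτ f'
    rw [e1, zero_sub, dvd_neg, PowerSeries.X_pow_dvd_iff] at this
    rw [hg1]
    exact X_pow_dvd_iff.2 fun k hk => by rw [← this k hk, Polynomial.coeff_coe]
  obtain ⟨a1, ha1, ha1'⟩ := exists_eq_X_pow_mul (show m < R by omega)
    (hτ (MvPolynomial.pderiv none f')) hm1 hm2
  obtain ⟨b, hb, hb'⟩ := exists_eq_X_pow_mul (show l < R by omega) (hτ h') hl1 hl2
  obtain ⟨t0, y0, ht, r1, r2⟩ := hF.exists_root (g := g1) (G := g2) (M := M) (by omega) (by omega) hr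
    (hg1'.trans ha1) ha1' (hg2.trans hb) hb'
  let w : Option (Fin d) → F := fun i => i.elim y0 fun j => (τ (some j)).eval t0
  have hspec : ∀ g : MvPolynomial (Option (Fin d)) F[X],
      (spec (RingHom.id F[X]) (fun j => τ (some j)) 1 g).eval₂ (evalRingHom t0) y0 =
      g.eval₂ (evalRingHom t0) w := by
    intro g
    rw [spec, ← coe_eval₂RingHom, MvPolynomial.hom_eval₂]
    congr 1
    · ext <;> simp
    · ext i; cases i <;> simp [w]
  have hid : eval₂RingHom (RingHom.id F) t0 = evalRingHom t0 := rfl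
  refine h4 F (RingHom.id F) (fun i => t0⁻¹ ^ N * w i) ?_ ?_
  · have := hf' (RingHom.id F) t0 t0⁻¹ (mul_inv_cancel₀ ht) w
    rw [hid, ← hspec, r1] at this
    exact (mul_eq_zero.1 this).resolve_left (pow_ne_zero _ ht)
  · have := hh' (RingHom.id F) t0 t0⁻¹ (mul_inv_cancel₀ ht) w
    rw [hid, ← hspec] at this
    exact right_ne_zero_of_mul (this.symm ▸ r2)

end LargeOfCurve

end Paper

namespace Paper

open Polynomial

section Coarse

variable {K : Type u} [Field K] {Γ : Type*} [LinearOrderedCommGroupWithZero Γ]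
  (v : Valuation K Γ) (t : K)

/-- The smallest coarsening of the valuation ring of `v` in which `t` becomes invertible. -/
def coarse (ht : v t ≤ 1) : ValuationSubring K where
  carrier := {x | ∃ k : ℕ, v x * v t ^ k ≤ 1}
  mul_mem' := by
    rintro x y ⟨k, hk⟩ ⟨l, hl⟩
    refine ⟨k + l, ?_⟩
    rw [map_mul, pow_add, mul_mul_mul_comm]
    exact mul_le_one' hk hl
  one_mem' := ⟨0, by simp⟩
  add_mem' := by
    rintro x y ⟨k, hk⟩ ⟨l, hl⟩
    refine ⟨k + l, ?_⟩
    rcases le_total (v x) (v y) with h | h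
    · calc v (x + y) * v t ^ (k + l) ≤ v y * v t ^ l :=
          mul_le_mul' (v.map_add_le h le_rfl) (pow_le_pow_right_of_le_one' ht (by omega))
        _ ≤ 1 := hl
    · calc v (x + y) * v t ^ (k + l) ≤ v x * v t ^ k :=
          mul_le_mul' (v.map_add_le le_rfl h) (pow_le_pow_right_of_le_one' ht (by omega))
        _ ≤ 1 := hk
  zero_mem' := ⟨0, by simp⟩
  neg_mem' := by
    rintro x ⟨k, hk⟩
    exact ⟨k, by rwa [Valuation.map_neg]⟩
  mem_or_inv_mem' := by
    intro x
    rcases le_total (v x) 1 with h | h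
    · exact Or.inl ⟨0, by simpa using h⟩
    · exact Or.inr ⟨0, by simpa using inv_le_one_of_one_le₀ h⟩

variable {v t} (ht : v t ≤ 1)

lemma mem_coarse {x : K} : x ∈ coarse v t ht ↔ ∃ k : ℕ, v x * v t ^ k ≤ 1 := Iff.rfl

/-- The place attached to the coarsening. -/
def CoarsePlace (x : K) (r : IsLocalRing.ResidueField (coarse v t ht)) : Prop :=
  ∃ h : x ∈ coarse v t ht, IsLocalRing.residue _ ⟨x, h⟩ = r

lemma coarsePlace_residue (x : coarse v t ht) :
    CoarsePlace ht (x : K) (IsLocalRing.residue _ x) := ⟨x.2, rfl⟩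

lemma residue_coarse_eq_zero_iff (ht0 : v t ≠ 0) (ht1 : v t < 1) (x : coarse v t ht) :
    IsLocalRing.residue _ x = 0 ↔ ∀ k : ℕ, v (x : K) ≤ v t ^ k := by
  have hpos : 0 < v t := zero_lt_iff.2 ht0
  rw [IsLocalRing.residue_eq_zero_iff, ValuationSubring.valuation_lt_one_iff, ← not_le]
  by_cases hx : (x : K) = 0
  · simp [hx]
  have hvx : 0 < v (x : K) := zero_lt_iff.2 ((Valuation.ne_zero_iff v).2 hx)
  have h1 : 1 ≤ (coarse v t ht).valuation x ↔ (x : K)⁻¹ ∈ coarse v t ht := by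
    rw [← ValuationSubring.valuation_le_one_iff, map_inv₀, inv_le_one₀]
    exact zero_lt_iff.2 ((Valuation.ne_zero_iff _).2 hx)
  rw [h1, mem_coarse]
  push Not
  simp only [map_inv₀]
  have h2 : ∀ k, 1 < (v (x : K))⁻¹ * v t ^ k ↔ v (x : K) < v t ^ k := fun k => by
    rw [lt_inv_mul_iff₀ hvx, mul_one]
  simp only [h2]
  refine ⟨fun h k => (h k).le, fun h k => (h (k + 1)).trans_lt ?_⟩
  rw [pow_succ]
  exact mul_lt_of_lt_one_right (pow_pos hpos k) ht1

lemma coarsePlace_zero_iff (ht0 : v t ≠ 0) (ht1 : v t < 1) (x : K) :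
    CoarsePlace ht x 0 ↔ ∀ k : ℕ, v x ≤ v t ^ k := by
  constructor
  · rintro ⟨h, hr⟩
    exact (residue_coarse_eq_zero_iff ht ht0 ht1 ⟨x, h⟩).1 hr
  · intro h
    have hx : x ∈ coarse v t ht := ⟨0, by simpa using h 0⟩
    exact ⟨hx, (residue_coarse_eq_zero_iff ht ht0 ht1 ⟨x, hx⟩).2 h⟩

lemma isPlace_coarsePlace (ht0 : v t ≠ 0) (ht1 : v t < 1) : IsPlace (CoarsePlace ht) where
  one := coarsePlace_residue ht 1
  neg := by
    rintro x _ ⟨h, rfl⟩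
    simpa using coarsePlace_residue ht (-⟨x, h⟩)
  add := by
    rintro x y _ _ ⟨h, rfl⟩ ⟨h', rfl⟩
    rw [← map_add]
    exact coarsePlace_residue ht (⟨x, h⟩ + ⟨y, h'⟩)
  mul := by
    rintro x y _ _ ⟨h, rfl⟩ ⟨h', rfl⟩
    rw [← map_mul]
    exact coarsePlace_residue ht (⟨x, h⟩ * ⟨y, h'⟩)
  uniq := by
    rintro x _ _ ⟨h, rfl⟩ ⟨h', rfl⟩
    rfl
  total := by
    intro x
    by_cases h : x ∈ coarse v t ht
    · exact Or.inl ⟨_, h, rfl⟩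
    · right
      have hpos : 0 < v t := zero_lt_iff.2 ht0
      rw [coarsePlace_zero_iff ht ht0 ht1]
      intro k
      rw [mem_coarse] at h
      push Not at h
      have hx : 0 < v x := zero_lt_iff.2 fun h0 => by
        have := h 0
        rw [h0, zero_mul] at this
        exact not_lt_zero this
      rw [map_inv₀, inv_le_iff_one_le_mul₀ hx, mul_comm]
      exact (h k).le
  surj := by
    intro r
    obtain ⟨x, rfl⟩ := IsLocalRing.residue_surjective r
    exact ⟨x, x.2, rfl⟩

lemma exists_bound {ι : Type*} (s : Finset ι) (f : ι → K) (hf : ∀ i ∈ s, f i ∈ coarse v t ht) :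
    ∃ k : ℕ, ∀ i ∈ s, ∀ l, k ≤ l → v (f i) * v t ^ l ≤ 1 := by
  classical
  choose! k hk using hf
  refine ⟨s.sup k, fun i hi l hl => (mul_le_mul_right (pow_le_pow_right_of_le_one' ht ?_) _).trans
    (hk i hi)⟩
  exact (Finset.le_sup hi).trans hl

lemma isPlaceHensel_coarsePlace (ht0 : v t ≠ 0) (ht1 : v t < 1) (hv : IsHenselian v) :
    IsPlaceHensel (CoarsePlace ht) := by
  have hpos : 0 < v t := zero_lt_iff.2 ht0
  intro g hg h0 h1
  rw [coarsePlace_zero_iff ht ht0 ht1] at h0 h1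
  push Not at h1
  obtain ⟨j, hj⟩ := h1
  obtain ⟨k, hk⟩ := exists_bound ht g.support g.coeff fun i _ => (hg i).choose_spec.choose
  obtain ⟨y, hy, hy'⟩ := exists_root_of_lt v hv g (v t ^ k)⁻¹ (fun i => by
      by_cases hi : i ∈ g.support
      · rw [← one_mul (v t ^ k)⁻¹, le_mul_inv_iff₀ (pow_pos hpos k)]
        exact hk i hi k le_rfl
      · rw [notMem_support_iff.1 hi, map_zero]
        exact zero_le) (by
      rw [mul_inv_lt_iff₀ (pow_pos hpos k)]
      calc v (g.coeff 0) ≤ v t ^ (2 * j + k) := h0 _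
        _ = (v t ^ j) ^ 2 * v t ^ k := by rw [pow_add, mul_comm 2, pow_mul]
        _ < v (g.coeff 1) ^ 2 * v t ^ k :=
          mul_lt_mul_of_pos_right (pow_lt_pow_left₀ hj zero_le two_ne_zero) (pow_pos hpos k))
  refine ⟨y, ?_, hy⟩
  rw [coarsePlace_zero_iff ht ht0 ht1]
  intro N
  have : v y * v t ^ j ≤ v t ^ N * v t ^ j := by
    rw [← pow_add]
    exact (mul_le_mul_right hj.le _).trans (hy'.trans (h0 _))
  exact le_of_mul_le_mul_right this (pow_pos hpos j)

lemma mul_le_pow {x y : K} {k m : ℕ} (hx : v x * v t ^ k ≤ 1)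
    (hy : v y ≤ v t ^ (k + m)) : v (x * y) ≤ v t ^ m := by
  rw [map_mul]
  calc v x * v y ≤ v x * (v t ^ k * v t ^ m) := mul_le_mul_right (hy.trans (pow_add _ _ _).le) _
    _ = (v x * v t ^ k) * v t ^ m := (mul_assoc _ _ _).symm
    _ ≤ 1 * v t ^ m := mul_le_mul_left hx _
    _ = _ := one_mul _

lemma largeCurve_coarse (ht0 : v t ≠ 0) (ht1 : v t < 1) (hv : IsHenselian v) :
    LargeCurve (IsLocalRing.ResidueField (coarse v t ht)) := by
  classical
  have hpos : 0 < v t := zero_lt_iff.2 ht0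
  let O := coarse v t ht
  let ρ := IsLocalRing.residue O
  intro N c d hN hc0 hc1 hd0
  have lift0 : ∀ r : IsLocalRing.ResidueField O, ∃ x : O, ρ x = r ∧ (r = 0 → x = 0) := by
    intro r
    by_cases hr : r = 0
    · exact ⟨0, by rw [map_zero, hr], fun _ => rfl⟩
    · obtain ⟨x, hx⟩ := IsLocalRing.residue_surjective r
      exact ⟨x, hx, fun h => absurd h hr⟩
  choose lft hl hl0 using lift0
  have hne : ∀ r, r ≠ 0 → ∃ k, v t ^ k < v (lft r : K) := by
    intro r hr
    have : ρ (lft r) ≠ 0 := by rwa [hl]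
    rw [Ne, residue_coarse_eq_zero_iff ht ht0 ht1] at this
    push Not at this
    exact this
  obtain ⟨k1, hk1⟩ := hne _ hc1
  obtain ⟨k2, hk2⟩ := hne _ hd0
  let S := Finset.range N ×ˢ Finset.range N
  obtain ⟨k3, hk3⟩ := exists_bound ht S (fun ij => (lft (c ij.1 ij.2) : K)) fun _ _ => Subtype.prop _
  obtain ⟨k4, hk4⟩ := exists_bound ht S (fun ij => (lft (d ij.1 ij.2) : K)) fun _ _ => Subtype.prop _
  obtain ⟨k, e1, e2, e3, e4⟩ : ∃ k, k1 ≤ k ∧ k2 ≤ k ∧ k3 ≤ k ∧ k4 ≤ k :=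
    ⟨k1 + k2 + k3 + k4, by omega, by omega, by omega, by omega⟩
  have hanti : ∀ {a b : ℕ}, a ≤ b → v t ^ b ≤ v t ^ a := fun h => pow_le_pow_right_of_le_one' ht h
  have hstrict : ∀ {a b : ℕ}, a < b → v t ^ b < v t ^ a := fun h =>
    (pow_lt_pow_iff_right_of_lt_one₀ hpos ht1).2 h
  have hc1' : v t ^ k < v (lft (c 0 1) : K) := (hanti e1).trans_lt hk1
  have hd0' : v t ^ k < v (lft (d 0 0) : K) := (hanti e2).trans_lt hk2
  let J := 4 * k + 1
  let e : K := t ^ J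
  have hvt : ∀ l, v (t ^ l) = v t ^ l := fun l => map_pow _ _ _
  have hmem : ∀ l, t ^ l ∈ O := fun l => ⟨0, by
    rw [pow_zero, mul_one, map_pow]
    exact pow_le_one₀ zero_le ht⟩
  let e' : O := ⟨e, hmem J⟩
  let coef : ℕ → K := fun j => ∑ i ∈ Finset.range N, (lft (c i j) : K) * e ^ i
  let g : K[X] := ∑ j ∈ Finset.range N, C (coef j) * X ^ j
  have hg : ∀ j, g.coeff j = if j < N then coef j else 0 := by
    intro j
    simp [g, coeff_X_pow]
  have hcoef : ∀ j, j < N → v (coef j) * v t ^ k ≤ 1 := by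
    intro j hj
    have : coef j * t ^ k = ∑ i ∈ Finset.range N, (lft (c i j) : K) * e ^ i * t ^ k := by
      rw [Finset.sum_mul]
    rw [← hvt, ← map_mul, this]
    refine v.map_sum_le fun i hi => ?_
    have h1 := hk3 (i, j) (Finset.mem_product.2 ⟨hi, Finset.mem_range.2 hj⟩) k e3
    rw [mul_right_comm, map_mul, map_mul, hvt, map_pow, hvt]
    exact mul_le_one' h1 (pow_le_one₀ zero_le (pow_le_one₀ zero_le ht))
  have hg0 : v (g.coeff 0) ≤ v t ^ (3 * k + 1) := by
    rw [hg, if_pos (by omega)]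
    refine v.map_sum_le fun i hi => ?_
    rcases i.eq_zero_or_pos with rfl | hi0
    · rw [hl0 _ hc0]
      simp
    · refine mul_le_pow (hk3 (i, 0) (Finset.mem_product.2 ⟨hi, Finset.mem_range.2 (by omega)⟩) k e3) ?_
      rw [map_pow, hvt, ← pow_mul]
      exact hanti ((show _ ≤ J by omega).trans (Nat.le_mul_of_pos_right J hi0))
  have hg1 : v (g.coeff 1) = v (lft (c 0 1) : K) := by
    rw [hg, if_pos (by omega)]
    simp only [coef]
    rw [← Finset.add_sum_erase _ _ (Finset.mem_range.2 (show 0 < N by omega)), pow_zero, mul_one]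
    refine Valuation.map_add_eq_of_lt_left _ (lt_of_le_of_lt ?_ ((hstrict
      (Nat.lt_succ_self k)).trans hc1'))
    refine v.map_sum_le fun i hi => ?_
    rw [Finset.mem_erase] at hi
    refine mul_le_pow (hk3 (i, 1) (Finset.mem_product.2 ⟨hi.2, Finset.mem_range.2 (by omega)⟩) k e3) ?_
    rw [map_pow, hvt, ← pow_mul]
    have : 1 ≤ i := Nat.one_le_iff_ne_zero.2 hi.1
    exact hanti ((show _ ≤ J by omega).trans (Nat.le_mul_of_pos_right J this))
  obtain ⟨y, hy, hy'⟩ := exists_root_of_lt v hv g (v t ^ k)⁻¹ (fun i => by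
      rw [hg]
      split_ifs with hi
      · rw [← one_mul (v t ^ k)⁻¹, le_mul_inv_iff₀ (pow_pos hpos k)]
        exact hcoef i hi
      · rw [map_zero]
        exact zero_le) (by
      rw [mul_inv_lt_iff₀ (pow_pos hpos k), hg1]
      calc v (g.coeff 0) ≤ v t ^ (3 * k + 1) := hg0
        _ < v t ^ (k * 2 + k) := hstrict (by omega)
        _ = (v t ^ k) ^ 2 * v t ^ k := by rw [pow_add, pow_mul]
        _ ≤ v (lft (c 0 1) : K) ^ 2 * v t ^ k :=
          mul_le_mul_left (pow_le_pow_left₀ zero_le hc1'.le 2) _)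
  rw [hg1] at hy'
  have hvy : v y ≤ v t ^ (2 * k + 1) := by
    have : v y * v t ^ k ≤ v t ^ (2 * k + 1) * v t ^ k := by
      rw [← pow_add]
      refine (mul_le_mul_right hc1'.le _).trans (hy'.trans (hg0.trans (hanti (by omega))))
    exact le_of_mul_le_mul_right this (pow_pos hpos k)
  have hyO : y ∈ O := ⟨0, by
    rw [pow_zero, mul_one]
    exact hvy.trans (pow_le_one₀ zero_le ht)⟩
  let y' : O := ⟨y, hyO⟩
  refine ⟨ρ e', ρ y', ?_, ?_, ?_⟩
  · rw [Ne, residue_coarse_eq_zero_iff ht ht0 ht1]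
    push Not
    exact ⟨J + 1, by
      change v t ^ (J + 1) < v (t ^ J)
      rw [hvt]
      exact hstrict (Nat.lt_succ_self J)⟩
  · have : ∑ i ∈ Finset.range N, ∑ j ∈ Finset.range N, lft (c i j) * e' ^ i * y' ^ j = 0 := by
      apply Subtype.ext
      rw [Finset.sum_comm]
      rw [eval_finsetSum] at hy
      push_cast
      rw [← hy]
      refine Finset.sum_congr rfl fun j _ => ?_
      rw [eval_mul, eval_C, eval_pow, eval_X, Finset.sum_mul]
    have := congrArg ρ this
    simpa only [map_sum, map_mul, map_pow, hl, map_zero] using this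
  · have h1 : ρ (∑ i ∈ Finset.range N, ∑ j ∈ Finset.range N, lft (d i j) * e' ^ i * y' ^ j) ≠ 0 := by
      rw [Ne, residue_coarse_eq_zero_iff ht ht0 ht1]
      push Not
      refine ⟨k, ?_⟩
      rw [← Finset.sum_product', ← Finset.add_sum_erase _ _ (show ((0, 0) : ℕ × ℕ) ∈ S from
        Finset.mem_product.2 ⟨Finset.mem_range.2 (by omega), Finset.mem_range.2 (by omega)⟩)]
      push_cast
      rw [pow_zero, pow_zero, mul_one, mul_one, Valuation.map_add_eq_of_lt_left]
      · exact hd0'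
      refine lt_of_le_of_lt ?_ ((hstrict (Nat.lt_succ_self k)).trans hd0')
      refine v.map_sum_le fun ij hij => ?_
      rw [Finset.mem_erase] at hij
      rw [mul_assoc]
      refine mul_le_pow (hk4 ij hij.2 k e4) ?_
      rw [map_mul v, map_pow v (e' : K), map_pow v (y' : K)]
      have h5 : v (e' : K) ≤ v t ^ (k + (k + 1)) := by
        change v (t ^ J) ≤ _
        rw [hvt]
        exact hanti (by omega)
      have h6 : v (y' : K) ≤ v t ^ (k + (k + 1)) := hvy.trans (hanti (by omega))
      have h7 : v t ^ (k + (k + 1)) ≤ 1 := pow_le_one₀ zero_le ht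
      obtain ⟨i, j⟩ := ij
      change v (e' : K) ^ i * v (y' : K) ^ j ≤ v t ^ (k + (k + 1))
      rcases i.eq_zero_or_pos with rfl | hi
      · have hj : j ≠ 0 := by
          rintro rfl
          exact hij.1 rfl
        rw [pow_zero, one_mul]
        exact (pow_le_of_le_one zero_le (h6.trans h7) hj).trans h6
      · exact (mul_le_of_le_one_right' (pow_le_one₀ zero_le (h6.trans h7))).trans
          ((pow_le_of_le_one zero_le (h5.trans h7) hi.ne').trans h5)
    simpa only [map_sum, map_mul, map_pow, hl] using h1

end Coarse

end Paper

namespace Paper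

section CompletionSep

open Filter Topology UniformSpace

variable {C : Type u} [Field C] (p : ℕ) [ExpChar C p]

omit [ExpChar C p] in
lemma exists_bound_of_erase (u : Valuation C Zm0) {π : C} (hπ0 : u π ≠ 0) {ι : Type*} {c : ι → C}
    {s : Finset ι}
    (h : ∃ N : ℕ, ∀ x : ι → C, u (∑ i ∈ s, c i * x i ^ p) ≤ u π ^ N → ∀ i ∈ s, u (x i) < 1)
    (m : ℕ) :
    ∃ N : ℕ, ∀ x : ι → C, u (∑ i ∈ s, c i * x i ^ p) ≤ u π ^ N → ∀ i ∈ s, u (x i) < u π ^ m := by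
  obtain ⟨N, hN⟩ := h
  have hpos : 0 < u π := zero_lt_iff.2 hπ0
  refine ⟨N + m * p, fun x hx i hi => ?_⟩
  have hπ : π ≠ 0 := (Valuation.ne_zero_iff u).1 hπ0
  have h1 : (∑ i ∈ s, c i * (x i * (π ^ m)⁻¹) ^ p) * π ^ (m * p) = ∑ i ∈ s, c i * x i ^ p := by
    rw [Finset.sum_mul]
    refine Finset.sum_congr rfl fun i _ => ?_
    rw [mul_pow, pow_mul, inv_pow]
    field_simp
  have := hN (fun i => x i * (π ^ m)⁻¹) (by
    rw [← h1, map_mul, map_pow, pow_add] at hx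
    exact le_of_mul_le_mul_right hx (pow_pos hpos _)) i hi
  simp only [map_mul, map_inv₀, map_pow] at this
  rwa [← div_eq_mul_inv, div_lt_one₀ (pow_pos hpos m)] at this

lemma exists_bound_of_completion [Valued C Zm0] {π : C} (hπ0 : Valued.v π ≠ 0)
    (hπ1 : Valued.v π < 1) (hC : PInd p (Completion.coeRingHom : C →+* Completion C))
    {ι : Type*} [Fintype ι] (c : ι → C)
    (hc : ∀ x : ι → C, ∑ i, c i * x i ^ p = 0 → ∀ i, x i = 0) (s : Finset ι) :
    ∃ N : ℕ, ∀ x : ι → C, Valued.v (∑ i ∈ s, c i * x i ^ p) ≤ Valued.v π ^ N →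
      ∀ i ∈ s, Valued.v (x i) < 1 := by
  classical
  have hanti : ∀ {a b : ℕ}, a ≤ b → Valued.v π ^ b ≤ Valued.v π ^ a :=
    fun h => pow_le_pow_right_of_le_one' hπ1.le h
  have hp : p ≠ 0 := (expChar_pos C p).ne'
  have hsmall : ∀ γ : (MonoidWithZeroHom.ValueGroup₀ (.ofClass (Valued.v (R := C))))ˣ,
      ∃ N : ℕ, ∀ M, N ≤ M → ∀ x : C, Valued.v x ≤ Valued.v π ^ M → Valued.v.restrict x < γ.1 := by
    intro γ
    have : MonoidWithZeroHom.ValueGroup₀.embedding γ.1 ≠ 0 := by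
      rw [Ne, map_eq_zero]
      exact γ.ne_zero
    obtain ⟨N, hN⟩ := exists_pow_lt₀ hπ1 (Units.mk0 _ this)
    refine ⟨N, fun M hM x hx => ?_⟩
    rw [Valuation.restrict_lt_iff_lt_embedding]
    exact (hx.trans (hanti hM)).trans_lt hN
  have hlim : ∀ z : ℕ → C, (∀ N, Valued.v (z N) ≤ Valued.v π ^ N) → Tendsto z atTop (𝓝 0) := by
    intro z hz
    rw [(Valued.hasBasis_nhds_zero C Zm0).tendsto_right_iff]
    intro γ _
    obtain ⟨N, hN⟩ := hsmall γ
    filter_upwards [eventually_ge_atTop N] with M hM using hN M hM _ (hz M)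
  induction s using Finset.strongInduction with
  | H s ih =>
  have key : ∀ i ∈ s, ∃ N : ℕ, ∀ x : ι → C, Valued.v (∑ i ∈ s, c i * x i ^ p) ≤ Valued.v π ^ N →
      Valued.v (x i) < 1 := by
    intro i hi
    by_contra! hcon
    have hcon' : ∀ N, ∃ y : ι → C, Valued.v (∑ i ∈ s, c i * y i ^ p) ≤ Valued.v π ^ N ∧ y i = 1 := by
      intro N
      obtain ⟨x, hx, hxi⟩ := hcon N
      have hxi0 : x i ≠ 0 := by
        intro h
        rw [h, map_zero] at hxi
        exact not_le.2 zero_lt_one hxi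
      refine ⟨fun j => x j * (x i)⁻¹, ?_, mul_inv_cancel₀ hxi0⟩
      have : ∑ j ∈ s, c j * (x j * (x i)⁻¹) ^ p = (∑ j ∈ s, c j * x j ^ p) * ((x i)⁻¹) ^ p := by
        rw [Finset.sum_mul]
        refine Finset.sum_congr rfl fun j _ => ?_
        ring
      rw [this, map_mul, map_pow, map_inv₀]
      exact (mul_le_of_le_one_right' (pow_le_one₀ zero_le (inv_le_one_of_one_le₀ hxi))).trans hx
    choose y hy hyi using hcon'
    have hcauchy : ∀ j ∈ s, CauchySeq fun N => y N j := by
      intro j hj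
      rcases eq_or_ne j i with rfl | hji
      · simp only [hyi]
        exact cauchySeq_const 1
      rw [(Valued.hasBasis_uniformity C Zm0).cauchySeq_iff]
      intro γ _
      obtain ⟨m, hm⟩ := hsmall γ
      obtain ⟨N, hN⟩ := exists_bound_of_erase p Valued.v hπ0 (ih _ (Finset.erase_ssubset hi)) m
      refine ⟨N, fun a ha b hb => hm m le_rfl _ (hN (y b - y a) ?_ j
        (Finset.mem_erase.2 ⟨hji, hj⟩)).le⟩
      have e : ∀ z : ι → C, ∑ j ∈ s.erase i, c j * z j ^ p = ∑ j ∈ s, c j * z j ^ p - c i * z i ^ p :=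
        fun z => by rw [← Finset.sum_erase_add _ _ hi, add_sub_cancel_right]
      rw [e, Pi.sub_apply, hyi, hyi, sub_self, zero_pow hp, mul_zero, sub_zero]
      have e2 : ∑ j ∈ s, c j * (y b - y a) j ^ p =
          ∑ j ∈ s, c j * y b j ^ p - ∑ j ∈ s, c j * y a j ^ p := by
        rw [← Finset.sum_sub_distrib]
        refine Finset.sum_congr rfl fun j _ => ?_
        rw [Pi.sub_apply, sub_pow_expChar, mul_sub]
      rw [e2]
      exact Valuation.map_sub_le _ ((hy b).trans (hanti hb)) ((hy a).trans (hanti ha))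
    have hex : ∀ j, ∃ l : Completion C, (j ∈ s → Tendsto (fun N => (y N j : Completion C)) atTop (𝓝 l)) ∧
        (j ∉ s → l = 0) := by
      intro j
      by_cases hj : j ∈ s
      · obtain ⟨l, hl⟩ := cauchySeq_tendsto_of_complete
          ((Completion.uniformContinuous_coe C).comp_cauchySeq (hcauchy j hj))
        exact ⟨l, fun _ => hl, fun h => absurd hj h⟩
      · exact ⟨0, fun h => absurd h hj, fun _ => rfl⟩
    choose l hl hl0 using hex
    have hsum : Tendsto (fun N => ((∑ j ∈ s, c j * y N j ^ p : C) : Completion C)) atTop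
        (𝓝 (∑ j ∈ s, (c j : Completion C) * l j ^ p)) := by
      have : ∀ N, ((∑ j ∈ s, c j * y N j ^ p : C) : Completion C) =
          ∑ j ∈ s, (c j : Completion C) * (y N j : Completion C) ^ p := by
        intro N
        change Completion.coeRingHom _ = _
        rw [map_sum]
        refine Finset.sum_congr rfl fun j _ => ?_
        rw [map_mul, map_pow]
        rfl
      simp only [this]
      exact tendsto_finsetSum _ fun j hj => ((hl j hj).pow p).const_mul _
    have hsum' : Tendsto (fun N => ((∑ j ∈ s, c j * y N j ^ p : C) : Completion C)) atTop
        (𝓝 ((0 : C) : Completion C)) :=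
      ((Completion.continuous_coe C).tendsto 0).comp (hlim _ hy)
    have h0 := tendsto_nhds_unique hsum hsum'
    have h1 : ∑ j, Completion.coeRingHom (c j) * l j ^ p = 0 := by
      rw [← Finset.sum_subset (Finset.subset_univ s)
        fun j _ hj => by rw [hl0 j hj, zero_pow hp, mul_zero] ]
      rw [Completion.coe_zero] at h0
      exact h0
    have h2 := hC.fintype c hc l h1 i
    have h3 : l i = ((1 : C) : Completion C) := by
      refine tendsto_nhds_unique (hl i hi) ?_
      simp only [hyi]
      exact tendsto_const_nhds
    rw [h3, Completion.coe_one] at h2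
    exact one_ne_zero h2
  choose! N hN using key
  exact ⟨s.sup N, fun x hx i hi => hN i hi x (hx.trans (hanti (Finset.le_sup hi)))⟩

lemma ExcellentCompletion.exists_bound {u : Valuation C Zm0} (h : ExcellentCompletion C u) {π : C}
    (hπ0 : u π ≠ 0) (hπ1 : u π < 1) {ι : Type*} [Fintype ι] (c : ι → C)
    (hc : ∀ x : ι → C, ∑ i, c i * x i ^ p = 0 → ∀ i, x i = 0) :
    ∃ N : ℕ, ∀ x : ι → C, u (∑ i, c i * x i ^ p) ≤ u π ^ N → ∀ i, u (x i) < 1 := by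
  let _ : Valued C Zm0 := Valued.mk' u
  obtain ⟨N, hN⟩ := exists_bound_of_completion p (π := π) hπ0 hπ1 (PInd.of_isSepExtHom h) c hc
    Finset.univ
  exact ⟨N, fun x hx i => hN x hx i (Finset.mem_univ i)⟩

end CompletionSep

end Paper

namespace Paper

lemma resMap_eq_zero_iff {K : Type*} [Field K] {Γ : Type*} [LinearOrderedCommGroupWithZero Γ]
    (v : Valuation K Γ) (x : v.valuationSubring) : resMap v x = 0 ↔ v (x : K) < 1 := by
  rw [IsLocalRing.residue_eq_zero_iff, ValuationSubring.valuation_lt_one_iff]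
  exact (Valuation.isEquiv_valuation_valuationSubring v).symm.lt_one_iff_lt_one

section ResidueBasis

variable {C : Type u} [Field C] {u : Valuation C Zm0} {π : C}
  {K : Type u} [Field K] [Algebra C K] {Γ : Type u} [LinearOrderedCommGroupWithZero Γ]
  {v : Valuation K Γ}

lemma IsUniformizer.le_of_lt {K : Type*} [Field K] {Γ : Type*} [LinearOrderedCommGroupWithZero Γ]
    {v : Valuation K Γ} {t : K} (ht : IsUniformizer v t) {N : ℕ} {x : K} (h : v x < v t ^ N) :
    v x ≤ v t ^ (N + 1) := by
  have hpos : 0 < v t ^ N := pow_pos ht.1 N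
  have ht0 : t ≠ 0 := (Valuation.ne_zero_iff v).1 ht.1.ne'
  have h1 : v (x * (t ^ N)⁻¹) < 1 := by
    rwa [map_mul, map_inv₀, map_pow, ← div_eq_mul_inv, div_lt_one₀ hpos]
  have h2 := ht.2.2 _ h1
  rw [map_mul, map_inv₀, map_pow, ← div_eq_mul_inv, div_le_iff₀ hpos] at h2
  rwa [pow_succ']

lemma exists_residue_basis (p : ℕ) [ExpChar (ResF u) p]
    (hKC : (v.comap (algebraMap C K)).IsEquiv u) (hπv : IsUniformizer v (algebraMap C K π))
    (hπu : u π ≤ 1)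
    (g : ResF u →+* ResF v) (hg : ResCompat u v g) (hP : PInd p g) :
    ∃ (κ : Type u) (B : κ → K), (∀ k, v (B k) ≤ 1) ∧
      (∀ (T : Finset κ) (η : κ → C) (d : C), v (∑ k ∈ T, algebraMap C K (η k) * B k ^ p) ≤
        v (algebraMap C K d) → ∀ k ∈ T, u (η k) ≤ u d) ∧
      ∀ (M : ℕ) (y : K), v y ≤ 1 → ∃ ξ : κ →₀ C, (∀ k, u (ξ k) ≤ 1) ∧
        v (y - Finsupp.linearCombination C B ξ) ≤ v (algebraMap C K π) ^ M := by
  classical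
  let _ : Algebra (ResF u) (ResF v) := g.toAlgebra
  have hle : ∀ x y : C, v (algebraMap C K x) ≤ v (algebraMap C K y) ↔ u x ≤ u y := hKC
  have hle1 : ∀ x : C, v (algebraMap C K x) ≤ 1 ↔ u x ≤ 1 := fun x => hKC.le_one_iff_le_one
  let b := Module.Basis.ofVectorSpace (ResF u) (ResF v)
  have hbp := hP.linearIndependent_pow b.linearIndependent
  choose B hB using fun k => IsLocalRing.residue_surjective (R := v.valuationSubring) (b k)
  let s : ResF u → u.valuationSubring := fun r =>
    if r = 0 then 0 else Function.surjInv IsLocalRing.residue_surjective r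
  have hs : ∀ r, resMap u (s r) = r := by
    intro r
    by_cases hr : r = 0
    · simp [s, hr]
    · simp only [s, if_neg hr]
      exact Function.surjInv_eq _ r
  have hs0 : s 0 = 0 := if_pos rfl
  let j : u.valuationSubring → v.valuationSubring := fun x =>
    ⟨algebraMap C K x, (hle1 _).2 x.2⟩
  have hj : ∀ x, resMap v (j x) = g (resMap u x) := fun x => (hg x _).symm
  refine ⟨_, fun k => (B k : K), fun k => (B k).2, ?_, ?_⟩
  · intro T η d h k hk
    by_contra! hcon
    obtain ⟨k0, hk0, hmax⟩ := T.exists_max_image (fun k => u (η k)) ⟨k, hk⟩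
    have hd : u d < u (η k0) := hcon.trans_le (hmax k hk)
    have hpos : 0 < u (η k0) := lt_of_le_of_lt zero_le hd
    have hη : η k0 ≠ 0 := (Valuation.ne_zero_iff u).1 hpos.ne'
    let μ : _ → u.valuationSubring := fun k => if h : k ∈ T then ⟨η k / η k0, by
      change u _ ≤ 1
      rw [map_div₀, div_le_one₀ hpos]
      exact hmax k h⟩ else 0
    have h1 : resMap v (∑ k ∈ T, j (μ k) * B k ^ p) ≠ 0 := by
      rw [map_sum]
      simp only [map_mul, map_pow, hj, hB]
      intro h0
      have := linearIndependent_iff'.1 hbp T (fun k => resMap u (μ k)) (by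
        simp only [Algebra.smul_def]
        exact h0) k0 hk0
      simp only [μ, dif_pos hk0] at this
      rw [resMap_eq_zero_iff] at this
      change u (η k0 / η k0) < 1 at this
      rw [div_self hη, map_one] at this
      exact lt_irrefl _ this
    rw [Ne, resMap_eq_zero_iff, not_lt] at h1
    have h2 : ∑ k ∈ T, algebraMap C K (η k) * (B k : K) ^ p = algebraMap C K (η k0) *
        ((∑ k ∈ T, j (μ k) * B k ^ p : v.valuationSubring) : K) := by
      push_cast
      rw [Finset.mul_sum]
      refine Finset.sum_congr rfl fun k hk => ?_
      simp only [μ, dif_pos hk, j]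
      rw [← mul_assoc, ← map_mul, mul_div_cancel₀ _ hη]
    rw [h2, map_mul] at h
    have h3 : v (algebraMap C K (η k0)) ≤ v (algebraMap C K d) :=
      (le_mul_of_one_le_right' h1).trans h
    exact not_lt.2 ((hle _ _).1 h3) hd
  · intro M y hy
    induction M with
    | zero => exact ⟨0, by simp, by simpa using hy⟩
    | succ M ih =>
      obtain ⟨ξ, hξ, hM⟩ := ih
      set ϖ := algebraMap C K π with hϖ
      have hϖ0 : ϖ ≠ 0 := (Valuation.ne_zero_iff v).1 hπv.1.ne'
      have hpos : 0 < v ϖ ^ M := pow_pos hπv.1 M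
      let r : v.valuationSubring := ⟨(y - Finsupp.linearCombination C (fun k => (B k : K)) ξ) / ϖ ^ M, by
        change v _ ≤ 1
        rwa [map_div₀, map_pow, div_le_one₀ hpos]⟩
      let lam := b.repr (resMap v r)
      let lam' : _ →₀ C := lam.mapRange (fun r => (s r : C)) (by rw [hs0]; rfl)
      have h1 : Finsupp.linearCombination C (fun k => (B k : K)) lam' =
          ((∑ k ∈ lam.support, j (s (lam k)) * B k : v.valuationSubring) : K) := by
        rw [Finsupp.linearCombination_apply, Finsupp.sum_of_support_subset _
          Finsupp.support_mapRange _ (by simp)]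
        push_cast
        refine Finset.sum_congr rfl fun k _ => ?_
        rw [Algebra.smul_def]
        rfl
      have h2 : resMap v (r - ∑ k ∈ lam.support, j (s (lam k)) * B k) = 0 := by
        rw [map_sub, map_sum, sub_eq_zero]
        conv_lhs => rw [← b.linearCombination_repr (resMap v r), Finsupp.linearCombination_apply,
          Finsupp.sum]
        refine Finset.sum_congr rfl fun k _ => ?_
        rw [map_mul, hj, hs, hB, Algebra.smul_def]
        rfl
      rw [resMap_eq_zero_iff] at h2
      have h3 : (r : K) * ϖ ^ M = y - Finsupp.linearCombination C (fun k => (B k : K)) ξ :=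
        div_mul_cancel₀ _ (pow_ne_zero _ hϖ0)
      refine ⟨ξ + π ^ M • lam', fun k => ?_, hπv.le_of_lt ?_⟩
      · refine Valuation.map_add_le _ (hξ k) ?_
        rw [Finsupp.smul_apply, smul_eq_mul, map_mul, map_pow, Finsupp.mapRange_apply]
        exact mul_le_one' (pow_le_one₀ zero_le hπu) (s _).2
      · have h4 : y - Finsupp.linearCombination C (fun k => (B k : K)) (ξ + π ^ M • lam') =
            ((r - ∑ k ∈ lam.support, j (s (lam k)) * B k : v.valuationSubring) : K) * ϖ ^ M := by
          rw [map_add, map_smul, ← sub_sub, ← h3, h1, Algebra.smul_def, map_pow]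
          rw [AddSubgroupClass.coe_sub]
          ring
        rw [h4, map_mul, map_pow]
        exact mul_lt_of_lt_one_left hpos h2

end ResidueBasis

end Paper

namespace Paper

section CoarsePInd

variable {C : Type u} [Field C] {u : Valuation C Zm0} {π : C}
  {K : Type u} [Field K] [Algebra C K] {Γ : Type u} [LinearOrderedCommGroupWithZero Γ]
  {v : Valuation K Γ}

lemma algebraMap_mem_coarse (hKC : (v.comap (algebraMap C K)).IsEquiv u)
    (hπ : u π < 1) (h1 : v (algebraMap C K π) ≤ 1) (x : C) :
    algebraMap C K x ∈ coarse v (algebraMap C K π) h1 := by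
  by_cases hx : x = 0
  · rw [hx, map_zero]
    exact zero_mem _
  · have hux : u x ≠ 0 := (Valuation.ne_zero_iff u).2 hx
    obtain ⟨k, hk⟩ := exists_pow_lt₀ hπ (Units.mk0 (u x)⁻¹ (inv_ne_zero hux))
    refine ⟨k, ?_⟩
    rw [← map_pow, ← map_pow, ← map_mul, ← map_mul]
    refine (hKC.le_one_iff_le_one).2 ?_
    rw [map_mul, map_pow, mul_comm]
    exact (le_mul_inv_iff₀ (zero_lt_iff.2 hux)).1 (by simpa using hk.le)

/-- The embedding of the base field into the residue field of the coarsening. -/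
noncomputable def coarseHom (hKC : (v.comap (algebraMap C K)).IsEquiv u)
    (hπ : u π < 1) (h1 : v (algebraMap C K π) ≤ 1) :
    C →+* IsLocalRing.ResidueField (coarse v (algebraMap C K π) h1) :=
  (IsLocalRing.residue _).comp
    ((algebraMap C K).codRestrict _ (algebraMap_mem_coarse hKC hπ h1))

lemma coarsePlace_coarseHom (hKC : (v.comap (algebraMap C K)).IsEquiv u)
    (hπ : u π < 1) (h1 : v (algebraMap C K π) ≤ 1) (x : C) :
    CoarsePlace h1 (algebraMap C K x) (coarseHom hKC hπ h1 x) :=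
  ⟨algebraMap_mem_coarse hKC hπ h1 x, rfl⟩

lemma lt_one_of_sum_pow_mem (p : ℕ) [ExpChar C p] [ExpChar (ResF u) p]
    (hKC : (v.comap (algebraMap C K)).IsEquiv u) (hπu : u π < 1)
    (hπv : IsUniformizer v (algebraMap C K π))
    (g : ResF u →+* ResF v) (hg : ResCompat u v g) (hP : PInd p g)
    {ι : Type*} [Fintype ι] {c : ι → C}
    (hc : ∃ N : ℕ, ∀ x : ι → C, u (∑ i, c i * x i ^ p) ≤ u π ^ N → ∀ i, u (x i) < 1)
    (Y : ι → K) (hY : ∀ i, v (Y i) ≤ 1)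
    (hsum : ∀ N, v (∑ i, algebraMap C K (c i) * Y i ^ p) ≤ v (algebraMap C K π) ^ N) (i : ι) :
    v (Y i) < 1 := by
  classical
  have : ExpChar K p := expChar_of_injective_algebraMap (algebraMap C K).injective p
  obtain ⟨N, hN⟩ := hc
  obtain ⟨κ, B, hB, hB1, hB2⟩ := exists_residue_basis p hKC hπv hπu.le g hg hP
  set ϖ := algebraMap C K π with hϖ
  have hϖ1 : v ϖ ≤ 1 := hπv.2.1.le
  obtain ⟨k0, hk0⟩ := exists_bound hϖ1 Finset.univ (fun i => algebraMap C K (c i))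
    fun i _ => algebraMap_mem_coarse hKC hπu hϖ1 _
  choose ξ hξ1 hξ2 using fun i => hB2 (k0 + N + 1) (Y i) (hY i)
  let e : ι → K := fun i => Y i - Finsupp.linearCombination C B (ξ i)
  let T : Finset κ := Finset.univ.biUnion fun i => (ξ i).support
  have hlc : ∀ i, Finsupp.linearCombination C B (ξ i) = ∑ k ∈ T, algebraMap C K (ξ i k) * B k := by
    intro i
    rw [Finsupp.linearCombination_apply, Finsupp.sum_of_support_subset _
      (Finset.subset_biUnion_of_mem (fun i => (ξ i).support) (Finset.mem_univ i)) _ (by simp)]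
    simp only [Algebra.smul_def]
    rfl
  have hYe : ∀ i, Y i = ∑ k ∈ T, algebraMap C K (ξ i k) * B k + e i := by
    intro i
    rw [← hlc]
    simp [e]
  have hpow : ∀ i, Y i ^ p = ∑ k ∈ T, algebraMap C K (ξ i k) ^ p * B k ^ p + e i ^ p := by
    intro i
    rw [hYe, add_pow_expChar]
    congr 1
    have := map_sum (frobenius K p) (fun k => algebraMap C K (ξ i k) * B k) T
    simpa only [frobenius_def, mul_pow] using this
  have he : v (∑ i, algebraMap C K (c i) * e i ^ p) ≤ v ϖ ^ N := by
    refine v.map_sum_le fun i _ => mul_le_pow (hk0 i (Finset.mem_univ i) k0 le_rfl) ?_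
    rw [map_pow]
    have h1 : v (e i) ≤ v ϖ ^ (k0 + N) :=
      (hξ2 i).trans (pow_le_pow_right_of_le_one' hϖ1 (Nat.le_succ _))
    exact (pow_le_of_le_one zero_le (h1.trans (pow_le_one₀ zero_le hϖ1))
      (expChar_pos C p).ne').trans h1
  have hdec : ∑ i, algebraMap C K (c i) * Y i ^ p =
      ∑ k ∈ T, algebraMap C K (∑ i, c i * ξ i k ^ p) * B k ^ p +
        ∑ i, algebraMap C K (c i) * e i ^ p := by
    simp only [hpow, mul_add, Finset.sum_add_distrib, map_sum, Finset.mul_sum, Finset.sum_mul]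
    rw [Finset.sum_comm]
    simp only [map_mul, map_pow, mul_assoc]
  have hmain := hB1 T (fun k => ∑ i, c i * ξ i k ^ p) (π ^ N) (by
    rw [map_pow (algebraMap C K), map_pow v, ← hϖ, ← add_sub_cancel_right
      (∑ k ∈ T, algebraMap C K (∑ i, c i * ξ i k ^ p) * B k ^ p)
      (∑ i, algebraMap C K (c i) * e i ^ p), ← hdec]
    exact Valuation.map_sub_le _ (hsum N) he)
  have hlt : ∀ k ∈ T, u (ξ i k) < 1 := fun k hk => hN (fun i => ξ i k) (by
    simpa only [map_pow] using hmain k hk) i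
  rw [hYe]
  refine Valuation.map_add_lt _ (Valuation.map_sum_lt _ one_ne_zero fun k hk => ?_) ?_
  · rw [map_mul]
    exact (mul_le_of_le_one_right' (hB k)).trans_lt ((hKC.lt_one_iff_lt_one).2 (hlt k hk))
  · refine (hξ2 i).trans_lt ?_
    rw [pow_succ]
    exact (mul_le_of_le_one_left' (pow_le_one₀ zero_le hϖ1)).trans_lt hπv.2.1

lemma pInd_coarseHom (p : ℕ) [ExpChar C p] [ExpChar (ResF u) p]
    (hKC : (v.comap (algebraMap C K)).IsEquiv u) (hπu0 : u π ≠ 0) (hπu : u π < 1)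
    (hexc : ExcellentCompletion C u)
    (hπv : IsUniformizer v (algebraMap C K π))
    (g : ResF u →+* ResF v) (hg : ResCompat u v g) (hP : PInd p g) :
    PInd p (coarseHom hKC hπu hπv.2.1.le) := by
  intro m c hc x hx
  have hb := hexc.exists_bound p hπu0 hπu c hc
  choose X hX using fun i => IsLocalRing.residue_surjective (x i)
  set ϖ := algebraMap C K π with hϖ
  have hϖ1 : v ϖ ≤ 1 := hπv.2.1.le
  have hϖ0 : ϖ ≠ 0 := (Valuation.ne_zero_iff v).1 hπv.1.ne'
  have hsum : ∀ N, v (∑ i, algebraMap C K (c i) * (X i : K) ^ p) ≤ v ϖ ^ N := by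
    rw [← coarsePlace_zero_iff hϖ1 hπv.1.ne' hπv.2.1]
    refine ⟨?_, ?_⟩
    · exact sum_mem fun i _ => mul_mem (algebraMap_mem_coarse hKC hπu hϖ1 _) (pow_mem (X i).2 p)
    · rw [← hx]
      have : ∀ i, x i = IsLocalRing.residue _ (X i) := fun i => (hX i).symm
      simp only [this, coarseHom, RingHom.comp_apply, ← map_pow, ← map_mul, ← map_sum]
      congr 1
      apply Subtype.ext
      push_cast
      rfl
  obtain ⟨k0, hk0⟩ := exists_bound hϖ1 Finset.univ (fun i => (X i : K)) fun i _ => (X i).2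
  have key : ∀ k i, v (ϖ ^ k0 * (X i : K)) ≤ v ϖ ^ k := by
    intro k
    induction k with
    | zero =>
      intro i
      rw [pow_zero, mul_comm, map_mul, map_pow]
      exact hk0 i (Finset.mem_univ i) k0 le_rfl
    | succ k ih =>
      intro i
      refine hπv.le_of_lt ?_
      have hpos : 0 < v ϖ ^ k := pow_pos hπv.1 k
      have := lt_one_of_sum_pow_mem p hKC hπu hπv g hg hP hb (fun i => ϖ ^ k0 * (X i : K) / ϖ ^ k)
        (fun i => by
          rw [map_div₀, map_pow v ϖ k, div_le_one₀ hpos]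
          exact ih i) (fun N => by
          have h1 : (∑ i, algebraMap C K (c i) * (ϖ ^ k0 * (X i : K) / ϖ ^ k) ^ p) * (ϖ ^ k) ^ p =
              (ϖ ^ k0) ^ p * ∑ i, algebraMap C K (c i) * (X i : K) ^ p := by
            rw [Finset.sum_mul, Finset.mul_sum]
            refine Finset.sum_congr rfl fun i _ => ?_
            rw [div_pow]
            field_simp
            rw [mul_pow]
            ring
          have h2 := congrArg v h1
          rw [map_mul, map_mul, map_pow, map_pow, map_pow, map_pow] at h2
          refine le_of_mul_le_mul_right (a := (v ϖ ^ k) ^ p) ?_ (pow_pos hpos p)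
          rw [h2]
          calc _ ≤ 1 * v ϖ ^ (N + k * p) := mul_le_mul' (pow_le_one₀ zero_le
                (pow_le_one₀ zero_le hϖ1)) (hsum _)
            _ = _ := by rw [one_mul, pow_add, pow_mul]) i
      rwa [map_div₀, map_pow v ϖ k, div_lt_one₀ hpos] at this
  intro i
  rw [← hX i, residue_coarse_eq_zero_iff hϖ1 hπv.1.ne' hπv.2.1]
  intro k
  have := key (k0 + k) i
  rw [map_mul, map_pow, pow_add] at this
  exact le_of_mul_le_mul_left this (pow_pos hπv.1 k0)

end CoarsePInd

end Paper

namespace Paper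

section CoarseSol

variable {C : Type u} [Field C] {u : Valuation C Zm0} {π : C}
  {K : Type u} [Field K] [Algebra C K] {Γ : Type u} [LinearOrderedCommGroupWithZero Γ]
  {v : Valuation K Γ}

/-- A nonzero valuation comparable with the powers of a uniformizer is a power of it. -/
lemma IsUniformizer.exists_zpow {t : K} (h : IsUniformizer v t) {x : K} {k l : ℕ}
    (hk : ¬ v x ≤ v t ^ k) (hl : v x * v t ^ l ≤ 1) : ∃ j : ℤ, v x = v t ^ j := by
  classical
  have ht0 : v t ≠ 0 := h.1.ne'
  have hex : ∃ m, ¬ v (x * t ^ l) ≤ v t ^ m := by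
    refine ⟨k + l, fun h1 => hk ?_⟩
    rw [map_mul, map_pow, pow_add] at h1
    exact le_of_mul_le_mul_right h1 (pow_pos h.1 l)
  obtain ⟨m, hm⟩ : ∃ m, Nat.find hex = m + 1 := by
    refine Nat.exists_eq_succ_of_ne_zero fun h0 => ?_
    have := Nat.find_spec hex
    rw [h0, pow_zero, map_mul, map_pow] at this
    exact this hl
  have h1 : v (x * t ^ l) ≤ v t ^ m := not_not.1 (Nat.find_min hex (by omega))
  have h2 : ¬ v (x * t ^ l) < v t ^ m := by
    intro h2
    have := Nat.find_spec hex
    rw [hm] at this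
    exact this (h.le_of_lt h2)
  have h3 := le_antisymm h1 (not_lt.1 h2)
  refine ⟨m - l, ?_⟩
  rw [zpow_sub₀ ht0, eq_div_iff (zpow_ne_zero _ ht0), zpow_natCast, zpow_natCast, ← h3, map_mul,
    map_pow]

/-- A solution in `K` yields a solution generating a subfield on which the valuation takes only
powers of the uniformizer. -/
lemma exists_sol_zpow (p : ℕ) [ExpChar C p] [ExpChar (ResF u) p] {n : ℕ} (hR4 : R4N.{u} n)
    (hKC : (v.comap (algebraMap C K)).IsEquiv u) (hπu0 : u π ≠ 0) (hπu : u π < 1)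
    (hexc : ExcellentCompletion C u) (hKhens : IsHenselian v)
    (hπv : IsUniformizer v (algebraMap C K π))
    (g : ResF u →+* ResF v) (hg : ResCompat u v g) (hP : PInd p g)
    {Z : Finset (MvPolynomial (Fin n) C)} {q : MvPolynomial (Fin n) C}
    (h : Sol (algebraMap C K) Z q) :
    ∃ a : Fin n → K, (∀ z ∈ Z, z.eval₂ (algebraMap C K) a = 0) ∧
      q.eval₂ (algebraMap C K) a ≠ 0 ∧
      ∀ y ∈ IntermediateField.adjoin C (Set.range a), y ≠ 0 →
        ∃ j : ℤ, v y = v (algebraMap C K π) ^ j := by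
  set ϖ := algebraMap C K π with hϖ
  have hϖ1 := hπv.2.1.le
  have hϖ0 := hπv.1.ne'
  have hpl := isPlace_coarsePlace hϖ1 hϖ0 hπv.2.1
  have hph := isPlaceHensel_coarsePlace hϖ1 hϖ0 hπv.2.1 hKhens
  have hpi := pInd_coarseHom p hKC hπu0 hπu hexc hπv g hg hP
  let S : Stage.{u} p := ⟨C, K, IsLocalRing.ResidueField (coarse v ϖ hϖ1), algebraMap C K,
    coarseHom hKC hπu hϖ1, CoarsePlace hϖ1, hpl, hph,
    coarsePlace_coarseHom hKC hπu hϖ1, hpi, largeCurve_coarse hϖ1 hϖ0 hπv.2.1 hKhens⟩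
  have hS : Sol (coarseHom hKC hπu hϖ1) Z q :=
    S.sol_residue hR4.r4Sol (fun F _ hF => hF.largeField) h
  obtain ⟨a', hZ, hq⟩ := hS
  obtain ⟨Z', hZ'⟩ : (RingHom.ker (MvPolynomial.eval₂Hom (coarseHom hKC hπu hϖ1) a')).FG :=
    IsNoetherian.noetherian _
  obtain ⟨a, ha, haZ⟩ := hpl.exists_lift hph (coarsePlace_coarseHom hKC hπu hϖ1) hpi a' Z'
    fun z hz => by
      have : z ∈ Ideal.span (Z' : Set _) := Ideal.subset_span hz
      rw [hZ'] at this
      exact this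
  have hker : ∀ P : MvPolynomial (Fin n) C, P.eval₂ (coarseHom hKC hπu hϖ1) a' = 0 →
      P.eval₂ (algebraMap C K) a = 0 := by
    intro P hP
    have h1 : Ideal.span (Z' : Set _) ≤ RingHom.ker (MvPolynomial.eval₂Hom (algebraMap C K) a) :=
      Ideal.span_le.2 haZ
    rw [hZ'] at h1
    exact h1 hP
  choose hmem hres using ha
  have hP : ∀ P : MvPolynomial (Fin n) C, ∃ hm : P.eval₂ (algebraMap C K) a ∈ coarse v ϖ hϖ1,
      IsLocalRing.residue (coarse v ϖ hϖ1) ⟨_, hm⟩ = P.eval₂ (coarseHom hKC hπu hϖ1) a' := by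
    intro P
    let A : Fin n → coarse v ϖ hϖ1 := fun i => ⟨a i, hmem i⟩
    let f : C →+* coarse v ϖ hϖ1 :=
      (algebraMap C K).codRestrict _ (algebraMap_mem_coarse hKC hπu hϖ1)
    have h1 : ((P.eval₂ f A : coarse v ϖ hϖ1) : K) = P.eval₂ (algebraMap C K) a :=
      MvPolynomial.hom_eval₂ P f (coarse v ϖ hϖ1).subtype A
    have h2 : IsLocalRing.residue _ (P.eval₂ f A) = P.eval₂ (coarseHom hKC hπu hϖ1) a' := by
      rw [MvPolynomial.hom_eval₂, show a' = _ from (funext hres).symm]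
      rfl
    refine ⟨h1 ▸ (P.eval₂ f A).2, ?_⟩
    rw [← h2]
    congr 1
    exact Subtype.ext h1.symm
  have hpow : ∀ P : MvPolynomial (Fin n) C, P.eval₂ (algebraMap C K) a ≠ 0 →
      ∃ j : ℤ, v (P.eval₂ (algebraMap C K) a) = v ϖ ^ j := by
    intro P h0
    obtain ⟨hm, hr⟩ := hP P
    obtain ⟨l, hl⟩ := id hm
    have h1 : ¬ CoarsePlace hϖ1 (P.eval₂ (algebraMap C K) a) 0 := by
      rintro ⟨hm', hr'⟩
      exact h0 (hker P (hr.symm.trans hr'))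
    rw [coarsePlace_zero_iff hϖ1 hϖ0 hπv.2.1] at h1
    push Not at h1
    obtain ⟨k, hk⟩ := h1
    exact hπv.exists_zpow hk.not_ge hl
  refine ⟨a, fun z hz => hker z (hZ z hz), fun h0 => ?_, fun y hy hy0 => ?_⟩
  · obtain ⟨hm, hr⟩ := hP q
    apply hq
    rw [← hr]
    have : (⟨_, hm⟩ : coarse v ϖ hϖ1) = 0 := Subtype.ext h0
    rw [this, map_zero]
  · rw [IntermediateField.mem_adjoin_range_iff] at hy
    obtain ⟨r, s, rfl⟩ := hy
    rw [div_ne_zero_iff] at hy0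
    obtain ⟨j1, h1⟩ := hpow r hy0.1
    obtain ⟨j2, h2⟩ := hpow s hy0.2
    refine ⟨j1 - j2, ?_⟩
    rw [zpow_sub₀ hϖ0, ← h1, ← h2, map_div₀]
    rfl

end CoarseSol

end Paper

namespace Paper

open Polynomial

section Sections

/-- Coefficient fields exist along a nilpotent thickening of a formally smooth extension. -/
lemma PInd.exists_section {k : Type u} {E : Type v} {B : Type w} [Field k] [Field E] [CommRing B]
    {p : ℕ} [ExpChar k p] {g : k →+* E} (hg : PInd p g) (α : k →+* B) (r : B →+* E)
    (hr : Function.Surjective r) (hn : IsNilpotent (RingHom.ker r)) (hα : r.comp α = g) :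
    ∃ s : E →+* B, r.comp s = RingHom.id E ∧ s.comp g = α := by
  let _ : Algebra k E := g.toAlgebra
  let _ : Algebra k B := α.toAlgebra
  have : Algebra.FormallySmooth k E := PInd.formallySmooth (p := p) hg
  let r' : B →ₐ[k] E := { r with commutes' := fun x => RingHom.congr_fun hα x }
  have hr' : RingHom.ker r' = RingHom.ker r := rfl
  let s := Algebra.FormallySmooth.liftOfSurjective (AlgHom.id k E) r' hr hn
  refine ⟨s, RingHom.ext fun x => ?_, RingHom.ext fun x => s.commutes x⟩
  exact Algebra.FormallySmooth.liftOfSurjective_apply (AlgHom.id k E) r' hr hn x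

lemma PInd.of_surjective_pow {k : Type u} {E : Type v} [Field k] [Field E] (p : ℕ) [ExpChar k p]
    (hk : Function.Surjective fun x : k => x ^ p) (g : k →+* E) : PInd p g := by
  classical
  intro m c hc x hx
  have hc0 : ∀ i, c i ≠ 0 := by
    intro i h0
    have := hc (Pi.single i 1) (by
      refine Finset.sum_eq_zero fun j _ => ?_
      by_cases h : j = i
      · rw [h, h0, zero_mul]
      · rw [Pi.single_eq_of_ne h, zero_pow (expChar_pos k p).ne', mul_zero]) i
    simp at this
  choose d hd using hk
  have hm : ∀ i j : Fin m, i = j := by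
    intro i j
    by_contra hij
    have h1 := hc (Pi.single i 1 + Pi.single j (d (-(c i / c j)))) (by
      rw [Fintype.sum_eq_add i j hij]
      · simp only [Pi.add_apply, Pi.single_eq_same, Pi.single_eq_of_ne hij,
          Pi.single_eq_of_ne (Ne.symm hij), add_zero, zero_add, one_pow]
        have := hd (-(c i / c j))
        simp only at this
        rw [this]
        field_simp [hc0 j]
        ring
      · rintro l ⟨h1, h2⟩
        simp only [Pi.add_apply, Pi.single_eq_of_ne h1, Pi.single_eq_of_ne h2, add_zero]
        rw [zero_pow (expChar_pos k p).ne', mul_zero]) i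
    simp [Pi.single_eq_of_ne hij] at h1
  intro i
  rw [Finset.sum_eq_single i (fun j _ h => (h (hm j i)).elim) (by simp)] at hx
  have h1 : g (c i) ≠ 0 := by simpa using hc0 i
  exact pow_eq_zero_iff (expChar_pos k p).ne' |>.1 ((mul_eq_zero.1 hx).resolve_left h1)

end Sections

section Digits

variable {B : Type u} [CommRing B] {E : Type v} [CommRing E]

lemma exists_digits {r : B →+* E} {s : E →+* B} {t : B} (hrs : ∀ x, r (s x) = x)
    (hker : ∀ x, r x = 0 → t ∣ x) (m : ℕ) (e : B) :
    ∃ P : E[X], t ^ m ∣ e - P.eval₂ s t := by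
  induction m with
  | zero => exact ⟨0, by simp⟩
  | succ m ih =>
    obtain ⟨P, c, hc⟩ := ih
    obtain ⟨d, hd⟩ := hker (c - s (r c)) (by rw [map_sub, hrs, sub_self])
    refine ⟨P + C (r c) * X ^ m, d, ?_⟩
    rw [eval₂_add, eval₂_mul, eval₂_C, eval₂_X_pow, ← sub_sub, hc, pow_succ, mul_assoc, ← hd]
    ring

lemma exists_digits_eq {r : B →+* E} {s : E →+* B} {t : B} (hrs : ∀ x, r (s x) = x)
    (hker : ∀ x, r x = 0 → t ∣ x) {m : ℕ} (hm : t ^ m = 0) (e : B) :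
    ∃ P : E[X], P.eval₂ s t = e := by
  obtain ⟨P, hP⟩ := exists_digits hrs hker m e
  rw [hm, zero_dvd_iff, sub_eq_zero] at hP
  exact ⟨P, hP.symm⟩

end Digits

section Transfer

variable {k BC BE BL E l : Type*} [CommRing k] [CommRing BC] [CommRing BE] [CommRing BL]
  [CommRing E] [CommRing l]

/-- Truncated solutions transfer along a specialization of the finitely many digits involved. -/
lemma exists_transfer {tC : BC} {tE : BE} {tL : BL} {ρE : BC →+* BE} {ρL : BC →+* BL}
    (hE : ρE tC = tE) (hL : ρL tC = tL) {N : ℕ} (htL : tL ^ N = 0)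
    {gE : k →+* E} {gL : k →+* l} {sC : k →+* BC} {sE : E →+* BE} {sL : l →+* BL}
    (hsE : sE.comp gE = ρE.comp sC) (hsL : sL.comp gL = ρL.comp sC)
    (hdC : ∀ e : BC, ∃ P : k[X], P.eval₂ sC tC = e)
    (hdE : ∀ e : BE, ∃ P : E[X], P.eval₂ sE tE = e)
    (hzE : ∀ P : E[X], P.eval₂ sE tE = 0 → ∀ i < N, P.coeff i = 0)
    (hres : ∀ s : Finset E, ∃ (A : Type u) (_ : CommRing A) (j : k →+* A) (ψE : A →+* E)
      (ψL : A →+* l), ψE.comp j = gE ∧ ψL.comp j = gL ∧ (∀ a, ψE a = 0 → ψL a = 0) ∧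
        ∀ c ∈ s, ∃ a, ψE a = c)
    {ι : Type*} [Finite ι] (e : ι → BE) :
    ∃ e' : ι → BL, ∀ G : MvPolynomial ι BC, G.eval₂ ρE e = 0 → G.eval₂ ρL e' = 0 := by
  classical
  have := Fintype.ofFinite ι
  choose P hP using fun i => hdE (e i)
  obtain ⟨A, _, j, ψE, ψL, h1, h2, h3, h4⟩ := hres (Finset.univ.biUnion fun i => (P i).coeffs)
  have hQ : ∀ i, ∃ Q : A[X], Q.map ψE = P i := by
    intro i
    have : P i ∈ lifts ψE := by
      rw [lifts_iff_coeff_lifts]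
      intro m
      by_cases hm : (P i).coeff m = 0
      · exact ⟨0, by rw [hm, map_zero]⟩
      · exact h4 _ (Finset.mem_biUnion.2 ⟨i, Finset.mem_univ i, coeff_mem_coeffs hm⟩)
    exact (mem_lifts _).1 this
  choose Q hQ using hQ
  let ΦE : A[X] →+* BE := eval₂RingHom (sE.comp ψE) tE
  let ΦL : A[X] →+* BL := eval₂RingHom (sL.comp ψL) tL
  have hΦ : ∀ R : A[X], ΦE R = 0 → ΦL R = 0 := by
    intro R hR
    have hR' : (R.map ψE).eval₂ sE tE = 0 := by rwa [eval₂_map]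
    have hc := hzE _ hR'
    change R.eval₂ (sL.comp ψL) tL = 0
    rw [eval₂_eq_sum_range]
    refine Finset.sum_eq_zero fun i _ => ?_
    by_cases hi : i < N
    · have := hc i hi
      rw [coeff_map] at this
      rw [RingHom.comp_apply, h3 _ this, map_zero, zero_mul]
    · obtain ⟨m, rfl⟩ := Nat.exists_eq_add_of_le (not_lt.1 hi)
      rw [pow_add, htL, zero_mul, mul_zero]
  refine ⟨fun i => ΦL (Q i), fun G hG => ?_⟩
  let θ : k[X] →+* BC := eval₂RingHom sC tC
  obtain ⟨G0, rfl⟩ := MvPolynomial.map_surjective θ hdC G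
  have e1 : ρE.comp θ = ΦE.comp (mapRingHom j) := by
    refine Polynomial.ringHom_ext (fun a => ?_) ?_
    · have h5 := RingHom.congr_fun hsE a
      have h6 := RingHom.congr_fun h1 a
      simp only [RingHom.comp_apply] at h5 h6
      simp [θ, ΦE, h6, h5]
    · simp [θ, ΦE, hE]
  have e2 : ρL.comp θ = ΦL.comp (mapRingHom j) := by
    refine Polynomial.ringHom_ext (fun a => ?_) ?_
    · have h5 := RingHom.congr_fun hsL a
      have h6 := RingHom.congr_fun h2 a
      simp only [RingHom.comp_apply] at h5 h6
      simp [θ, ΦL, h6, h5]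
    · simp [θ, ΦL, hL]
  have e3 : e = fun i => ΦE (Q i) := by
    funext i
    rw [← hP i, ← hQ i, eval₂_map]
    rfl
  rw [MvPolynomial.eval₂_map] at hG ⊢
  rw [e2]
  rw [e1, e3] at hG
  have := hΦ (G0.eval₂ (mapRingHom j) Q) (by rwa [MvPolynomial.hom_eval₂])
  rwa [MvPolynomial.hom_eval₂] at this

end Transfer

end Paper

namespace Paper

section Specialization

variable {k E R l : Type u} [Field k] [Field E] [Field R] [Field l]

/-- An existential transfer in `n` variables specializes finitely many elements of an extension of
transcendence degree less than `n`. -/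
lemma PInd.exists_specialization [Algebra k E] {p : ℕ} [ExpChar k p]
    (hp : PInd p (algebraMap k E)) (κ : E →+* R) (gL : k →+* l) {n : ℕ}
    (hsol : ∀ (Z : Finset (MvPolynomial (Fin n) k)) (q : MvPolynomial (Fin n) k),
      Sol (κ.comp (algebraMap k E)) Z q → Sol gL Z q)
    (htr : ∀ (d : ℕ) (T : Fin d → E), AlgebraicIndependent k T → d < n) (s : Finset E) :
    ∃ (A : Type u) (_ : CommRing A) (j : k →+* A) (ψE : A →+* E)
      (ψL : A →+* l), ψE.comp j = algebraMap k E ∧ ψL.comp j = gL ∧ (∀ a, ψE a = 0 → ψL a = 0) ∧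
        ∀ c ∈ s, ∃ a, ψE a = c := by
  classical
  obtain ⟨d, T, y, hT, -, ha, -, -⟩ := hp.exists_sep_generators (fun i : s => (i : E))
  have hd := htr d T hT
  let b : Fin n → E := fun i => if h : (i : ℕ) < d then T ⟨i, h⟩ else y
  have hbT : ∀ i, T i ∈ IntermediateField.adjoin k (Set.range b) := fun i =>
    IntermediateField.subset_adjoin _ _ ⟨⟨i, i.2.trans hd⟩, by simp [b]⟩
  have hby : y ∈ IntermediateField.adjoin k (Set.range b) :=
    IntermediateField.subset_adjoin _ _ ⟨⟨d, hd⟩, by simp [b]⟩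
  have hab : ∀ c ∈ s, c ∈ IntermediateField.adjoin k (Set.range b) := by
    intro c hc
    have h1 := ha ⟨c, hc⟩
    have h2 : IntermediateField.adjoin k (Set.range T) ≤ IntermediateField.adjoin k (Set.range b) :=
      IntermediateField.adjoin_le_iff.2 (by rintro _ ⟨i, rfl⟩; exact hbT i)
    let M : IntermediateField (IntermediateField.adjoin k (Set.range T)) E :=
      IntermediateField.extendScalars h2
    have h3 : IntermediateField.adjoin (IntermediateField.adjoin k (Set.range T)) {y} ≤ M :=
      IntermediateField.adjoin_le_iff.2 (by
        rintro _ rfl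
        exact hby)
    exact h3 h1
  have hfrac : ∀ c ∈ s, ∃ r t : MvPolynomial (Fin n) k, t.eval₂ (algebraMap k E) b ≠ 0 ∧
      c * t.eval₂ (algebraMap k E) b = r.eval₂ (algebraMap k E) b := by
    intro c hc
    obtain ⟨r, t, h⟩ := (IntermediateField.mem_adjoin_range_iff k b c).1 (hab c hc)
    by_cases ht : MvPolynomial.aeval b t = 0
    · rw [ht, div_zero] at h
      exact ⟨0, 1, by simp, by simp [h]⟩
    · exact ⟨r, t, ht, (div_eq_iff ht).1 h.symm |>.symm ▸ rfl⟩
  choose! r t ht hrt using hfrac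
  let q : MvPolynomial (Fin n) k := ∏ c ∈ s, t c
  have hq : q.eval₂ (algebraMap k E) b ≠ 0 := by
    rw [← MvPolynomial.coe_eval₂Hom, map_prod]
    exact Finset.prod_ne_zero_iff.2 ht
  obtain ⟨Z, hZ⟩ : (RingHom.ker (MvPolynomial.eval₂Hom (algebraMap k E) b)).FG :=
    IsNoetherian.noetherian _
  have hsolK : Sol (κ.comp (algebraMap k E)) Z q := by
    refine Sol.map (φ := algebraMap k E) ⟨b, fun z hz => ?_, hq⟩ κ κ.injective
    have : z ∈ Ideal.span (Z : Set _) := Ideal.subset_span hz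
    rw [hZ] at this
    exact this
  obtain ⟨b', hZ', hq'⟩ := hsol Z q hsolK
  have hker : ∀ P : MvPolynomial (Fin n) k, P.eval₂ (algebraMap k E) b = 0 →
      P.eval₂ gL b' = 0 := by
    intro P hP
    have h1 : Ideal.span (Z : Set _) ≤ RingHom.ker (MvPolynomial.eval₂Hom gL b') :=
      Ideal.span_le.2 hZ'
    rw [hZ] at h1
    exact h1 hP
  let A := Localization.Away q
  have huE : IsUnit (MvPolynomial.eval₂Hom (algebraMap k E) b q) := IsUnit.mk0 _ hq
  have huL : IsUnit (MvPolynomial.eval₂Hom gL b' q) := IsUnit.mk0 _ hq'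
  let ψE : A →+* E := IsLocalization.Away.lift q huE
  let ψL : A →+* l := IsLocalization.Away.lift q huL
  have hψE : ∀ P, ψE (algebraMap (MvPolynomial (Fin n) k) A P) = P.eval₂ (algebraMap k E) b := fun P =>
    IsLocalization.Away.lift_eq q huE P
  have hψL : ∀ P, ψL (algebraMap (MvPolynomial (Fin n) k) A P) = P.eval₂ gL b' := fun P =>
    IsLocalization.Away.lift_eq q huL P
  refine ⟨A, inferInstance, (algebraMap (MvPolynomial (Fin n) k) A).comp MvPolynomial.C, ψE, ψL, ?_, ?_, ?_, ?_⟩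
  · ext c
    simp [hψE]
  · ext c
    simp [hψL]
  · intro a h0
    obtain ⟨m, P, hP⟩ := IsLocalization.Away.surj q a
    have h1 := congrArg ψE hP
    have h2 := congrArg ψL hP
    rw [map_mul, h0, zero_mul, hψE] at h1
    rw [hψL, hker P h1.symm, map_mul, map_pow, hψL] at h2
    exact (mul_eq_zero.1 h2).resolve_right (pow_ne_zero _ hq')
  · intro c hc
    refine ⟨algebraMap (MvPolynomial (Fin n) k) A (r c * ∏ c' ∈ s.erase c, t c') *
      IsLocalization.Away.invSelf q, ?_⟩
    have h1 : ψE (IsLocalization.Away.invSelf q) * q.eval₂ (algebraMap k E) b = 1 := by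
      rw [← hψE, ← map_mul, mul_comm, IsLocalization.Away.mul_invSelf, map_one]
    have h2 : (r c * ∏ c' ∈ s.erase c, t c').eval₂ (algebraMap k E) b =
        c * q.eval₂ (algebraMap k E) b := by
      rw [MvPolynomial.eval₂_mul, ← hrt c hc, mul_assoc, ← MvPolynomial.eval₂_mul,
        Finset.mul_prod_erase s t hc]
    rw [map_mul, hψE, h2, mul_assoc, mul_comm (MvPolynomial.eval₂ _ _ q), h1, mul_one]

end Specialization

end Paper

namespace Paper

open Polynomial

section LocalTransfer

open IsLocalRing

lemma residue_eq_of_mk_eq {O : Type*} [CommRing O] [IsLocalRing O] {T : O} (hT : residue O T = 0)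
    {N : ℕ} (hN : N ≠ 0) {x y : O}
    (h : Ideal.Quotient.mk (Ideal.span {T ^ N}) x = Ideal.Quotient.mk _ y) :
    residue O x = residue O y := by
  rw [Ideal.Quotient.eq, Ideal.mem_span_singleton] at h
  obtain ⟨c, hc⟩ := h
  have := congrArg (residue O) hc
  rw [map_mul, map_pow, hT, zero_pow hN, zero_mul, map_sub, sub_eq_zero] at this
  exact this

lemma PInd.exists_truncSection {O : Type u} [CommRing O] [IsDomain O] [IsLocalRing O] {T : O}
    (hT0 : T ≠ 0) (hT : residue O T = 0) (hT' : ∀ x, residue O x = 0 → T ∣ x) {N : ℕ} (hN : N ≠ 0)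
    {k : Type v} [Field k] {p : ℕ} [ExpChar k p] {g : k →+* ResidueField O} (hg : PInd p g)
    (α : k →+* O ⧸ Ideal.span {T ^ N})
    (hα : ∀ c x, Ideal.Quotient.mk _ x = α c → residue O x = g c) :
    ∃ s : ResidueField O →+* O ⧸ Ideal.span {T ^ N},
      (∀ c x, Ideal.Quotient.mk _ x = s c → residue O x = c) ∧ s.comp g = α ∧
      (∀ e, ∃ P : (ResidueField O)[X], P.eval₂ s (Ideal.Quotient.mk _ T) = e) ∧
      ∀ P : (ResidueField O)[X], P.eval₂ s (Ideal.Quotient.mk _ T) = 0 →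
        ∀ i < N, P.coeff i = 0 := by
  let I : Ideal O := Ideal.span {T ^ N}
  let r : O ⧸ I →+* ResidueField O := Ideal.Quotient.lift I (residue O) (fun a ha => by
    obtain ⟨c, rfl⟩ := Ideal.mem_span_singleton.1 ha
    rw [map_mul, map_pow, hT, zero_pow hN, zero_mul])
  have hr : ∀ x, r (Ideal.Quotient.mk I x) = residue O x := fun x => rfl
  have hrs : Function.Surjective r := fun c => by
    obtain ⟨x, rfl⟩ := residue_surjective c
    exact ⟨Ideal.Quotient.mk I x, rfl⟩
  have hker : ∀ x, r x = 0 → Ideal.Quotient.mk I T ∣ x := by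
    intro x hx
    obtain ⟨x, rfl⟩ := Ideal.Quotient.mk_surjective x
    exact map_dvd _ (hT' x hx)
  have htN : Ideal.Quotient.mk I T ^ N = 0 := by
    rw [← map_pow, Ideal.Quotient.eq_zero_iff_mem]
    exact Ideal.subset_span rfl
  have hnil : IsNilpotent (RingHom.ker r) := by
    refine ⟨N, le_bot_iff.1 ((Ideal.pow_right_mono
      (show RingHom.ker r ≤ Ideal.span {Ideal.Quotient.mk I T} from
        fun x hx => Ideal.mem_span_singleton.2 (hker x hx)) N).trans ?_)⟩
    rw [Ideal.span_singleton_pow, htN, Ideal.span_singleton_eq_bot.2 rfl]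
  obtain ⟨s, h1, h2⟩ := hg.exists_section α r hrs hnil (RingHom.ext fun c => by
    obtain ⟨x, hx⟩ := Ideal.Quotient.mk_surjective (α c)
    rw [RingHom.comp_apply, ← hx, hr]
    exact hα c x hx)
  refine ⟨s, fun c x h => ?_, h2,
    exists_digits_eq (fun x => RingHom.congr_fun h1 x) hker htN, fun P hP i => ?_⟩
  · rw [← hr]
    exact (congrArg r h).trans (RingHom.congr_fun h1 c)
  · induction i using Nat.strong_induction_on with
    | _ i ih =>
      intro hi
      obtain ⟨Q, rfl⟩ := X_pow_dvd_iff.2 fun j hj => ih j hj (hj.trans hi)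
      obtain ⟨z, hz⟩ := Ideal.Quotient.mk_surjective (Q.eval₂ s (Ideal.Quotient.mk I T))
      rw [eval₂_mul, eval₂_X_pow] at hP
      rw [coeff_X_pow_mul', if_pos le_rfl, Nat.sub_self]
      have h3 : residue O z = Q.coeff 0 := by
        rw [← hr, hz, hom_eval₂, h1, hr, hT, eval₂_at_zero]
        rfl
      rw [← h3]
      have h4 : Ideal.Quotient.mk I (T ^ i * z) = 0 := by
        rw [map_mul, map_pow, hz]
        exact hP
      rw [Ideal.Quotient.eq_zero_iff_mem, Ideal.mem_span_singleton] at h4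
      obtain ⟨m, rfl⟩ := Nat.exists_eq_add_of_lt hi
      rw [add_assoc, pow_add] at h4
      obtain ⟨c, rfl⟩ := (mul_dvd_mul_iff_left (pow_ne_zero i hT0)).1 h4
      rw [map_mul, map_pow, hT, zero_pow (Nat.succ_ne_zero m), zero_mul]

variable {OC OE OL : Type u} [CommRing OC] [IsDomain OC] [IsLocalRing OC]
  [CommRing OE] [IsDomain OE] [IsLocalRing OE] [CommRing OL] [IsDomain OL] [IsLocalRing OL]

/-- Transfer of truncated solutions between unramified extensions of discrete valuation rings. -/
lemma exists_local_transfer {k : Type v} [Field k] {p : ℕ} [ExpChar k p]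
    [ExpChar (ResidueField OC) p] (i : k →+* OC) (hi : PInd p ((residue OC).comp i))
    {TC : OC} {iE : OC →+* OE} {iL : OC →+* OL} (hC0 : TC ≠ 0) (hE0 : iE TC ≠ 0) (hL0 : iL TC ≠ 0)
    (hC : residue OC TC = 0) (hE : residue OE (iE TC) = 0) (hL : residue OL (iL TC) = 0)
    (hC' : ∀ x, residue OC x = 0 → TC ∣ x) (hE' : ∀ x, residue OE x = 0 → iE TC ∣ x)
    (hL' : ∀ x, residue OL x = 0 → iL TC ∣ x)
    {gE : ResidueField OC →+* ResidueField OE} {gL : ResidueField OC →+* ResidueField OL}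
    (hgE : ∀ x, gE (residue OC x) = residue OE (iE x))
    (hgL : ∀ x, gL (residue OC x) = residue OL (iL x))
    (hpE : PInd p gE) (hpL : PInd p gL)
    (hres : ∀ s : Finset (ResidueField OE), ∃ (A : Type u) (_ : CommRing A)
      (j : ResidueField OC →+* A) (ψE : A →+* ResidueField OE)
      (ψL : A →+* ResidueField OL), ψE.comp j = gE ∧ ψL.comp j = gL ∧
        (∀ a, ψE a = 0 → ψL a = 0) ∧ ∀ c ∈ s, ∃ a, ψE a = c)
    {ι : Type*} [Finite ι] (e : ι → OE) {N : ℕ} (hN : N ≠ 0) :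
    ∃ e' : ι → OL, ∀ G : MvPolynomial ι OC,
      iE TC ^ N ∣ G.eval₂ iE e → iL TC ^ N ∣ G.eval₂ iL e' := by
  let mC := Ideal.Quotient.mk (Ideal.span {TC ^ N})
  let mE := Ideal.Quotient.mk (Ideal.span {iE TC ^ N})
  let mL := Ideal.Quotient.mk (Ideal.span {iL TC ^ N})
  let ρE : OC ⧸ Ideal.span {TC ^ N} →+* OE ⧸ Ideal.span {iE TC ^ N} :=
    Ideal.Quotient.lift _ (mE.comp iE) (fun a ha => by
      obtain ⟨c, rfl⟩ := Ideal.mem_span_singleton.1 ha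
      rw [RingHom.comp_apply, map_mul, map_pow, Ideal.Quotient.eq_zero_iff_mem]
      exact Ideal.mul_mem_right _ _ (Ideal.subset_span rfl))
  let ρL : OC ⧸ Ideal.span {TC ^ N} →+* OL ⧸ Ideal.span {iL TC ^ N} :=
    Ideal.Quotient.lift _ (mL.comp iL) (fun a ha => by
      obtain ⟨c, rfl⟩ := Ideal.mem_span_singleton.1 ha
      rw [RingHom.comp_apply, map_mul, map_pow, Ideal.Quotient.eq_zero_iff_mem]
      exact Ideal.mul_mem_right _ _ (Ideal.subset_span rfl))
  have hρE : ∀ x, ρE (mC x) = mE (iE x) := fun x => rfl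
  have hρL : ∀ x, ρL (mC x) = mL (iL x) := fun x => rfl
  obtain ⟨sC, hsC, -, hdC, -⟩ := hi.exists_truncSection hC0 hC hC' hN (mC.comp i)
    fun c x h => residue_eq_of_mk_eq hC hN h
  obtain ⟨sE, hsE, hsE', hdE, hzE⟩ := hpE.exists_truncSection hE0 hE hE' hN (ρE.comp sC)
    fun c x h => by
      obtain ⟨y, hy⟩ := Ideal.Quotient.mk_surjective (sC c)
      rw [← hsC c y hy, hgE]
      rw [RingHom.comp_apply, ← hy] at h
      exact residue_eq_of_mk_eq hE hN h
  obtain ⟨sL, hsL, hsL', hdL, -⟩ := hpL.exists_truncSection hL0 hL hL' hN (ρL.comp sC)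
    fun c x h => by
      obtain ⟨y, hy⟩ := Ideal.Quotient.mk_surjective (sC c)
      rw [← hsC c y hy, hgL]
      rw [RingHom.comp_apply, ← hy] at h
      exact residue_eq_of_mk_eq hL hN h
  have htL : mL (iL TC) ^ N = 0 := (map_pow mL (iL TC) N).symm.trans
    (Ideal.Quotient.eq_zero_iff_mem.2 (Ideal.subset_span rfl))
  obtain ⟨e', he'⟩ := exists_transfer (hρE TC) (hρL TC) htL hsE' hsL' hdC hdE hzE hres
    (fun j => mE (e j))
  choose f hf using fun j => Ideal.Quotient.mk_surjective (e' j)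
  refine ⟨f, fun G hG => ?_⟩
  have h1 := he' (G.map mC) (by
    rw [MvPolynomial.eval₂_map, show ρE.comp mC = mE.comp iE from rfl,
      ← MvPolynomial.hom_eval₂,
      Ideal.Quotient.eq_zero_iff_mem, Ideal.mem_span_singleton]
    exact hG)
  rw [MvPolynomial.eval₂_map, show ρL.comp mC = mL.comp iL from rfl,
    show e' = fun j => mL (f j) from (funext hf).symm, ← MvPolynomial.hom_eval₂,
    Ideal.Quotient.eq_zero_iff_mem, Ideal.mem_span_singleton] at h1
  exact h1

end LocalTransfer

end Paper

namespace Paper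

open Polynomial

section PrimeField

/-- An equicharacteristic valuation ring contains a perfect field. -/
lemma exists_primeField {C : Type u} [Field C] (u : Valuation C Zm0) (p : ℕ) [ExpChar C p]
    [ExpChar (ResF u) p] : ∃ (k : Type) (_ : Field k) (_ : ExpChar k p)
      (i : k →+* u.valuationSubring), PInd p ((resMap u).comp i) := by
  rcases ‹ExpChar C p› with _ | hp
  · have : CharZero (ResF u) := by
      have h := ‹ExpChar (ResF u) 1›
      generalize hq : 1 = q at h
      cases h with
      | zero => assumption
      | prime hq' => exact (hq'.ne_one hq.symm).elim
    have hmem : ∀ r : ℚ, u (r : C) ≤ 1 := by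
      intro r
      have h1 : u (r.den : C) = 1 := by
        have h2 : u (r.den : C) ≤ 1 := (r.den : u.valuationSubring).2
        refine le_antisymm h2 (not_lt.1 fun h3 => ?_)
        have h4 := (resMap_eq_zero_iff u (r.den : u.valuationSubring)).2 h3
        rw [map_natCast] at h4
        exact r.den_nz (by exact_mod_cast h4)
      rw [Rat.cast_def, map_div₀, h1, div_one]
      exact (r.num : u.valuationSubring).2
    let i : ℚ →+* u.valuationSubring := (Rat.castHom C).codRestrict _ hmem
    exact ⟨ℚ, inferInstance, inferInstance, i,
      PInd.of_surjective_pow 1 (fun x => ⟨x, pow_one x⟩) _⟩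
  · have : Fact p.Prime := ⟨hp⟩
    have : CharP u.valuationSubring p :=
      RingHom.charP u.valuationSubring.subtype Subtype.val_injective p
    exact ⟨ZMod p, inferInstance, inferInstance, ZMod.castHom dvd_rfl _,
      PInd.of_surjective_pow p (fun x => ⟨x, ZMod.pow_card x⟩) _⟩

end PrimeField

section Units

open IsLocalRing

lemma exists_transfer_units {OC : Type u} {OE : Type v} {OL : Type w} [CommRing OC] [CommRing OE]
    [CommRing OL] [IsLocalRing OL] {TC : OC} {iE : OC →+* OE} {iL : OC →+* OL}
    (hL : residue OL (iL TC) = 0)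
    (H : ∀ (ι : Type) [Finite ι] (e : ι → OE) (N : ℕ), N ≠ 0 → ∃ e' : ι → OL,
      ∀ G : MvPolynomial ι OC, iE TC ^ N ∣ G.eval₂ iE e → iL TC ^ N ∣ G.eval₂ iL e')
    {ι κ : Type} [Finite ι] [Finite κ] (e : ι → OE) (G : κ → MvPolynomial ι OC) (m : κ → ℕ)
    (U : κ → OEˣ) (hG : ∀ j, (G j).eval₂ iE e = iE TC ^ m j * U j) {N : ℕ} (hN : N ≠ 0) :
    ∃ e' : ι → OL, (∀ G : MvPolynomial ι OC, iE TC ^ N ∣ G.eval₂ iE e →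
      iL TC ^ N ∣ G.eval₂ iL e') ∧
      ∀ j, ∃ U' : OLˣ, iL TC ^ N ∣ (G j).eval₂ iL e' - iL TC ^ m j * U' := by
  obtain ⟨f, hf⟩ := H (ι ⊕ κ ⊕ κ) (Sum.elim e (Sum.elim (fun j => U j) fun j => ↑(U j)⁻¹)) N hN
  refine ⟨fun j => f (Sum.inl j), fun G hG => ?_, fun j => ?_⟩
  · have := hf (MvPolynomial.rename Sum.inl G) (by
      rw [MvPolynomial.eval₂_rename]
      exact hG)
    rwa [MvPolynomial.eval₂_rename] at this
  · have h1 := hf (MvPolynomial.X (Sum.inr (Sum.inl j)) * MvPolynomial.X (Sum.inr (Sum.inr j)) - 1)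
      (by simp)
    have h2 := hf (MvPolynomial.rename Sum.inl (G j) -
      MvPolynomial.C (TC ^ m j) * MvPolynomial.X (Sum.inr (Sum.inl j))) (by
        rw [MvPolynomial.eval₂_sub, MvPolynomial.eval₂_rename, MvPolynomial.eval₂_mul,
          MvPolynomial.eval₂_C, MvPolynomial.eval₂_X, Sum.elim_comp_inl, hG, map_pow]
        simp)
    have h3 : IsUnit (f (Sum.inr (Sum.inl j))) := by
      rw [MvPolynomial.eval₂_sub, MvPolynomial.eval₂_mul, MvPolynomial.eval₂_X,
        MvPolynomial.eval₂_X, MvPolynomial.eval₂_one] at h1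
      obtain ⟨c, hc⟩ := h1
      have h4 := congrArg (residue OL) hc
      rw [map_mul, map_pow, hL, zero_pow hN, zero_mul, map_sub, map_one, sub_eq_zero, map_mul] at h4
      exact (residue_ne_zero_iff_isUnit _).1 (left_ne_zero_of_mul_eq_one h4)
    obtain ⟨U', hU'⟩ := h3
    refine ⟨U', ?_⟩
    rwa [MvPolynomial.eval₂_sub, MvPolynomial.eval₂_rename, MvPolynomial.eval₂_mul,
      MvPolynomial.eval₂_C, MvPolynomial.eval₂_X, map_pow, ← hU'] at h2

end Units

section HenselSol

variable {L : Type u} [Field L] {Γ : Type v} [LinearOrderedCommGroupWithZero Γ]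

lemma exists_hensel_sol {w : Valuation L Γ} (hw : IsHenselian w) {O : Type w} [CommRing O]
    {i : O →+* w.valuationSubring} {σ : Type} {τ : Γ} (hτ0 : 0 < τ) (hτ1 : τ < 1)
    {F H : MvPolynomial (Option σ) O} {x : Option σ → w.valuationSubring} {m l : ℕ}
    (hF : w (F.eval₂ i x : w.valuationSubring) ≤ τ ^ (2 * m + l + 1))
    (hF' : w ((MvPolynomial.pderiv none F).eval₂ i x : w.valuationSubring) = τ ^ m)
    (hH : w (H.eval₂ i x : w.valuationSubring) = τ ^ l) :
    ∃ y : Option σ → w.valuationSubring, F.eval₂ i y = 0 ∧ H.eval₂ i y ≠ 0 := by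
  let O' := w.valuationSubring
  let g : O'[X] := (spec i (fun j => x (some j)) 1 F).comp (X + C (x none))
  have hx : (fun j : Option σ => j.elim (1 * x none) fun j => x (some j)) = x := by
    ext j
    cases j <;> simp
  have h0 : g.coeff 0 = F.eval₂ i x := by
    rw [coeff_zero_eq_eval_zero, eval_comp, eval_add, eval_X, eval_C, zero_add, eval_spec, hx]
  have h1 : g.coeff 1 = (MvPolynomial.pderiv none F).eval₂ i x := by
    have : g.coeff 1 = g.derivative.eval 0 := by
      rw [← coeff_zero_eq_eval_zero, coeff_derivative]
      simp
    rw [this, derivative_comp, derivative_spec]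
    simp only [derivative_add, derivative_X, derivative_C, add_zero, map_one, one_mul, eval_comp,
      eval_add, eval_X, eval_C, zero_add, eval_spec]
    rw [← hx]
    simp
  obtain ⟨y, hy, hyv⟩ := exists_root_of_lt w hw (g.map w.valuationSubring.subtype) 1
    (fun j => by
      rw [coeff_map]
      exact (g.coeff j).2) (by
      rw [coeff_map, coeff_map, h0, h1, mul_one]
      refine hF.trans_lt ?_
      change _ < (w ((MvPolynomial.pderiv none F).eval₂ i x : w.valuationSubring)) ^ 2
      rw [hF', ← pow_mul]
      exact pow_lt_pow_right_of_lt_one₀ hτ0 hτ1 (by omega))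
  rw [coeff_map, coeff_map, h0, h1] at hyv
  have hyv' : w y ≤ τ ^ (m + l + 1) := by
    have h2 : w y * τ ^ m ≤ τ ^ (m + l + 1) * τ ^ m := by
      rw [← pow_add, ← hF']
      refine hyv.trans (hF.trans_eq ?_)
      congr 1
      omega
    exact le_of_mul_le_mul_right h2 (pow_pos hτ0 m)
  have hy1 : w y ≤ 1 := hyv'.trans (pow_le_one₀ zero_le hτ1.le)
  let Y : O' := ⟨y, hy1⟩
  let z : Option σ → O' := fun j => j.elim (Y + x none) fun j => x (some j)
  refine ⟨z, ?_, fun h2 => ?_⟩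
  · have h2 : g.eval Y = 0 := by
      apply Subtype.ext
      have h3 : w.valuationSubring.subtype (g.eval Y) = 0 := by
        rw [← eval₂_hom, ← eval_map]
        exact hy
      exact h3
    rw [eval_comp, eval_add, eval_X, eval_C, eval_spec] at h2
    simpa only [one_mul] using h2
  · have h3 : Y ∣ H.eval₂ i z - H.eval₂ i x := by
      refine dvd_eval₂_sub_eval₂ i (fun j => ?_) H
      cases j <;> simp [z]
    rw [h2, zero_sub, dvd_neg] at h3
    obtain ⟨c, hc⟩ := h3
    have h4 : w (H.eval₂ i x : w.valuationSubring) ≤ τ ^ (m + l + 1) := by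
      rw [hc]
      change w (y * c) ≤ _
      rw [map_mul]
      exact (mul_le_of_le_one_right' c.2).trans hyv'
    rw [hH] at h4
    exact absurd h4 (pow_lt_pow_right_of_lt_one₀ hτ0 hτ1 (by omega)).not_ge

end HenselSol

end Paper

namespace Paper

section Scaling

variable {C : Type u} [Field C] {σ : Type v}

/-- The substitution multiplying all variables by `s`. -/
noncomputable def scaleVars (s : C) : MvPolynomial σ C →ₐ[C] MvPolynomial σ C :=
  MvPolynomial.aeval fun i => MvPolynomial.C s * MvPolynomial.X i

lemma eval₂_scaleVars {R : Type*} [CommRing R] (φ : C →+* R) (y : σ → R) (s : C)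
    (f : MvPolynomial σ C) :
    (scaleVars s f).eval₂ φ y = f.eval₂ φ fun i => φ s * y i := by
  have : (MvPolynomial.eval₂Hom φ y).comp (scaleVars s).toRingHom =
      MvPolynomial.eval₂Hom φ fun i => φ s * y i := by
    ext <;> simp [scaleVars]
  exact RingHom.congr_fun this f

lemma pderiv_scaleVars (s : C) (i : σ) (f : MvPolynomial σ C) :
    MvPolynomial.pderiv i (scaleVars s f) =
      MvPolynomial.C s * scaleVars s (MvPolynomial.pderiv i f) := by
  classical
  induction f using MvPolynomial.induction_on with
  | C a => simp [scaleVars]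
  | add p q hp hq => simp only [map_add, hp, hq, mul_add]
  | mul_X p j hp =>
    have h1 : scaleVars s (MvPolynomial.X j : MvPolynomial σ C) =
        MvPolynomial.C s * MvPolynomial.X j := by simp [scaleVars]
    have h2 : scaleVars s (MvPolynomial.pderiv i (p * MvPolynomial.X j)) =
        scaleVars s (MvPolynomial.pderiv i p) * (MvPolynomial.C s * MvPolynomial.X j) +
          scaleVars s p * Pi.single (M := fun _ => MvPolynomial σ C) i 1 j := by
      rw [MvPolynomial.pderiv_mul, map_add, map_mul, map_mul, h1, MvPolynomial.pderiv_X]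
      by_cases hij : j = i
      · subst hij
        simp
      · simp [Pi.single_eq_of_ne hij]
    rw [h2, map_mul, h1, MvPolynomial.pderiv_mul, hp, MvPolynomial.pderiv_C_mul,
      MvPolynomial.pderiv_X]
    by_cases hij : j = i
    · subst hij
      simp
      ring
    · simp [Pi.single_eq_of_ne hij]
      ring

variable {u : Valuation C Zm0} {π : C}

lemma exists_mul_pow_le (hπ : u π < 1) (x : C) : ∃ k : ℕ, ∀ l ≥ k, u (π ^ l * x) ≤ 1 := by
  by_cases hx : x = 0
  · exact ⟨0, fun l _ => by simp [hx]⟩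
  have hux : u x ≠ 0 := (Valuation.ne_zero_iff u).2 hx
  obtain ⟨k, hk⟩ := exists_pow_lt₀ hπ (Units.mk0 (u x)⁻¹ (inv_ne_zero hux))
  refine ⟨k, fun l hl => ?_⟩
  rw [map_mul, map_pow]
  refine (mul_le_mul_left (pow_le_pow_right_of_le_one' hπ.le hl) _).trans ?_
  exact (le_mul_inv_iff₀ (zero_lt_iff.2 hux)).1 (by simpa using hk.le)

lemma exists_integral_multiple (hπ : u π < 1) (f : MvPolynomial σ C) :
    ∃ (m : ℕ) (F : MvPolynomial σ u.valuationSubring),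
      F.map u.valuationSubring.subtype = MvPolynomial.C (π ^ m) * f := by
  choose k hk using exists_mul_pow_le (u := u) hπ
  refine ⟨f.support.sup fun i => k (f.coeff i), ?_⟩
  have : MvPolynomial.C (π ^ f.support.sup fun i => k (f.coeff i)) * f ∈
      Set.range (MvPolynomial.map u.valuationSubring.subtype) := by
    rw [MvPolynomial.mem_range_map_iff_coeffs_subset]
    intro c hc
    rw [Finset.mem_coe, MvPolynomial.mem_coeffs_iff] at hc
    obtain ⟨i, hi, rfl⟩ := hc
    rw [MvPolynomial.coeff_C_mul]
    by_cases h : i ∈ f.support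
    · exact ⟨⟨_, hk _ _ (Finset.le_sup (f := fun i => k (f.coeff i)) h)⟩, rfl⟩
    · rw [MvPolynomial.notMem_support_iff.1 h, mul_zero]
      exact ⟨0, rfl⟩
  exact this

end Scaling

section IntegralHypersurface

variable {C : Type u} [Field C] {u : Valuation C Zm0} {π : C}
  {E : Type u} [Field E] [Algebra C E] {Γ : Type v} [LinearOrderedCommGroupWithZero Γ]
  {v : Valuation E Γ}

/-- The inclusion of valuation rings. -/
def intHom (hEC : (v.comap (algebraMap C E)).IsEquiv u) :
    u.valuationSubring →+* v.valuationSubring :=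
  ((algebraMap C E).comp u.valuationSubring.subtype).codRestrict v.valuationSubring
    fun x => hEC.le_one_iff_le_one.2 x.2

lemma eval₂_intHom (hEC : (v.comap (algebraMap C E)).IsEquiv u) {σ : Type*}
    (F : MvPolynomial σ u.valuationSubring) (x : σ → v.valuationSubring) :
    ((F.eval₂ (intHom hEC) x : v.valuationSubring) : E) =
      (F.map u.valuationSubring.subtype).eval₂ (algebraMap C E) fun i => (x i : E) := by
  rw [MvPolynomial.eval₂_map]
  exact MvPolynomial.hom_eval₂ F (intHom hEC) v.valuationSubring.subtype x

lemma PInd.exists_integral_hypersurface {p : ℕ} [ExpChar C p] (hp : PInd p (algebraMap C E))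
    (hEC : (v.comap (algebraMap C E)).IsEquiv u) (hπu0 : u π ≠ 0) (hπu : u π < 1)
    (hπE : v (algebraMap C E π) ≤ 1)
    (hE : ∀ y : E, ∃ k : ℕ, v y * v (algebraMap C E π) ^ k ≤ 1)
    {n : ℕ} {Z : Finset (MvPolynomial (Fin n) C)} {q : MvPolynomial (Fin n) C} {a : Fin n → E}
    (hZ : ∀ z ∈ Z, z.eval₂ (algebraMap C E) a = 0) (hq : q.eval₂ (algebraMap C E) a ≠ 0) :
    ∃ (d : ℕ) (x : Option (Fin d) → v.valuationSubring)
      (F H : MvPolynomial (Option (Fin d)) u.valuationSubring),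
      F.eval₂ (intHom hEC) x = 0 ∧ (MvPolynomial.pderiv none F).eval₂ (intHom hEC) x ≠ 0 ∧
      H.eval₂ (intHom hEC) x ≠ 0 ∧
      ∀ (L : Type u) [Field L] (φ : C →+* L) (x' : Option (Fin d) → L),
        F.eval₂ (φ.comp u.valuationSubring.subtype) x' = 0 →
        H.eval₂ (φ.comp u.valuationSubring.subtype) x' ≠ 0 → Sol φ Z q := by
  obtain ⟨d, x, f, h, -, -, h1, h2, h3, h4⟩ := hp.exists_generic_hypersurface hZ hq
  have hπ0 : π ≠ 0 := (Valuation.ne_zero_iff u).1 hπu0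
  choose k hk using hE
  let N := Finset.univ.sup fun j => k (x j)
  have hx : ∀ j, v (algebraMap C E π ^ N * x j) ≤ 1 := by
    intro j
    rw [map_mul, map_pow, mul_comm]
    exact (mul_le_mul_right (pow_le_pow_right_of_le_one' hπE
      (Finset.le_sup (f := fun j => k (x j)) (Finset.mem_univ j))) _).trans (hk _)
  obtain ⟨m, F, hF⟩ := exists_integral_multiple hπu (scaleVars (π⁻¹ ^ N) f)
  obtain ⟨l, H, hH⟩ := exists_integral_multiple hπu (scaleVars (π⁻¹ ^ N) h)
  have hxx : (fun j => algebraMap C E (π⁻¹ ^ N) * (algebraMap C E π ^ N * x j)) = x := by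
    funext j
    rw [← mul_assoc, ← map_pow, ← map_mul, ← mul_pow, inv_mul_cancel₀ hπ0, one_pow, map_one,
      one_mul]
  have hpow : ∀ m, algebraMap C E (π ^ m) ≠ 0 := fun m => by simpa using fun h => (hπ0 h).elim
  refine ⟨d, fun j => ⟨_, hx j⟩, F, H, ?_, ?_, ?_, ?_⟩
  · apply Subtype.ext
    rw [eval₂_intHom, hF, MvPolynomial.eval₂_mul, eval₂_scaleVars, hxx, h1, mul_zero]
    rfl
  · intro h0
    have := congrArg Subtype.val h0
    rw [eval₂_intHom, ← MvPolynomial.pderiv_map, hF, MvPolynomial.pderiv_C_mul, pderiv_scaleVars,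
      MvPolynomial.eval₂_mul, MvPolynomial.eval₂_mul, MvPolynomial.eval₂_C, MvPolynomial.eval₂_C,
      eval₂_scaleVars, hxx] at this
    exact mul_ne_zero (hpow m) (mul_ne_zero (by simpa using fun h => (hπ0 h).elim) h2) this
  · intro h0
    have := congrArg Subtype.val h0
    rw [eval₂_intHom, hH, MvPolynomial.eval₂_mul, eval₂_scaleVars, hxx,
      MvPolynomial.eval₂_C] at this
    exact mul_ne_zero (hpow l) h3 this
  · intro L _ φ x' hF' hH'
    rw [← MvPolynomial.eval₂_map, hF, MvPolynomial.eval₂_mul, eval₂_scaleVars,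
      MvPolynomial.eval₂_C] at hF'
    rw [← MvPolynomial.eval₂_map, hH, MvPolynomial.eval₂_mul, eval₂_scaleVars] at hH'
    refine h4 L φ _ ((mul_eq_zero.1 hF').resolve_left ?_) (right_ne_zero_of_mul hH')
    simpa using fun h => (hπ0 h).elim

end IntegralHypersurface

section Abhyankar

variable {C : Type u} [Field C] {u : Valuation C Zm0}
  {E : Type u} [Field E] [Algebra C E] {Γ : Type v} [LinearOrderedCommGroupWithZero Γ]
  {v : Valuation E Γ}

/-- Lifts of algebraically independent residues are algebraically independent. -/
lemma algebraicIndependent_of_residue (hEC : (v.comap (algebraMap C E)).IsEquiv u)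
    (g : ResF u →+* ResF v) (hg : ∀ x, g (resMap u x) = resMap v (intHom hEC x))
    {ι : Type*} (T : ι → v.valuationSubring)
    (hT : ∀ P : MvPolynomial ι (ResF u), P.eval₂ g (fun i => resMap v (T i)) = 0 → P = 0) :
    AlgebraicIndependent C fun i => (T i : E) := by
  rw [algebraicIndependent_iff]
  intro P hP
  by_contra hP0
  obtain ⟨m, hm, hmax⟩ := P.support.exists_max_image (fun m => u (P.coeff m))
    (MvPolynomial.support_nonempty.2 hP0)
  have hc : P.coeff m ≠ 0 := MvPolynomial.mem_support_iff.1 hm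
  have hc' : 0 < u (P.coeff m) := zero_lt_iff.2 ((Valuation.ne_zero_iff u).2 hc)
  obtain ⟨Q, hQ⟩ : MvPolynomial.C (P.coeff m)⁻¹ * P ∈
      Set.range (MvPolynomial.map u.valuationSubring.subtype) := by
    rw [MvPolynomial.mem_range_map_iff_coeffs_subset]
    intro c hc
    rw [Finset.mem_coe, MvPolynomial.mem_coeffs_iff] at hc
    obtain ⟨i, hi, rfl⟩ := hc
    rw [MvPolynomial.coeff_C_mul]
    by_cases h : i ∈ P.support
    · refine ⟨⟨_, ?_⟩, rfl⟩
      change u ((P.coeff m)⁻¹ * P.coeff i) ≤ 1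
      rw [map_mul, map_inv₀]
      exact (inv_mul_le_one₀ hc').2 (hmax i h)
    · rw [MvPolynomial.notMem_support_iff.1 h, mul_zero]
      exact ⟨0, rfl⟩
  have h1 : Q.eval₂ (intHom hEC) T = 0 := by
    apply Subtype.ext
    rw [eval₂_intHom, hQ, MvPolynomial.eval₂_mul,
      show P.eval₂ (algebraMap C E) (fun i => (T i : E)) = 0 from hP, mul_zero]
    rfl
  have h2 := congrArg (resMap v) h1
  rw [MvPolynomial.hom_eval₂, map_zero,
    show (resMap v).comp (intHom hEC) = g.comp (resMap u) from
      RingHom.ext fun x => (hg x).symm, ← MvPolynomial.eval₂_map] at h2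
  have h3 := congrArg (MvPolynomial.coeff m) (hT _ h2)
  rw [MvPolynomial.coeff_map, MvPolynomial.coeff_zero] at h3
  have h4 : MvPolynomial.coeff m Q = 1 := by
    apply Subtype.ext
    have := congrArg (MvPolynomial.coeff m) hQ
    rw [MvPolynomial.coeff_map, MvPolynomial.coeff_C_mul, inv_mul_cancel₀ hc] at this
    exact this
  rw [h4, map_one] at h3
  exact one_ne_zero h3

lemma lt_of_not_algebraicIndependent {n : ℕ} {a : Fin n → E}
    (ha : ∀ y : E, ∃ r s : MvPolynomial (Fin n) C,
      y = MvPolynomial.aeval a r / MvPolynomial.aeval a s)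
    (hna : ¬ AlgebraicIndependent C a) {d : ℕ} {T : Fin d → E} (hT : AlgebraicIndependent C T) :
    d < n := by
  classical
  have hmem : ∀ r : MvPolynomial (Fin n) C, MvPolynomial.aeval a r ∈
      Algebra.adjoin C (Set.range a) := fun r => by
    rw [Algebra.adjoin_range_eq_range_aeval]
    exact ⟨r, rfl⟩
  have : Algebra.IsAlgebraic (Algebra.adjoin C (Set.range a)) E := ⟨fun y => by
    obtain ⟨r, s, rfl⟩ := ha y
    rw [div_eq_mul_inv]
    exact (isAlgebraic_algebraMap (⟨_, hmem r⟩ : Algebra.adjoin C (Set.range a))).mul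
      (isAlgebraic_algebraMap (⟨_, hmem s⟩ : Algebra.adjoin C (Set.range a))).inv⟩
  obtain ⟨t, ht, htb⟩ := exists_isTranscendenceBasis_subset (R := C) (Set.range a)
  have hfin : t.Finite := (Set.finite_range a).subset ht
  have := hfin.fintype
  have h1 : d ≤ Fintype.card t := by
    have h := hT.lift_cardinalMk_le_trdeg
    rw [← htb.cardinalMk_eq_trdeg] at h
    simpa using h
  have h2 : Fintype.card t ≤ Fintype.card (Set.range a) := Set.card_le_card ht
  have h3 : Fintype.card (Set.range a) ≤ n := by
    simpa using Fintype.card_range_le a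
  refine lt_of_le_of_ne (h1.trans (h2.trans h3)) fun hdn => hna ?_
  have h4 : t = Set.range a := by
    refine Set.eq_of_subset_of_card_le ht ?_
    omega
  have h5 : Function.Injective a := by
    have h6 : Fintype.card (Fin n) ≤ Fintype.card (Set.range a) := by
      rw [Fintype.card_fin]
      omega
    have h7 : Function.Bijective (Set.rangeFactorization a) :=
      (Fintype.bijective_iff_surjective_and_card _).2 ⟨Set.rangeFactorization_surjective,
        le_antisymm h6 (by simpa using h3)⟩
    exact Set.rangeFactorization_injective.1 h7.1
  subst h4
  exact htb.1.of_subtype_range h5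

end Abhyankar

end Paper

namespace Paper

open IsLocalRing

section Uniformizer

variable {K : Type*} [Field K] {Γ : Type*} [LinearOrderedCommGroupWithZero Γ] {v : Valuation K Γ}

lemma IsUniformizer.dvd {t : v.valuationSubring} (h : IsUniformizer v (t : K))
    {x : v.valuationSubring} (hx : residue v.valuationSubring x = 0) : t ∣ x := by
  have h0 : (t : K) ≠ 0 := (Valuation.ne_zero_iff v).1 h.1.ne'
  have h1 : v ((x : K) / t) ≤ 1 := by
    rw [map_div₀, div_le_one₀ h.1]
    exact h.2.2 _ ((resMap_eq_zero_iff v x).1 hx)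
  exact ⟨⟨_, h1⟩, Subtype.ext (mul_div_cancel₀ _ h0).symm⟩

lemma valuationSubring_dvd_iff {x y : v.valuationSubring} (hx : (x : K) ≠ 0) :
    x ∣ y ↔ v (y : K) ≤ v (x : K) := by
  have hx' : 0 < v (x : K) := zero_lt_iff.2 ((Valuation.ne_zero_iff v).2 hx)
  constructor
  · rintro ⟨c, rfl⟩
    change v ((x : K) * c) ≤ _
    rw [map_mul]
    exact mul_le_of_le_one_right' c.2
  · intro h
    exact ⟨⟨y / x, by
      change v ((y : K) / x) ≤ 1
      rwa [map_div₀, div_le_one₀ hx']⟩, Subtype.ext (mul_div_cancel₀ _ hx).symm⟩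

lemma exists_eq_pow_mul_unit {t : v.valuationSubring} (h : IsUniformizer v (t : K))
    (hz : ∀ y : K, y ≠ 0 → ∃ j : ℤ, v y = v (t : K) ^ j) {x : v.valuationSubring} (hx : x ≠ 0) :
    ∃ (m : ℕ) (U : v.valuationSubringˣ), x = t ^ m * U := by
  have h0 : (t : K) ≠ 0 := (Valuation.ne_zero_iff v).1 h.1.ne'
  have hx0 : (x : K) ≠ 0 := fun h => hx (Subtype.ext h)
  obtain ⟨j, hj⟩ := hz x hx0
  have hj0 : 0 ≤ j := by
    by_contra! hneg
    have h1 : v (x : K) ≤ 1 := x.2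
    rw [hj] at h1
    exact absurd h1 (one_lt_zpow_of_neg₀ h.1 h.2.1 hneg).not_ge
  lift j to ℕ using hj0
  rw [zpow_natCast] at hj
  have hpow : ((t ^ j : v.valuationSubring) : K) ≠ 0 := pow_ne_zero j h0
  obtain ⟨c, hc⟩ := (valuationSubring_dvd_iff hpow (y := x)).2 (by
    change _ ≤ v ((t : K) ^ j)
    rw [hj, map_pow])
  obtain ⟨d, hd⟩ := (valuationSubring_dvd_iff hx0 (y := t ^ j)).2 (by
    change v ((t : K) ^ j) ≤ _
    rw [hj, map_pow])
  have hcd : c * d = 1 := by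
    have h2 : t ^ j * (c * d) = t ^ j * 1 := by rw [← mul_assoc, ← hc, ← hd, mul_one]
    exact mul_left_cancel₀ (fun h => hpow (congrArg Subtype.val h)) h2
  exact ⟨j, Units.mkOfMulEqOne c d hcd, hc⟩

end Uniformizer

section Transfer

variable {C : Type u} [Field C] {u : Valuation C Zm0} {π : C}

lemma PInd.of_residue (p : ℕ) [ExpChar C p] [ExpChar (ResF u) p] {K : Type u} [Field K]
    [Algebra C K] {Γ : Type u} [LinearOrderedCommGroupWithZero Γ] {v : Valuation K Γ}
    (hKC : (v.comap (algebraMap C K)).IsEquiv u) (hπu0 : u π ≠ 0) (hπu : u π < 1)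
    (hexc : ExcellentCompletion C u) (hπv : IsUniformizer v (algebraMap C K π))
    (g : ResF u →+* ResF v) (hg : ResCompat u v g) (hP : PInd p g) :
    PInd p (algebraMap C K) := by
  intro m c hc x hx i
  by_contra hi
  obtain ⟨j, -, hj⟩ := Finset.univ.exists_max_image (fun j => v (x j)) ⟨i, Finset.mem_univ i⟩
  have hj0 : 0 < v (x j) :=
    (zero_lt_iff.2 ((Valuation.ne_zero_iff v).2 hi)).trans_le (hj i (Finset.mem_univ i))
  have h := lt_one_of_sum_pow_mem p hKC hπu hπv g hg hP (hexc.exists_bound p hπu0 hπu c hc)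
    (fun i => x i / x j) (fun i => by
      rw [map_div₀, div_le_one₀ hj0]
      exact hj i (Finset.mem_univ i)) (fun N => by
      have : ∑ i, algebraMap C K (c i) * (x i / x j) ^ p = 0 := by
        simp only [div_pow, ← mul_div_assoc, ← Finset.sum_div, hx, zero_div]
      rw [this, map_zero]
      exact zero_le) j
  rw [div_self ((Valuation.ne_zero_iff v).1 hj0.ne'), map_one] at h
  exact lt_irrefl _ h

lemma residue_intHom_eq_zero {E : Type u} [Field E] [Algebra C E] {Γ : Type v}
    [LinearOrderedCommGroupWithZero Γ] {v : Valuation E Γ}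
    (hEC : (v.comap (algebraMap C E)).IsEquiv u) {x : u.valuationSubring} (hx : u (x : C) < 1) :
    residue v.valuationSubring (intHom hEC x) = 0 :=
  (resMap_eq_zero_iff v _).2 (hEC.lt_one_iff_lt_one.2 hx)

lemma sol_of_zpow (p : ℕ) [ExpChar C p] [ExpChar (ResF u) p] (hπu : IsUniformizer u π)
    {E : Type u} [Field E] [Algebra C E] {ΓE : Type u} [LinearOrderedCommGroupWithZero ΓE]
    {vE : Valuation E ΓE} (hEC : (vE.comap (algebraMap C E)).IsEquiv u)
    (hπE : IsUniformizer vE (algebraMap C E π)) (hpCE : PInd p (algebraMap C E))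
    (hz : ∀ y : E, y ≠ 0 → ∃ j : ℤ, vE y = vE (algebraMap C E π) ^ j)
    {gE : ResF u →+* ResF vE} (hgE : ∀ x, gE (resMap u x) = resMap vE (intHom hEC x))
    (hpE : PInd p gE)
    {L : Type u} [Field L] [Algebra C L] {ΓL : Type u} [LinearOrderedCommGroupWithZero ΓL]
    {w : Valuation L ΓL} (hLC : (w.comap (algebraMap C L)).IsEquiv u) (hLhens : IsHenselian w)
    (hπw : IsUniformizer w (algebraMap C L π))
    {gL : ResF u →+* ResF w} (hgL : ∀ x, gL (resMap u x) = resMap w (intHom hLC x))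
    (hpL : PInd p gL) {R : Type u} [Field R] (κ : ResF vE →+* R) {n : ℕ}
    (hsol : ∀ (Z : Finset (MvPolynomial (Fin n) (ResF u))) (q : MvPolynomial (Fin n) (ResF u)),
      Sol (κ.comp gE) Z q → Sol gL Z q)
    {a : Fin n → E} (ha : ∀ y : E, ∃ r s : MvPolynomial (Fin n) C,
      y = MvPolynomial.aeval a r / MvPolynomial.aeval a s)
    (hna : ¬ AlgebraicIndependent C a)
    {Z : Finset (MvPolynomial (Fin n) C)} {q : MvPolynomial (Fin n) C}
    (hZ : ∀ z ∈ Z, z.eval₂ (algebraMap C E) a = 0) (hq : q.eval₂ (algebraMap C E) a ≠ 0) :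
    Sol (algebraMap C L) Z q := by
  let T : u.valuationSubring := ⟨π, hπu.2.1.le⟩
  have hT0 : ∀ {F : Type u} [Field F] [Algebra C F] {Γ : Type u}
      [LinearOrderedCommGroupWithZero Γ] {v : Valuation F Γ}
      (hFC : (v.comap (algebraMap C F)).IsEquiv u) (hπ : IsUniformizer v (algebraMap C F π)),
      intHom hFC T ≠ 0 := fun _ hπ h =>
    (Valuation.ne_zero_iff _).1 hπ.1.ne' (congrArg Subtype.val h)
  have htr : ∀ (d : ℕ) (t : Fin d → ResF vE),
      letI := gE.toAlgebra
      AlgebraicIndependent (ResF u) t → d < n := by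
    intro d t ht
    let _ := gE.toAlgebra
    choose t' ht' using fun i => residue_surjective (t i)
    refine lt_of_not_algebraicIndependent ha hna
      (algebraicIndependent_of_residue hEC gE hgE t' fun P hP => ?_)
    refine (algebraicIndependent_iff.1 ht) P ?_
    rw [← hP]
    have : (fun i => resMap vE (t' i)) = t := funext ht'
    rw [this]
    rfl
  have hspec : ∀ s : Finset (ResF vE), ∃ (A : Type u) (_ : CommRing A)
      (j : ResF u →+* A) (ψE : A →+* ResF vE) (ψL : A →+* ResF w), ψE.comp j = gE ∧
        ψL.comp j = gL ∧ (∀ a, ψE a = 0 → ψL a = 0) ∧ ∀ c ∈ s, ∃ a, ψE a = c := by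
    let _ := gE.toAlgebra
    exact PInd.exists_specialization (p := p) hpE κ gL hsol htr
  obtain ⟨k, _, _, i, hi⟩ := exists_primeField u p
  have H : ∀ (ι : Type) [Finite ι] (e : ι → vE.valuationSubring) (N : ℕ), N ≠ 0 →
      ∃ e' : ι → w.valuationSubring, ∀ G : MvPolynomial ι u.valuationSubring,
        intHom hEC T ^ N ∣ G.eval₂ (intHom hEC) e → intHom hLC T ^ N ∣ G.eval₂ (intHom hLC) e' :=
    fun ι _ e N hN => exists_local_transfer i hi (TC := T)
      (fun h => (Valuation.ne_zero_iff u).1 hπu.1.ne' (congrArg Subtype.val h)) (hT0 hEC hπE)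
      (hT0 hLC hπw) ((resMap_eq_zero_iff u T).2 hπu.2.1) (residue_intHom_eq_zero hEC hπu.2.1)
      (residue_intHom_eq_zero hLC hπu.2.1) (fun x => IsUniformizer.dvd (t := T) hπu)
      (fun x => IsUniformizer.dvd (t := intHom hEC T) hπE)
      (fun x => IsUniformizer.dvd (t := intHom hLC T) hπw) hgE hgL hpE hpL hspec e hN
  obtain ⟨d, x, F, G, hF, hF', hG, hback⟩ := hpCE.exists_integral_hypersurface hEC hπu.1.ne'
    hπu.2.1 hπE.2.1.le (fun y => by
      by_cases hy : y = 0
      · exact ⟨0, by simp [hy]⟩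
      obtain ⟨j, hj⟩ := hz y hy
      refine ⟨j.natAbs, ?_⟩
      rw [hj, ← zpow_natCast, ← zpow_add₀ hπE.1.ne']
      obtain ⟨m, hm⟩ := Int.eq_ofNat_of_zero_le (show 0 ≤ j + (j.natAbs : ℤ) by omega)
      rw [hm, zpow_natCast]
      exact pow_le_one₀ zero_le hπE.2.1.le) hZ hq
  obtain ⟨m, U, hU⟩ := exists_eq_pow_mul_unit (t := intHom hEC T) hπE hz hF'
  obtain ⟨l, V, hV⟩ := exists_eq_pow_mul_unit (t := intHom hEC T) hπE hz hG
  obtain ⟨x', hx', hunit⟩ := exists_transfer_units (iL := intHom hLC) (TC := T)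
    (residue_intHom_eq_zero hLC hπu.2.1) H x
    (fun b : Bool => if b then MvPolynomial.pderiv none F else G) (fun b => if b then m else l)
    (fun b => if b then U else V) (by
      intro b
      cases b
      · exact hV
      · exact hU) (N := 2 * m + l + 1) (by omega)
  set τ : ΓL := w (algebraMap C L π)
  have hval : ∀ {y : w.valuationSubring} {j : ℕ} (U' : w.valuationSubringˣ),
      j < 2 * m + l + 1 → intHom hLC T ^ (2 * m + l + 1) ∣ y - intHom hLC T ^ j * U' →
        w (y : L) = τ ^ j := by
    intro y j U' hj h
    have h1 : w ((y : L) - algebraMap C L π ^ j * U') ≤ τ ^ (2 * m + l + 1) := by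
      rw [← map_pow w]
      exact (valuationSubring_dvd_iff (v := w) (x := intHom hLC T ^ (2 * m + l + 1))
        (pow_ne_zero _ ((Valuation.ne_zero_iff _).1 hπw.1.ne'))).1 h
    have h2 : w (algebraMap C L π ^ j * (U' : w.valuationSubring)) = τ ^ j := by
      have h3 : w ((U' : w.valuationSubring) : L) = 1 := by
        refine le_antisymm (U' : w.valuationSubring).2 (not_lt.1 fun h3 => ?_)
        exact (residue_ne_zero_iff_isUnit _).2 U'.isUnit ((resMap_eq_zero_iff w _).2 h3)
      rw [map_mul, map_pow, h3, mul_one]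
    rw [← h2]
    refine Valuation.map_eq_of_sub_lt w (h1.trans_lt ?_)
    rw [h2]
    exact pow_lt_pow_right_of_lt_one₀ hπw.1 hπw.2.1 hj
  obtain ⟨U', hU'⟩ := hunit true
  obtain ⟨V', hV'⟩ := hunit false
  obtain ⟨y, hy, hy'⟩ := exists_hensel_sol hLhens (i := intHom hLC) (τ := τ) hπw.1 hπw.2.1
    (F := F) (H := G) (x := x') (m := m) (l := l)
    (by
      have h := hx' F (by rw [hF]; exact dvd_zero _)
      rw [← map_pow w]
      exact (valuationSubring_dvd_iff (v := w) (x := intHom hLC T ^ (2 * m + l + 1))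
        (pow_ne_zero _ ((Valuation.ne_zero_iff _).1 hπw.1.ne'))).1 h)
    (hval U' (by omega) hU') (hval V' (by omega) hV')
  refine hback L (algebraMap C L) (fun j => (y j : L)) ?_ ?_
  · rw [← MvPolynomial.eval₂_map, ← eval₂_intHom hLC, hy]
    rfl
  · rw [← MvPolynomial.eval₂_map, ← eval₂_intHom hLC]
    exact fun h => hy' (Subtype.ext h)

end Transfer

end Paper

namespace Paper

open IsLocalRing

lemma exists_residue_lift {R : Type u} {S : Type v} [CommRing R] [IsLocalRing R] [CommRing S]
    [IsLocalRing S] (f : R →+* S) (hf : ∀ x, residue R x = 0 → residue S (f x) = 0) :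
    ∃ g : ResidueField R →+* ResidueField S, ∀ x, g (residue R x) = residue S (f x) :=
  ⟨Ideal.Quotient.lift (maximalIdeal R) ((residue S).comp f)
    fun x hx => hf x ((residue_eq_zero_iff x).2 hx), fun _ => rfl⟩

lemma expChar_residue {C : Type u} [Field C] (u : Valuation C Zm0) (p : ℕ) [ExpChar C p]
    (h : ringChar C = ringChar (ResF u)) : ExpChar (ResF u) p := by
  have h1 : CharP (ResF u) (ringChar C) := by
    rw [h]
    infer_instance
  rcases ‹ExpChar C p› with _ | hp
  · rw [ringChar.eq_zero] at h1
    have := CharP.charP_to_charZero (ResF u)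
    exact ExpChar.zero
  · rw [ringChar.eq C p] at h1
    exact ExpChar.prime hp

lemma Sol.of_algebraicIndependent {C K L : Type u} [Field C] [Field K] [Algebra C K] [Field L]
    [Algebra C L] [Infinite C] {n : ℕ} {Z : Finset (MvPolynomial (Fin n) C)}
    {q : MvPolynomial (Fin n) C} {a : Fin n → K} (ha : AlgebraicIndependent C a)
    (hZ : ∀ z ∈ Z, z.eval₂ (algebraMap C K) a = 0) (hq : q.eval₂ (algebraMap C K) a ≠ 0) :
    Sol (algebraMap C L) Z q := by
  have hq0 : q ≠ 0 := by
    rintro rfl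
    exact hq (MvPolynomial.eval₂_zero _ _)
  obtain ⟨b, hb⟩ : ∃ b, MvPolynomial.eval b q ≠ 0 := by
    by_contra! h
    exact hq0 (MvPolynomial.funext fun b => by rw [h b, map_zero])
  refine ⟨fun i => algebraMap C L (b i), fun z hz => ?_, ?_⟩
  · rw [algebraicIndependent_iff.1 ha z (hZ z hz), MvPolynomial.eval₂_zero]
  · have h1 := MvPolynomial.eval₂_comp_left (algebraMap C L) (RingHom.id C) b q
    intro h2
    refine hb ((map_eq_zero (algebraMap C L)).1 ?_)
    rw [← h2]
    exact h1

lemma IsUniformizer.infinite {C : Type u} [Field C] {Γ : Type*} [LinearOrderedCommGroupWithZero Γ]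
    {u : Valuation C Γ} {π : C} (h : IsUniformizer u π) : Infinite C :=
  Infinite.of_injective (fun j : ℕ => π ^ j) fun i j hij =>
    (pow_right_strictAnti₀ h.1 h.2.1).injective (by
      have := congrArg u hij
      simpa only [map_pow] using this)

end Paper

namespace Paper

/-- Theorem 1.4 / Theorem `thm:En`(1a) of the paper.
Let `(C, u)` be an equicharacteristic `ℤ`-valued field with uniformizer `π` such that `O_u` is
excellent, and let `(K, v)` and `(L, w)` be henselian valued field extensions of `(C, u)` in
which `π` is still a uniformizer, with `Kv/Cu` and `Lw/Cu` separable.  If `(R4_n)` holds and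
`Th_{∃_n}(Kv, Cu) ⊆ Th_{∃_n}(Lw, Cu)`, then `Th_{∃_n}(K, C) ⊆ Th_{∃_n}(L, C)`. -/
theorem statement0 (n : ℕ)
    -- the `ℤ`-valued field `(C, u)`, equicharacteristic, with uniformizer `π`,
    -- whose valuation ring is excellent
    (C : Type u) [Field C] (u : Valuation C Zm0) (hZ : Function.Surjective u)
    (hequichar : ringChar C = ringChar (ResF u))
    (π : C) (hπu : IsUniformizer u π)
    (hexc : ExcellentCompletion C u)
    -- the henselian extension `(K, v)` with uniformizer `π`
    (K : Type u) [Field K] [Algebra C K]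
    (ΓK : Type u) [LinearOrderedCommGroupWithZero ΓK] (v : Valuation K ΓK)
    (hKC : (v.comap (algebraMap C K)).IsEquiv u)
    (hKhens : IsHenselian v) (hπv : IsUniformizer v (algebraMap C K π))
    -- the henselian extension `(L, w)` with uniformizer `π`
    (L : Type u) [Field L] [Algebra C L]
    (ΓL : Type u) [LinearOrderedCommGroupWithZero ΓL] (w : Valuation L ΓL)
    (hLC : (w.comap (algebraMap C L)).IsEquiv u)
    (hLhens : IsHenselian w) (hπw : IsUniformizer w (algebraMap C L π))
    -- the residue field extensions `Kv/Cu` and `Lw/Cu`, both separable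
    (gK : ResF u →+* ResF v) (hgK : ResCompat u v gK) (hsepK : IsSepExtHom gK)
    (gL : ResF u →+* ResF w) (hgL : ResCompat u w gL) (hsepL : IsSepExtHom gL)
    -- `(R4_n)`
    (hR4 : R4N.{u} n)
    -- `Th_{∃_n}(Kv, Cu) ⊆ Th_{∃_n}(Lw, Cu)`
    (hres : ThRingSub (fun {k} φ => IsExistsN n φ) (ResF v) gK (ResF w) gL) :
    -- `Th_{∃_n}(K, C) ⊆ Th_{∃_n}(L, C)`
    ThRingSub (fun {k} φ => IsExistsN n φ) K (algebraMap C K) L (algebraMap C L) := by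
  obtain ⟨p, _⟩ := ExpChar.exists C
  have := expChar_residue u p hequichar
  have hPK : PInd p gK := PInd.of_isSepExtHom hsepK
  have hPL : PInd p gL := PInd.of_isSepExtHom hsepL
  have hπu0 : u π ≠ 0 := hπu.1.ne'
  refine thRingSub_of_sol _ _ fun Z q hK => ?_
  obtain ⟨a, haZ, haq, hz⟩ :=
    exists_sol_zpow p hR4 hKC hπu0 hπu.2.1 hexc hKhens hπv gK hgK hPK hK
  have := hπu.infinite
  by_cases hna : AlgebraicIndependent C a
  · exact Sol.of_algebraicIndependent hna haZ haq
  let E := IntermediateField.adjoin C (Set.range a)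
  let vE : Valuation E ΓK := v.comap (algebraMap E K)
  have hEC : (vE.comap (algebraMap C E)).IsEquiv u := hKC
  have hπE : IsUniformizer vE (algebraMap C E π) := ⟨hπv.1, hπv.2.1, fun x => hπv.2.2 x⟩
  obtain ⟨gE, hgE⟩ := exists_residue_lift (intHom hEC) fun x hx =>
    residue_intHom_eq_zero hEC ((resMap_eq_zero_iff u x).1 hx)
  obtain ⟨κ, hκ⟩ := exists_residue_lift (R := vE.valuationSubring) (S := v.valuationSubring)
    (((algebraMap E K).comp vE.valuationSubring.subtype).codRestrict v.valuationSubring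
      fun x => x.2) fun x hx => (resMap_eq_zero_iff v _).2 ((resMap_eq_zero_iff vE x).1 hx)
  have hκgE : κ.comp gE = gK := by
    refine RingHom.ext fun y => ?_
    obtain ⟨x, rfl⟩ := IsLocalRing.residue_surjective y
    rw [RingHom.comp_apply, hgE, hκ]
    exact (hgK x _).symm
  have hpE : PInd p gE := PInd.of_comp (ψ := κ) (by rwa [hκgE])
  let a' : Fin n → E := fun i => ⟨a i, IntermediateField.subset_adjoin C _ ⟨i, rfl⟩⟩
  have heval : ∀ r : MvPolynomial (Fin n) C,
      ((r.eval₂ (algebraMap C E) a' : E) : K) = r.eval₂ (algebraMap C K) a := fun r =>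
    MvPolynomial.hom_eval₂ r (algebraMap C E) (algebraMap E K) a'
  refine sol_of_zpow p hπu hEC hπE ?_ ?_ hgE hpE hLC hLhens hπw (fun x => hgL x _) hPL κ
    (fun Z q h => sol_iff_of_thRingSub gK gL hres (hκgE ▸ h)) (a := a') ?_ ?_ ?_ ?_
  · refine PInd.of_comp (ψ := algebraMap E K) ?_
    exact PInd.of_residue p hKC hπu0 hπu.2.1 hexc hπv gK hgK hPK
  · exact fun y hy => hz y y.2 fun h => hy (Subtype.ext h)
  · intro y
    obtain ⟨r, s, h⟩ := (IntermediateField.mem_adjoin_range_iff C a (y : K)).1 y.2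
    refine ⟨r, s, Subtype.ext (h.trans ?_)⟩
    rw [IntermediateField.coe_div]
    exact congrArg₂ _ (heval r).symm (heval s).symm
  · exact fun h => hna (h.map' (f := IsScalarTower.toAlgHom C E K) (algebraMap E K).injective)
  · exact fun z hz => Subtype.ext ((heval z).trans (haZ z hz))
  · exact fun h => haq ((heval q).symm.trans (congrArg Subtype.val h))

end Paper
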